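/- arXiv:2401.05259 — 13 statements merged into one kernel-verified Lean document; each statement's English description precedes it below -/
import Mathlib

section
/- Let (V, dist) be a metric space with at least five points. If every triangle in V is degenerate, then (V, dist) is isometric to a subset of the real line with the usual Euclidean metric (i.e., there exists an isometric embedding of V into ℝ). -/
/-- `[r s t]`: `r`, `s`, `t` are pairwise distinct and `d r s + d s t = d r t`,
with respect to the distance function `d`. -/
def MBtw {V : Type*} (d : V → V → ℝ) (r s t : V) : Prop :=
  r ≠ s ∧ s ≠ t ∧ r ≠ t ∧ d r s + d s t = d r t

/-- The triangle `{r, s, t}` is degenerate: some ordering of its points satisfies `MBtw`. -/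
def TriDegen {V : Type*} (d : V → V → ℝ) (r s t : V) : Prop :=
  MBtw d r s t ∨ MBtw d s r t ∨ MBtw d r t s

/-- A rectangle-like quadruple with sides `p, q` and diagonals `p + q` admits no fifth point. -/
theorem no_fifth (p q w x y z : ℝ) (hp : 0 < p) (hq : 0 < q) (hw : 0 < w) (hx : 0 < x)
    (hy : 0 < y) (hz : 0 < z)
    (h1 : w + y = p + q ∨ w = y + (p + q) ∨ y = w + (p + q))
    (h2 : x + z = p + q ∨ x = z + (p + q) ∨ z = x + (p + q))
    (h3 : w + x = p ∨ w = x + p ∨ x = w + p)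
    (h4 : x + y = q ∨ x = y + q ∨ y = x + q)
    (h5 : y + z = p ∨ y = z + p ∨ z = y + p)
    (h6 : z + w = q ∨ z = w + q ∨ w = z + q) : False := by
  rcases h1 with h1 | h1 | h1 <;> rcases h3 with h3 | h3 | h3 <;> (try linarith) <;>
  rcases h4 with h4 | h4 | h4 <;> (try linarith) <;>
  rcases h6 with h6 | h6 | h6 <;> (try linarith) <;>
  rcases h5 with h5 | h5 | h5 <;> (try linarith) <;>
  rcases h2 with h2 | h2 | h2 <;> linarith

theorem no_fifth_pt {V : Type*} [MetricSpace V]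
    (h3 : ∀ r s t : V, dist r s + dist s t = dist r t ∨ dist r s + dist r t = dist s t ∨
      dist r t + dist s t = dist r s)
    (a b c d e : V) (hab : a ≠ b) (hbc : b ≠ c)
    (ha : e ≠ a) (hb : e ≠ b) (hc : e ≠ c) (hd : e ≠ d)
    (h1 : dist a b = dist c d) (h2 : dist b c = dist a d) (hac : dist a c = dist a b + dist b c)
    (hbd : dist b d = dist a b + dist b c) : False := by
  have k : ∀ u v : V, dist e u + dist e v = dist u v ∨ dist e u = dist e v + dist u v ∨
      dist e v = dist e u + dist u v := by
    intro u v
    rcases h3 e u v with h | h | h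
    · right; right; linarith
    · left; linarith
    · right; left; linarith
  have k1 := k a c
  have k2 := k b d
  have k3 := k a b
  have k4 := k b c
  have k5 := k c d
  have k6 := k d a
  rw [hac] at k1
  rw [hbd] at k2
  rw [← h1] at k5
  rw [dist_comm d a, ← h2] at k6
  exact no_fifth (dist a b) (dist b c) (dist e a) (dist e b) (dist e c) (dist e d)
    (dist_pos.2 hab) (dist_pos.2 hbc) (dist_pos.2 ha) (dist_pos.2 hb) (dist_pos.2 hc)
    (dist_pos.2 hd) k1 k2 k3 k4 k5 k6

/-- Four points with all triples degenerate: linear or one of three exceptional patterns. -/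
theorem four (r s t u v w F G : ℝ) (hr : 0 < r) (hs : 0 < s) (ht : 0 < t) (hu : 0 < u)
    (hv : 0 < v) (hw : 0 < w)
    (h1 : (F = -s ∧ u = s + r) ∨ (F = s ∧ (s = r + u ∨ r = s + u)))
    (h2 : (G = -t ∧ v = t + r) ∨ (G = t ∧ (t = r + v ∨ r = t + v)))
    (h3 : s + t = w ∨ s = t + w ∨ t = s + w)
    (h4 : u + v = w ∨ u = v + w ∨ v = u + w) :
    (F - G = w ∨ F - G = -w) ∨
    (r = w ∧ s = v ∧ t = u ∧ (r = s + t ∨ s = r + t ∨ t = r + s)) := by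
  rcases h1 with ⟨rfl, h1⟩ | ⟨rfl, h1 | h1⟩ <;> rcases h2 with ⟨rfl, h2⟩ | ⟨rfl, h2 | h2⟩ <;>
  rcases h3 with h3 | h3 | h3 <;> rcases h4 with h4 | h4 | h4 <;>
  first
  | (exfalso; linarith)
  | (left; left; linarith)
  | (left; right; linarith)
  | (right; refine ⟨by linarith, by linarith, by linarith, ?_⟩
     first
     | (left; linarith)
     | (right; left; linarith)
     | (right; right; linarith))

theorem stmt0 {V : Type*} [MetricSpace V]
    (h5 : ∃ S : Finset V, S.card = 5)
    (hdeg : ∀ r s t : V, r ≠ s → s ≠ t → r ≠ t →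
      TriDegen (fun x y : V => dist x y) r s t) :
    ∃ f : V → ℝ, Isometry f := by
  classical
  obtain ⟨S, hS⟩ := h5
  have h3 : ∀ r s t : V, dist r s + dist s t = dist r t ∨ dist r s + dist r t = dist s t ∨
      dist r t + dist s t = dist r s := by
    intro r s t
    by_cases h1 : r = s
    · subst h1; simp
    by_cases h2 : s = t
    · subst h2; simp
    by_cases h4 : r = t
    · subst h4; simp [dist_comm]
    rcases hdeg r s t h1 h2 h4 with h | h | h
    · left; exact h.2.2.2
    · right; left; have := h.2.2.2; simp only [dist_comm s r] at this; exact this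
    · right; right; have := h.2.2.2; simp only [dist_comm t s] at this; exact this
  obtain ⟨a, -, b, -, hab⟩ := Finset.one_lt_card.1 (show 1 < S.card by omega)
  let f : V → ℝ := fun x => if dist b x = dist a x + dist a b then -dist a x else dist a x
  have hf : ∀ x, (f x = -dist a x ∧ dist b x = dist a x + dist a b) ∨
      (f x = dist a x ∧ (dist a x = dist a b + dist b x ∨ dist a b = dist a x + dist b x)) := by
    intro x
    by_cases h : dist b x = dist a x + dist a b
    · left; exact ⟨if_pos h, h⟩
    · right
      refine ⟨if_neg h, ?_⟩
      rcases h3 a b x with k | k | k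
      · left; linarith
      · exact absurd (by linarith) h
      · right; linarith
  have hr := dist_pos.2 hab
  have fa : f a = 0 := by rcases hf a with h | h <;> simpa using h.1
  have fb : f b = dist a b := by
    rcases hf b with h | h
    · have := h.2; rw [dist_self] at this; linarith
    · exact h.1
  refine ⟨f, Isometry.of_dist_eq fun x y => ?_⟩
  have key : f x - f y = dist x y ∨ f x - f y = - dist x y := by
    by_cases hxy : x = y
    · subst hxy; simp
    by_cases hxa : x = a
    · subst hxa; rw [fa]; rcases hf y with h | h <;> rw [h.1] <;> simp
    by_cases hya : y = a
    · subst hya; rw [fa, dist_comm x]; rcases hf x with h | h <;> rw [h.1] <;> simp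
    by_cases hxb : x = b
    · subst hxb; rw [fb]
      rcases hf y with ⟨h, h' ⟩ | ⟨h, h' | h' ⟩ <;> rw [h]
      · left; linarith
      · right; linarith
      · left; linarith
    by_cases hyb : y = b
    · subst hyb; rw [fb, dist_comm x]
      rcases hf x with ⟨h, h' ⟩ | ⟨h, h' | h' ⟩ <;> rw [h]
      · right; linarith
      · left; linarith
      · right; linarith
    have k : ∀ e : V, dist e x + dist e y = dist x y ∨ dist e x = dist e y + dist x y ∨
        dist e y = dist e x + dist x y := by
      intro e
      rcases h3 e x y with h | h | h
      · right; right; linarith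
      · left; linarith
      · right; left; linarith
    rcases four (dist a b) (dist a x) (dist a y) (dist b x) (dist b y) (dist x y) (f x) (f y)
      hr (dist_pos.2 (Ne.symm hxa)) (dist_pos.2 (Ne.symm hya)) (dist_pos.2 (Ne.symm hxb))
      (dist_pos.2 (Ne.symm hyb)) (dist_pos.2 hxy) (hf x) (hf y) (k a) (k b) with h | h
    · exact h
    exfalso
    obtain ⟨e, -, he⟩ : ∃ e ∈ S, e ∉ ({a, b, x, y} : Finset V) :=
      Finset.exists_mem_notMem_of_card_lt_card (lt_of_le_of_lt Finset.card_le_four (by omega))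
    simp only [Finset.mem_insert, Finset.mem_singleton, not_or] at he
    obtain ⟨ea, eb, ex, ey⟩ := he
    obtain ⟨q1, q2, q3, q4⟩ := h
    have c1 := dist_comm a x
    have c2 := dist_comm b x
    have c3 := dist_comm a y
    have c4 := dist_comm b y
    have c5 := dist_comm x y
    have c6 := dist_comm a b
    rcases q4 with q4 | q4 | q4
    · -- diagonals ab and xy
      exact no_fifth_pt h3 a x b y e (Ne.symm hxa) hxb ea ex eb ey
        (by linarith) (by linarith) (by linarith) (by linarith)
    · -- diagonals ax and by
      exact no_fifth_pt h3 a b x y e hab (Ne.symm hxb) ea eb ex ey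
        (by linarith) (by linarith) (by linarith) (by linarith)
    · exact no_fifth_pt h3 a b y x e hab (Ne.symm hyb) ea eb ey ex
        (by linarith) (by linarith) (by linarith) (by linarith)
  rw [Real.dist_eq]
  rcases key with h | h <;> rw [h]
  · exact abs_of_nonneg dist_nonneg
  · rw [abs_neg]; exact abs_of_nonneg dist_nonneg
end

section
/- There exists a metric space on a four-point set {a,b,c,d}, with dist(a,b) = dist(b,c) = dist(c,d) = dist(d,a) = 1 and dist(a,c) = dist(b,d) = 2, in which all four triangles are degenerate but which is not isometric to any subset of the real line with the usual Euclidean metric. -/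
/-- `d` is a metric on `V`. -/
def IsMetricD {V : Type*} (d : V → V → ℝ) : Prop :=
  (∀ x y, d x y = 0 ↔ x = y) ∧ (∀ x y, d x y = d y x) ∧ (∀ x y z, d x z ≤ d x y + d y z)

/-- `(V, d)` is isometric to a subset of the real line with the Euclidean metric. -/
def LineEmbeds {V : Type*} (d : V → V → ℝ) : Prop :=
  ∃ f : V → ℝ, ∀ x y, |f x - f y| = d x y

/-- There is a metric space on a four-point set `{a, b, c, d}` with
`dist (a, b) = dist (b, c) = dist (c, d) = dist (d, a) = 1` and `dist (a, c) = dist (b, d) = 2`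
in which all four triangles are degenerate, but which is not isometric to a subset of ℝ. -/
theorem stmt1 : ∃ d : Fin 4 → Fin 4 → ℝ, IsMetricD d ∧
    d 0 1 = 1 ∧ d 1 2 = 1 ∧ d 2 3 = 1 ∧ d 3 0 = 1 ∧ d 0 2 = 2 ∧ d 1 3 = 2 ∧
    (∀ r s t : Fin 4, r ≠ s → s ≠ t → r ≠ t → TriDegen d r s t) ∧
    ¬ LineEmbeds d := by
  refine ⟨fun x y => ((min (x - y).val (y - x).val : ℕ) : ℝ), ⟨?_, ?_, ?_⟩,
    ?_, ?_, ?_, ?_, ?_, ?_, ?_, ?_⟩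
  · intro x y
    rw [Nat.cast_eq_zero]
    revert x y
    decide
  · intro x y
    rw [Nat.cast_inj]
    exact min_comm _ _
  · intro x y z
    rw [← Nat.cast_add, Nat.cast_le]
    revert x y z
    decide
  · exact (congrArg (Nat.cast : ℕ → ℝ) (by decide : min ((0 : Fin 4) - 1).val ((1 : Fin 4) - 0).val = 1)).trans Nat.cast_one
  · exact (congrArg (Nat.cast : ℕ → ℝ) (by decide : min ((1 : Fin 4) - 2).val ((2 : Fin 4) - 1).val = 1)).trans Nat.cast_one
  · exact (congrArg (Nat.cast : ℕ → ℝ) (by decide : min ((2 : Fin 4) - 3).val ((3 : Fin 4) - 2).val = 1)).trans Nat.cast_one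
  · exact (congrArg (Nat.cast : ℕ → ℝ) (by decide : min ((3 : Fin 4) - 0).val ((0 : Fin 4) - 3).val = 1)).trans Nat.cast_one
  · exact (congrArg (Nat.cast : ℕ → ℝ) (by decide : min ((0 : Fin 4) - 2).val ((2 : Fin 4) - 0).val = 2)).trans Nat.cast_ofNat
  · exact (congrArg (Nat.cast : ℕ → ℝ) (by decide : min ((1 : Fin 4) - 3).val ((3 : Fin 4) - 1).val = 2)).trans Nat.cast_ofNat
  · intro r s t
    simp only [TriDegen, MBtw, ← Nat.cast_add, Nat.cast_inj]
    revert r s t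
    decide
  · rintro ⟨f, hf⟩
    have h01 : |f 0 - f 1| = 1 := (hf 0 1).trans
      (by exact (congrArg (Nat.cast : ℕ → ℝ) (by decide : min ((0 : Fin 4) - 1).val ((1 : Fin 4) - 0).val = 1)).trans Nat.cast_one)
    have h12 : |f 1 - f 2| = 1 := (hf 1 2).trans
      (by exact (congrArg (Nat.cast : ℕ → ℝ) (by decide : min ((1 : Fin 4) - 2).val ((2 : Fin 4) - 1).val = 1)).trans Nat.cast_one)
    have h23 : |f 2 - f 3| = 1 := (hf 2 3).trans
      (by exact (congrArg (Nat.cast : ℕ → ℝ) (by decide : min ((2 : Fin 4) - 3).val ((3 : Fin 4) - 2).val = 1)).trans Nat.cast_one)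
    have h30 : |f 3 - f 0| = 1 := (hf 3 0).trans
      (by exact (congrArg (Nat.cast : ℕ → ℝ) (by decide : min ((3 : Fin 4) - 0).val ((0 : Fin 4) - 3).val = 1)).trans Nat.cast_one)
    have h02 : |f 0 - f 2| = 2 := (hf 0 2).trans
      (by exact (congrArg (Nat.cast : ℕ → ℝ) (by decide : min ((0 : Fin 4) - 2).val ((2 : Fin 4) - 0).val = 2)).trans Nat.cast_ofNat)
    have h13 : |f 1 - f 3| = 2 := (hf 1 3).trans
      (by exact (congrArg (Nat.cast : ℕ → ℝ) (by decide : min ((1 : Fin 4) - 3).val ((3 : Fin 4) - 1).val = 2)).trans Nat.cast_ofNat)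
    -- both 1 and 3 must be the midpoint of 0 and 2, so their distance would be 0
    rw [abs_eq (by norm_num)] at h02 h13
    have a1 := abs_le.mp h01.le
    have a2 := abs_le.mp h12.le
    have a3 := abs_le.mp h23.le
    have a4 := abs_le.mp h30.le
    rcases h02 with h | h <;> rcases h13 with h' | h' <;> linarith [a1.1, a1.2, a2.1, a2.2, a3.1, a3.2, a4.1, a4.2]
end

section
/- Let (V, dist) be a metric space with n points, where n ≥ 6, in which at most n − 4 triangles are nondegenerate. Then either (V, dist) is isometric to a subset of the real line with the usual Euclidean metric, or precisely n − 4 triangles are nondegenerate and moreover either the intersection of all the nondegenerate triangles consists of exactly two points, or n = 6 and the two nondegenerate triangles are disjoint. -/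
namespace Szabo

open Finset

/-- The real-line embeddability of a finite subset. -/
def Lin {V : Type*} [MetricSpace V] (S : Finset V) : Prop :=
  ∃ f : V → ℝ, ∀ x ∈ S, ∀ y ∈ S, dist x y = |f x - f y|

/-- Nondegenerate triangle as a set. -/
def Nd {V : Type*} [MetricSpace V] [DecidableEq V] (T : Finset V) : Prop :=
  T.card = 3 ∧ ¬ ∃ r s t : V, T = {r, s, t} ∧ TriDegen (fun x y : V => dist x y) r s t

/-- Equational form of degeneracy. -/
def Deg {V : Type*} [MetricSpace V] (a b c : V) : Prop :=
  dist a b + dist b c = dist a c ∨ dist b a + dist a c = dist b c ∨ dist a c + dist c b = dist a b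

open Classical in
/-- The nondegenerate triangles inside `S`. -/
noncomputable def NN {V : Type*} [MetricSpace V] [DecidableEq V] (S : Finset V) :
    Finset (Finset V) := (S.powersetCard 3).filter Nd

lemma mem_NN {V : Type*} [MetricSpace V] [DecidableEq V] {S T : Finset V} :
    T ∈ NN S ↔ T ⊆ S ∧ Nd T := by
  classical
  unfold NN
  rw [mem_filter, mem_powersetCard]
  constructor
  · rintro ⟨⟨h, _⟩, h2⟩; exact ⟨h, h2⟩
  · rintro ⟨h, h2⟩; exact ⟨⟨h, h2.1⟩, h2⟩

lemma nd_iff {V : Type*} [MetricSpace V] [DecidableEq V] {a b c : V} (hab : a ≠ b) (hbc : b ≠ c)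
    (hac : a ≠ c) : Nd ({a, b, c} : Finset V) ↔ ¬ Deg a b c := by
  unfold Nd
  have h3 : ({a, b, c} : Finset V).card = 3 := Finset.card_eq_three.2 ⟨a, b, c, hab, hac, hbc, rfl⟩
  rw [and_iff_right h3, not_iff_not]
  constructor
  · have key : ∀ r s t : V, ({a, b, c} : Finset V) = {r, s, t} →
        MBtw (fun x y : V => dist x y) r s t → Deg a b c := by
      rintro r s t h ⟨h1, h2, h3, h4⟩
      have hr : r ∈ ({a, b, c} : Finset V) := by rw [h]; simp
      have hs : s ∈ ({a, b, c} : Finset V) := by rw [h]; simp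
      have ht : t ∈ ({a, b, c} : Finset V) := by rw [h]; simp
      simp only [mem_insert, mem_singleton] at hr hs ht
      simp only at h4
      have e1 := dist_comm a b
      have e2 := dist_comm b c
      have e3 := dist_comm a c
      unfold Deg
      rcases hr with rfl | rfl | rfl <;> rcases hs with rfl | rfl | rfl <;>
        rcases ht with rfl | rfl | rfl <;> first | (exact absurd rfl ‹_›) | grind
    rintro ⟨r, s, t, h, h1 | h1 | h1⟩
    · exact key r s t h h1
    · exact key s r t (by rw [h]; ext; simp; tauto) h1
    · exact key r t s (by rw [h]; ext; simp; tauto) h1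
  · intro h
    refine ⟨a, b, c, rfl, ?_⟩
    unfold TriDegen MBtw
    rcases h with h | h | h
    · exact Or.inl ⟨hab, hbc, hac, h⟩
    · exact Or.inr (Or.inl ⟨hab.symm, hac, hbc, h⟩)
    · exact Or.inr (Or.inr ⟨hac, hbc.symm, hab, h⟩)

lemma lin_NN {V : Type*} [MetricSpace V] [DecidableEq V] {S : Finset V} (h : Lin S) :
    NN S = ∅ := by
  rw [Finset.eq_empty_iff_forall_notMem]
  intro T hT
  rw [mem_NN] at hT
  obtain ⟨a, b, c, hab, hac, hbc, rfl⟩ := Finset.card_eq_three.1 hT.2.1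
  refine (nd_iff hab hbc hac).1 hT.2 ?_
  obtain ⟨f, hf⟩ := h
  have ha := hT.1 (show a ∈ _ by simp)
  have hb := hT.1 (show b ∈ _ by simp)
  have hc := hT.1 (show c ∈ _ by simp)
  unfold Deg
  rw [hf a ha b hb, hf b hb c hc, hf a ha c hc, hf b hb a ha, hf c hc b hb]
  rcases le_total (f a) (f b) with h1 | h1 <;> rcases le_total (f b) (f c) with h2 | h2 <;>
    rcases le_total (f a) (f c) with h3 | h3 <;> grind

/-- Combinatorial core. -/
lemma core {V : Type*} [DecidableEq V] (S : Finset V) (l r : V → ℝ)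
    (hlr : ∀ x ∈ S, l x < r x)
    (hmono : ∀ x ∈ S, ∀ y ∈ S, l x + r x ≤ l y + r y → l x ≤ l y ∧ r x ≤ r y)
    (hinj : ∀ x ∈ S, ∀ y ∈ S, x ≠ y → l x + r x ≠ l y + r y)
    (hcross : ∀ x ∈ S, ∀ y ∈ S, l x ≤ r y)
    (E : Finset (Finset V))
    (hE : ∀ x ∈ S, ∀ y ∈ S, l x ≠ l y → r x ≠ r y → l x ≠ r y → l y ≠ r x → {x, y} ∈ E)
    (hne : 2 ≤ S.card) :
    (∃ c, ∀ x ∈ S, l x = c ∨ r x = c) ∨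
    (∃ z ∈ S, ∃ F ⊆ E, S.card ≤ F.card + 3 ∧ ∀ e ∈ F, z ∈ e) ∨ S.card ≤ E.card + 2 := by
  have hSne : S.Nonempty := Finset.card_pos.1 (by omega)
  obtain ⟨u, hu, humin⟩ := S.exists_min_image (fun x => l x + r x) hSne
  obtain ⟨w, hw, hwmax⟩ := S.exists_max_image (fun x => l x + r x) hSne
  have hul : ∀ x ∈ S, l u ≤ l x ∧ r u ≤ r x := fun x hx => hmono u hu x hx (humin x hx)
  have hwl : ∀ x ∈ S, l x ≤ l w ∧ r x ≤ r w := fun x hx => hmono x hx w hw (hwmax x hx)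
  have huw : u ≠ w := by
    rintro rfl
    obtain ⟨y, hy, hyu⟩ := Finset.exists_mem_ne (by omega : 1 < S.card) u
    exact hinj y hy u hu hyu (le_antisymm (hwmax y hy) (humin y hy))
  -- star construction
  have star : ∀ z ∈ S, ∀ K ⊆ S, z ∉ K → (∀ k ∈ K, {z, k} ∈ E) → S.card ≤ K.card + 3 →
      (∃ z ∈ S, ∃ F ⊆ E, S.card ≤ F.card + 3 ∧ ∀ e ∈ F, z ∈ e) := by
    intro z hz K hK hzK hKE hc
    refine ⟨z, hz, K.image (fun k => {z, k}), ?_, ?_, ?_⟩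
    · intro e he
      obtain ⟨k, hk, rfl⟩ := mem_image.1 he
      exact hKE k hk
    · rw [card_image_of_injOn]
      · exact hc
      · intro a ha b hb hab
        have h1 : a ∈ ({z, b} : Finset V) := by
          rw [← show ({z, a} : Finset V) = {z, b} from hab]; simp
        simp only [mem_insert, mem_singleton] at h1
        rcases h1 with rfl | h1
        · exact absurd ha hzK
        · exact h1
    · intro e he
      obtain ⟨k, hk, rfl⟩ := mem_image.1 he
      simp
  -- double-star construction
  have dstar : ∀ K ⊆ S, u ∉ K → w ∉ K → (∀ k ∈ K, {u, k} ∈ E ∨ {w, k} ∈ E) →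
      ∃ F ⊆ E, F.card = K.card ∧ ∀ e ∈ F, ∃ k ∈ K, e = {u, k} ∨ e = {w, k} := by
    intro K hK huK hwK hKE
    have hch : ∀ k : V, ∃ q : V, k ∈ K → (q = u ∨ q = w) ∧ {q, k} ∈ E := by
      intro k
      by_cases hk : k ∈ K
      · rcases hKE k hk with h | h
        · exact ⟨u, fun _ => ⟨Or.inl rfl, h⟩⟩
        · exact ⟨w, fun _ => ⟨Or.inr rfl, h⟩⟩
      · exact ⟨u, fun h => absurd h hk⟩
    choose q hq using hch
    refine ⟨K.image (fun k => {q k, k}), ?_, ?_, ?_⟩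
    · intro e he
      obtain ⟨k, hk, rfl⟩ := mem_image.1 he
      exact (hq k hk).2
    · rw [card_image_of_injOn]
      intro a ha b hb hab
      have h1 : a ∈ ({q b, b} : Finset V) := by
        rw [← show ({q a, a} : Finset V) = {q b, b} from hab]; simp
      simp only [mem_insert, mem_singleton] at h1
      rcases h1 with h1 | h1
      · rcases (hq b hb).1 with h2 | h2
        · exact absurd (h2 ▸ h1 ▸ ha) huK
        · exact absurd (h2 ▸ h1 ▸ ha) hwK
      · exact h1
    · intro e he
      obtain ⟨k, hk, rfl⟩ := mem_image.1 he
      rcases (hq k hk).1 with h2 | h2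
      · exact ⟨k, hk, Or.inl (by simp only [h2])⟩
      · exact ⟨k, hk, Or.inr (by simp only [h2])⟩
  have hcardK : ((S.erase u).erase w).card = S.card - 2 := by
    rw [card_erase_of_mem (mem_erase.2 ⟨huw.symm, hw⟩), card_erase_of_mem hu]; omega
  rcases lt_or_eq_of_le (hcross w hw u hu) with hc | hc
  · -- no point of type B
    by_cases h1 : l u = l w
    · left
      exact ⟨l u, fun x hx => Or.inl (le_antisymm (h1 ▸ (hwl x hx).1) (hul x hx).1)⟩
    by_cases h2 : r u = r w
    · left
      exact ⟨r u, fun x hx => Or.inr (le_antisymm (h2 ▸ (hwl x hx).2) (hul x hx).2)⟩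
    right; right
    have huwE : {u, w} ∈ E := hE u hu w hw h1 h2
      (by have := hlr u hu; have := (hul w hw).2; intro h; linarith) hc.ne
    have hcr : ∀ x ∈ S, ∀ y ∈ S, l x < r y := fun x hx y hy =>
      lt_of_le_of_lt (hwl x hx).1 (lt_of_lt_of_le hc (hul y hy).2)
    have hedge : ∀ x ∈ S, ∀ y ∈ S, l x ≠ l y → r x ≠ r y → {x, y} ∈ E := fun x hx y hy a b =>
      hE x hx y hy a b (hcr x hx y hy).ne (hcr y hy x hx).ne
    have fin : ∀ K ⊆ (S.erase u).erase w, S.card ≤ K.card + 3 →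
        (∀ k ∈ K, {u, k} ∈ E ∨ {w, k} ∈ E) → S.card ≤ E.card + 2 := by
      intro K hK hKc hKE
      have huK : u ∉ K := fun h => by simpa using hK h
      have hwK : w ∉ K := fun h => by simpa using hK h
      obtain ⟨F, hFE, hFc, hF⟩ := dstar K (fun x hx => by
        have := hK hx; simp only [mem_erase] at this; exact this.2.2) huK hwK hKE
      have hn : ({u, w} : Finset V) ∉ F := by
        intro h
        obtain ⟨k, hk, h | h⟩ := hF _ h
        · have : k ∈ ({u, w} : Finset V) := by rw [h]; simp
          simp only [mem_insert, mem_singleton] at this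
          rcases this with rfl | rfl <;> contradiction
        · have : k ∈ ({u, w} : Finset V) := by rw [h]; simp
          simp only [mem_insert, mem_singleton] at this
          rcases this with rfl | rfl <;> contradiction
      have : (insert {u, w} F).card ≤ E.card := card_le_card (insert_subset huwE hFE)
      rw [card_insert_of_notMem hn] at this
      omega
    by_cases hbad : ∃ k ∈ S, k ≠ u ∧ k ≠ w ∧ {u, k} ∉ E ∧ {w, k} ∉ E
    · obtain ⟨k, hk, hku, hkw, hk1, hk2⟩ := hbad
      have htyp : ∀ k ∈ S, k ≠ u → k ≠ w → {u, k} ∉ E → {w, k} ∉ E →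
          (l k = l u ∧ r k = r w) ∨ (l k = l w ∧ r k = r u) := by
        intro k hk hku hkw hk1 hk2
        have a1 : l u = l k ∨ r u = r k := by
          by_contra hcon; push Not at hcon
          exact hk1 (hedge u hu k hk hcon.1 hcon.2)
        have a2 : l w = l k ∨ r w = r k := by
          by_contra hcon; push Not at hcon
          exact hk2 (hedge w hw k hk hcon.1 hcon.2)
        grind
      refine fin (((S.erase u).erase w).erase k) (erase_subset _ _) ?_ ?_
      · rw [card_erase_of_mem (by simp [*]), hcardK]; omega
      · intro k' hk'
        simp only [mem_erase] at hk'
        by_contra hcon; push Not at hcon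
        have t1 := htyp k hk hku hkw hk1 hk2
        have t2 := htyp k' hk'.2.2.2 hk'.2.2.1 hk'.2.1 hcon.1 hcon.2
        have i := hinj k' hk'.2.2.2 k hk hk'.1
        have m1 := hmono k hk k' hk'.2.2.2
        have m2 := hmono k' hk'.2.2.2 k hk
        have b1 := hul w hw
        have b3 : l u < l w := lt_of_le_of_ne b1.1 h1
        have b4 : r u < r w := lt_of_le_of_ne b1.2 h2
        rcases t1 with t1 | t1 <;> rcases t2 with t2 | t2
        · exact i (by rw [t1.1, t1.2, t2.1, t2.2])
        · rcases le_total (l k + r k) (l k' + r k') with h | h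
          · have := m1 h; linarith [this.2]
          · have := m2 h; linarith [this.1]
        · rcases le_total (l k + r k) (l k' + r k') with h | h
          · have := m1 h; linarith [this.1]
          · have := m2 h; linarith [this.2]
        · exact i (by rw [t1.1, t1.2, t2.1, t2.2])
    · push Not at hbad
      refine fin ((S.erase u).erase w) subset_rfl (by omega) ?_
      intro k hk
      simp only [mem_erase] at hk
      by_cases h : {u, k} ∈ E
      · exact Or.inl h
      · exact Or.inr (hbad k hk.2.2 hk.2.1 hk.1 h)
  · -- the case `l w = r u`
    set c := r u with hcdef
    have hle : ∀ x ∈ S, l x ≤ c ∧ c ≤ r x := fun x hx => ⟨hc ▸ (hwl x hx).1, (hul x hx).2⟩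
    -- innermost points of the two groups
    obtain ⟨a, ha, hamax⟩ := (S.filter (fun x => r x = c)).exists_max_image (fun x => l x + r x)
      ⟨u, by simp [hu, hcdef]⟩
    obtain ⟨b, hb, hbmin⟩ := (S.filter (fun x => l x = c)).exists_min_image (fun x => l x + r x)
      ⟨w, by simp [hw, hc]⟩
    rw [mem_filter] at ha hb
    have hab : a ≠ b := by
      rintro rfl
      have := hlr a ha.1
      rw [ha.2, hb.2] at this
      exact lt_irrefl _ this
    set M := S.filter (fun x => l x ≠ c ∧ r x ≠ c) with hM
    set Q := (S.filter (fun x => ¬ (l x ≠ c ∧ r x ≠ c))) with hQ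
    set T := (Q.erase a).erase b with hT
    have hMQ : M.card + Q.card = S.card := card_filter_add_card_filter_not _
    have haQ : a ∈ Q := by simp [hQ, ha.1, ha.2]
    have hbQ : b ∈ Q := by simp [hQ, hb.1, hb.2]
    have hTc : T.card + 2 = Q.card := by
      have h1 := card_erase_add_one haQ
      have h2 : T.card + 1 = (Q.erase a).card := card_erase_add_one (mem_erase.2 ⟨hab.symm, hbQ⟩)
      omega
    have hMT : ∀ k ∈ M, ∀ i ∈ T, {k, i} ∈ E := by
      intro k hk i hi
      simp only [hM, hT, hQ, mem_filter, mem_erase] at hk hi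
      obtain ⟨hkS, hk1, hk2⟩ := hk
      obtain ⟨hib, hia, hiS, hi2⟩ := hi
      have c1 := hle k hkS
      have c2 : l k < c := lt_of_le_of_ne c1.1 hk1
      have c3 : c < r k := lt_of_le_of_ne c1.2 (Ne.symm hk2)
      have hi3 : r i = c ∨ l i = c := by
        by_contra hcon; push Not at hcon; exact hi2 ⟨hcon.2, hcon.1⟩
      have hli := hlr i hiS
      rcases hi3 with hi3 | hi3
      · have d1 := hamax i (by simp [hiS, hi3])
        have d2 := hinj i hiS a ha.1 hia
        have d3 : l i < l a := by
          rcases lt_or_eq_of_le d1 with h | h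
          · simp only [hi3, ha.2] at h; linarith
          · exact absurd h d2
        have d4 : l a ≤ l k := by
          rcases le_total (l a + r a) (l k + r k) with h | h
          · exact (hmono a ha.1 k hkS h).1
          · have := (hmono k hkS a ha.1 h).2
            rw [ha.2] at this; linarith
        refine hE k hkS i hiS ?_ ?_ ?_ ?_ <;> intro h <;> linarith
      · have d1 := hbmin i (by simp [hiS, hi3])
        have d2 := hinj i hiS b hb.1 hib
        have d3 : r b < r i := by
          rcases lt_or_eq_of_le d1 with h | h
          · simp only [hi3, hb.2] at h; linarith
          · exact absurd h.symm d2
        have d4 : r k ≤ r b := by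
          rcases le_total (l k + r k) (l b + r b) with h | h
          · exact (hmono k hkS b hb.1 h).2
          · have := (hmono b hb.1 k hkS h).1
            rw [hb.2] at this; linarith
        refine hE k hkS i hiS ?_ ?_ ?_ ?_ <;> intro h <;> linarith
    have hMS : M ⊆ S := filter_subset _ _
    have hTS : T ⊆ S := (erase_subset _ _).trans ((erase_subset _ _).trans (filter_subset _ _))
    have hdisj : ∀ k ∈ M, k ∉ T := by
      intro k hk hi
      simp only [hM, hT, hQ, mem_filter, mem_erase] at hk hi
      exact hi.2.2.2 hk.2
    have hM0 : M.card = 0 ∨ M.card = 1 ∨ 2 ≤ M.card := by omega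
    have hT0 : T.card = 0 ∨ T.card = 1 ∨ 2 ≤ T.card := by omega
    rcases hM0 with hM0 | hM0 | hM0
    · left
      refine ⟨c, fun x hx => ?_⟩
      rw [card_eq_zero] at hM0
      by_contra hcon; push Not at hcon
      have : x ∈ M := by rw [hM, mem_filter]; exact ⟨hx, hcon⟩
      rw [hM0] at this
      simp at this
    · right; left
      obtain ⟨k, hk⟩ := card_eq_one.1 hM0
      have hkM : k ∈ M := by rw [hk]; simp
      exact star k (hMS hkM) T hTS (hdisj k hkM) (fun i hi => hMT k hkM i hi) (by omega)
    rcases hT0 with hT0 | hT0 | hT0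
    · -- `T` empty
      right
      have hQab : ∀ x ∈ Q, x = a ∨ x = b := by
        intro x hx
        rw [card_eq_zero] at hT0
        by_contra hcon; push Not at hcon
        have : x ∈ T := by rw [hT]; simp [hx, hcon]
        rw [hT0] at this; simp at this
      have huQ : u ∈ Q := by simp [hQ, hu, ← hcdef]
      have hwQ : w ∈ Q := by simp [hQ, hw, hc]
      have hmid : ∀ x ∈ S, x ≠ u → x ≠ w → l x < c ∧ c < r x := by
        intro x hx hxu hxw
        by_cases hxM : x ∈ M
        · rw [hM, mem_filter] at hxM
          exact ⟨lt_of_le_of_ne (hle x hx).1 hxM.2.1, lt_of_le_of_ne (hle x hx).2 (Ne.symm hxM.2.2)⟩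
        · have hxQ : x ∈ Q := by
            rw [hQ, mem_filter]; refine ⟨hx, fun h => hxM ?_⟩
            rw [hM, mem_filter]; exact ⟨hx, h⟩
          have e1 := hQab x hxQ
          have e2 := hQab u huQ
          have e3 := hQab w hwQ
          grind
      have hue : ∀ x ∈ S, x ≠ u → x ≠ w → l u ≠ l x → {u, x} ∈ E := by
        intro x hx hxu hxw h
        have := hmid x hx hxu hxw
        have h2 := hlr u hu
        refine hE u hu x hx h ?_ ?_ ?_ <;> intro h3 <;> linarith
      have hwe : ∀ x ∈ S, x ≠ u → x ≠ w → r w ≠ r x → {w, x} ∈ E := by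
        intro x hx hxu hxw h
        have := hmid x hx hxu hxw
        have h2 := hlr w hw
        refine hE w hw x hx ?_ h ?_ ?_ <;> intro h3 <;> linarith
      by_cases hbad : ∃ k ∈ S, k ≠ u ∧ k ≠ w ∧ l u = l k ∧ r w = r k
      · obtain ⟨k, hk, hku, hkw, hk1, hk2⟩ := hbad
        have hKc : (((S.erase u).erase w).erase k).card + 3 = S.card := by
          have := card_erase_add_one (show k ∈ (S.erase u).erase w by simp [*])
          omega
        have hKS : (((S.erase u).erase w).erase k) ⊆ S :=
          (erase_subset _ _).trans ((erase_subset _ _).trans (erase_subset _ _))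
        by_cases hA : ∀ x ∈ ((S.erase u).erase w).erase k, r w ≠ r x
        · left
          refine star w hw (((S.erase u).erase w).erase k) hKS (by simp) ?_ (by omega)
          intro x hx
          have hx2 := hA x hx
          simp only [mem_erase] at hx
          exact hwe x hx.2.2.2 hx.2.2.1 hx.2.1 hx2
        by_cases hB : ∀ x ∈ ((S.erase u).erase w).erase k, l u ≠ l x
        · left
          refine star u hu (((S.erase u).erase w).erase k) hKS (by simp) ?_ (by omega)
          intro x hx
          have hx2 := hB x hx
          simp only [mem_erase] at hx
          exact hue x hx.2.2.2 hx.2.2.1 hx.2.1 hx2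
        right
        push Not at hA hB
        obtain ⟨x, hx, hxr⟩ := hA
        obtain ⟨y, hy, hyl⟩ := hB
        simp only [mem_erase] at hx hy
        have hxl : l u < l x := by
          refine lt_of_le_of_ne (hul x hx.2.2.2).1 fun h => ?_
          exact hinj x hx.2.2.2 k hk hx.1 (by rw [← h, ← hxr, ← hk1, ← hk2])
        have hyr : r y < r w := by
          refine lt_of_le_of_ne (hwl y hy.2.2.2).2 fun h => ?_
          exact hinj y hy.2.2.2 k hk hy.1 (by rw [h, ← hyl, ← hk1, ← hk2])
        have hx3 := hmid x hx.2.2.2 hx.2.2.1 hx.2.1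
        have hy3 := hmid y hy.2.2.2 hy.2.2.1 hy.2.1
        have hxy : {x, y} ∈ E := by
          refine hE x hx.2.2.2 y hy.2.2.2 ?_ ?_ ?_ ?_ <;> intro h <;> linarith
        obtain ⟨F, hFE, hFc, hF⟩ := dstar (((S.erase u).erase w).erase k) hKS (by simp) (by simp) (by
          intro z hz
          simp only [mem_erase] at hz
          by_cases h1 : l u = l z
          · right
            refine hwe z hz.2.2.2 hz.2.2.1 hz.2.1 fun h2 => ?_
            exact hinj z hz.2.2.2 k hk hz.1 (by rw [← h1, ← h2, ← hk1, ← hk2])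
          · exact Or.inl (hue z hz.2.2.2 hz.2.2.1 hz.2.1 h1))
        have hn : ({x, y} : Finset V) ∉ F := by
          intro h
          obtain ⟨q, hq, h | h⟩ := hF _ h
          · have : u ∈ ({x, y} : Finset V) := by rw [h]; simp
            simp only [mem_insert, mem_singleton] at this
            rcases this with h | h
            · exact hx.2.2.1 h.symm
            · exact hy.2.2.1 h.symm
          · have : w ∈ ({x, y} : Finset V) := by rw [h]; simp
            simp only [mem_insert, mem_singleton] at this
            rcases this with h | h
            · exact hx.2.1 h.symm
            · exact hy.2.1 h.symm
        have : (insert {x, y} F).card ≤ E.card := card_le_card (insert_subset hxy hFE)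
        rw [card_insert_of_notMem hn] at this
        omega
      · right
        push Not at hbad
        obtain ⟨F, hFE, hFc, hF⟩ := dstar ((S.erase u).erase w)
          ((erase_subset _ _).trans (erase_subset _ _)) (by simp) (by simp) (by
          intro z hz
          simp only [mem_erase] at hz
          by_cases h1 : l u = l z
          · exact Or.inr (hwe z hz.2.2 hz.2.1 hz.1 (hbad z hz.2.2 hz.2.1 hz.1 h1))
          · exact Or.inl (hue z hz.2.2 hz.2.1 hz.1 h1))
        have := card_le_card hFE
        omega
    · right; left
      obtain ⟨i, hi⟩ := card_eq_one.1 hT0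
      have hiT : i ∈ T := by rw [hi]; simp
      exact star i (hTS hiT) M hMS (fun h => hdisj i h hiT)
        (fun k hk => by rw [pair_comm]; exact hMT k hk i hiT) (by omega)
    · right; right
      have hcard : ((M ×ˢ T).image (fun q => ({q.1, q.2} : Finset V))).card = M.card * T.card := by
        rw [card_image_of_injOn, card_product]
        rintro ⟨k, i⟩ h1 ⟨k', i'⟩ h2 h
        simp only [coe_product, Set.mem_prod, mem_coe] at h1 h2
        simp only at h
        have g1 : k ∈ ({k', i'} : Finset V) := by rw [← h]; simp
        have g2 : i ∈ ({k', i'} : Finset V) := by rw [← h]; simp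
        simp only [mem_insert, mem_singleton] at g1 g2
        rcases g1 with g1 | g1
        · rcases g2 with g2 | g2
          · exact absurd (g2 ▸ h1.2) (hdisj k' h2.1)
          · rw [g1, g2]
        · exact absurd h2.2 (g1 ▸ hdisj k h1.1)
      have hsub : ((M ×ˢ T).image (fun q => ({q.1, q.2} : Finset V))) ⊆ E := by
        intro e he
        obtain ⟨q, hq, rfl⟩ := mem_image.1 he
        rw [mem_product] at hq
        exact hMT _ hq.1 _ hq.2
      have := card_le_card hsub
      rw [hcard] at this
      have : M.card + T.card ≤ M.card * T.card := by nlinarith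
      omega

/-- Adding a point to a linear set. -/
lemma addPoint {V : Type*} [MetricSpace V] [DecidableEq V] (S : Finset V) (v : V) (hv : v ∉ S)
    (h4 : 4 ≤ S.card) (hS : Lin S) (hN : (NN (insert v S)).card + 3 ≤ S.card)
    (hnl : ¬ Lin (insert v S)) :
    (NN (insert v S)).card + 3 = S.card ∧ ∃ z ∈ S, ∀ T ∈ NN (insert v S), v ∈ T ∧ z ∈ T := by
  have hSe := lin_NN hS
  obtain ⟨p, hp⟩ := hS
  have hvT : ∀ T ∈ NN (insert v S), v ∈ T := by
    intro T hT
    by_contra h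
    have : T ∈ NN S := by
      rw [mem_NN] at hT ⊢
      exact ⟨(subset_insert_iff_of_notMem h).1 hT.1, hT.2⟩
    rw [hSe] at this
    simp at this
  have hEc : ((NN (insert v S)).image (fun T => T.erase v)).card = (NN (insert v S)).card := by
    refine card_image_of_injOn ?_
    intro A hA B hB h
    rw [← insert_erase (hvT A hA), ← insert_erase (hvT B hB)]
    exact congrArg (insert v) h
  have hne : ∀ x ∈ S, v ≠ x := fun x hx h => hv (h ▸ hx)
  have hpi : ∀ x ∈ S, ∀ y ∈ S, x ≠ y → p x ≠ p y := by
    intro x hx y hy hxy h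
    have := hp x hx y hy
    rw [h, sub_self, abs_zero, dist_eq_zero] at this
    exact hxy this
  have tri : ∀ x ∈ S, ∀ y ∈ S, dist v x ≤ dist v y + |p x - p y| ∧
      |p x - p y| ≤ dist v x + dist v y := by
    intro x hx y hy
    rw [← hp x hx y hy]
    refine ⟨?_, ?_⟩
    · have := dist_triangle v y x; rwa [dist_comm y x] at this
    · have := dist_triangle x v y; rwa [dist_comm x v] at this
  have := core S (fun x => p x - dist v x) (fun x => p x + dist v x)
    (fun x hx => by have := dist_pos.2 (hne x hx); linarith)
    (fun x hx y hy h => by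
      have h1 : p x ≤ p y := by linarith
      have t1 := (tri x hx y hy).1
      have t2 := (tri y hy x hx).1
      rw [abs_of_nonpos (by linarith)] at t1
      rw [abs_of_nonneg (by linarith)] at t2
      constructor <;> linarith)
    (fun x hx y hy hxy h => hpi x hx y hy hxy (by linarith))
    (fun x hx y hy => by
      have := (tri x hx y hy).2
      have := le_abs_self (p x - p y)
      linarith)
    ((NN (insert v S)).image (fun T => T.erase v))
    (fun x hx y hy h1 h2 h3 h4 => by
      have hxy : x ≠ y := by rintro rfl; exact h1 rfl
      refine mem_image.2 ⟨{v, x, y}, ?_, ?_⟩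
      · rw [mem_NN]
        refine ⟨?_, ?_⟩
        · intro q hq
          simp only [mem_insert, mem_singleton] at hq
          rcases hq with rfl | rfl | rfl <;> simp [*]
        · rw [nd_iff (hne x hx) hxy (hne y hy)]
          unfold Deg
          rw [dist_comm x v, dist_comm y x, hp x hx y hy]
          rintro (h | h | h) <;> rcases abs_cases (p x - p y) with ⟨h', _⟩ | ⟨h', _⟩ <;>
            rw [h'] at h
          all_goals first
            | exact h1 (by linarith)
            | exact h2 (by linarith)
            | exact h3 (by linarith)
            | exact h4 (by linarith)
      · exact erase_insert (by simp [hne x hx, hne y hy]))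
    (by omega)
  rw [hEc] at this
  rcases this with ⟨c, hc⟩ | ⟨z, hz, F, hF, hFc, hFz⟩ | h
  · exfalso
    refine hnl ⟨fun x => if x = v then c else p x, ?_⟩
    have hcv : ∀ x ∈ S, dist v x = |c - p x| := by
      intro x hx
      have h0 : 0 ≤ dist v x := dist_nonneg
      rcases hc x hx with h | h
      · rw [← h, abs_of_nonpos] <;> linarith
      · rw [← h, abs_of_nonneg] <;> linarith
    intro x hx y hy
    rw [mem_insert] at hx hy
    rcases hx with rfl | hx <;> rcases hy with rfl | hy
    · simp
    · simp only [if_true, if_neg (hne y hy).symm]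
      exact hcv y hy
    · simp only [if_true, if_neg (hne x hx).symm]
      rw [dist_comm, abs_sub_comm]
      exact hcv x hx
    · simp only [if_neg (hne x hx).symm, if_neg (hne y hy).symm]
      exact hp x hx y hy
  · have hFE : F = (NN (insert v S)).image (fun T => T.erase v) :=
      eq_of_subset_of_card_le hF (by rw [hEc]; omega)
    refine ⟨?_, z, hz, fun T hT => ⟨hvT T hT, ?_⟩⟩
    · rw [hFE, hEc] at hFc; omega
    · exact mem_of_mem_erase (hFz (T.erase v) (by rw [hFE]; exact mem_image_of_mem _ hT))
  · omega

lemma four_aux {V : Type*} [MetricSpace V] [DecidableEq V] {a b c d : V}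
    (had : a ≠ d) (hbd : b ≠ d) (hcd : c ≠ d) (hab : a ≠ b) (hbc : b ≠ c) (hac : a ≠ c)
    (h1 : dist a b + dist b c = dist a c) (h2 : Deg a b d) (h3 : Deg a c d) (h4 : Deg b c d) :
    Lin ({a, b, c, d} : Finset V) ∨
      (dist a b = dist c d ∧ dist a c = dist b d ∧ dist a d = dist b c) := by
  have key : ∀ t : ℝ, |t| = dist a d → |dist a b - t| = dist b d → |dist a c - t| = dist c d →
      Lin ({a, b, c, d} : Finset V) := by
    intro t ht1 ht2 ht3
    refine ⟨fun x => if x = d then t else dist a x, ?_⟩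
    have e1 : |dist a b - dist a c| = dist b c := by
      rw [abs_of_nonpos] <;> linarith [dist_nonneg (x := b) (y := c)]
    have e2 : |dist a c - dist a b| = dist b c := by rw [abs_sub_comm, e1]
    have f1 : |t - dist a b| = dist b d := by rw [abs_sub_comm, ht2]
    have f2 : |t - dist a c| = dist c d := by rw [abs_sub_comm, ht3]
    intro x hx y hy
    simp only [mem_insert, mem_singleton] at hx hy
    rcases hx with rfl | rfl | rfl | rfl <;> rcases hy with rfl | rfl | rfl | rfl <;>
      simp [*, dist_comm]
  have p1 := dist_pos.2 had
  have p2 := dist_pos.2 hbd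
  have p3 := dist_pos.2 hcd
  have p4 := dist_pos.2 hab
  have p5 := dist_pos.2 hbc
  have p6 := dist_pos.2 hac
  unfold Deg at h2 h3 h4
  rw [dist_comm b a, dist_comm d b] at h2
  rw [dist_comm c a, dist_comm d c] at h3
  rw [dist_comm c b, dist_comm d c] at h4
  by_contra hcon
  push Not at hcon
  obtain ⟨hL, hO⟩ := hcon
  have k1 : ¬ (|dist a b - dist a d| = dist b d ∧ |dist a c - dist a d| = dist c d) := fun h =>
    hL (key (dist a d) (abs_of_pos p1) h.1 h.2)
  have k2 : ¬ (dist a b + dist a d = dist b d ∧ dist a c + dist a d = dist c d) := fun h =>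
    hL (key (-dist a d) (by rw [abs_neg, abs_of_pos p1])
      (by rw [sub_neg_eq_add, abs_of_pos (by linarith)]; exact h.1)
      (by rw [sub_neg_eq_add, abs_of_pos (by linarith)]; exact h.2))
  generalize dist a b = x1 at *
  generalize dist a c = x2 at *
  generalize dist a d = x3 at *
  generalize dist b c = x4 at *
  generalize dist b d = x5 at *
  generalize dist c d = x6 at *
  rcases abs_cases (x1 - x3) with ⟨q1, _⟩ | ⟨q1, _⟩ <;>
  rcases abs_cases (x2 - x3) with ⟨q2, _⟩ | ⟨q2, _⟩ <;> rw [q1, q2] at k1 <;>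
  rcases h2 with h2 | h2 | h2 <;> rcases h3 with h3 | h3 | h3 <;> rcases h4 with h4 | h4 | h4 <;>
  first
    | (exfalso; linarith)
    | exact k1 ⟨by linarith, by linarith⟩
    | exact k2 ⟨by linarith, by linarith⟩
    | exact hO (by linarith) (by linarith) (by linarith)

lemma Deg.swap {V : Type*} [MetricSpace V] {a b c : V} (h : Deg a b c) : Deg b a c := by
  have e1 := dist_comm a b
  have e2 := dist_comm b c
  have e3 := dist_comm a c
  unfold Deg at *
  rcases h with h | h | h
  · right; left; linarith
  · left; linarith
  · right; right; linarith

lemma four {V : Type*} [MetricSpace V] [DecidableEq V] {a b c d : V}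
    (hab : a ≠ b) (hac : a ≠ c) (had : a ≠ d) (hbc : b ≠ c) (hbd : b ≠ d) (hcd : c ≠ d)
    (h1 : Deg a b c) (h2 : Deg a b d) (h3 : Deg a c d) (h4 : Deg b c d) :
    Lin ({a, b, c, d} : Finset V) ∨
      (dist a b = dist c d ∧ dist a c = dist b d ∧ dist a d = dist b c) := by
  rcases h1 with h | h | h
  · exact four_aux had hbd hcd hab hbc hac h h2 h3 h4
  · rcases four_aux hbd had hcd hab.symm hac hbc h h2.swap h4 h3 with h | h
    · left
      rwa [show ({a, b, c, d} : Finset V) = {b, a, c, d} by ext; simp; tauto]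
    · right; rw [dist_comm b a] at h; exact ⟨h.1, h.2.2.symm, h.2.1.symm⟩
  · rcases four_aux had hcd hbd hac hbc.symm hab h h3 h2 h4.swap with h | h
    · left
      rwa [show ({a, b, c, d} : Finset V) = {a, c, b, d} by ext; simp; tauto]
    · right; rw [dist_comm c b] at h; exact ⟨h.2.1, h.1, h.2.2⟩

lemma NN_mono {V : Type*} [MetricSpace V] [DecidableEq V] {S T : Finset V} (h : S ⊆ T) :
    NN S ⊆ NN T := by
  intro A hA
  rw [mem_NN] at *
  exact ⟨hA.1.trans h, hA.2⟩

lemma menger_step {V : Type*} [MetricSpace V] [DecidableEq V] {S : Finset V} {v : V}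
    (hv : v ∉ S) (h4 : 4 ≤ S.card) (hS : Lin S) (hN : NN (insert v S) = ∅) :
    Lin (insert v S) := by
  by_contra h
  have := (addPoint S v hv h4 hS (by rw [hN]; simp; omega) h).1
  rw [hN, card_empty] at this
  omega

lemma menger5 {V : Type*} [MetricSpace V] [DecidableEq V] {S : Finset V} (h5 : S.card = 5)
    (hN : NN S = ∅) : Lin S := by
  have hdeg : ∀ x ∈ S, ∀ y ∈ S, ∀ z ∈ S, x ≠ y → y ≠ z → x ≠ z → Deg x y z := by
    intro x hx y hy z hz h1 h2 h3
    by_contra h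
    have : ({x, y, z} : Finset V) ∈ NN S := by
      rw [mem_NN, nd_iff h1 h2 h3]
      refine ⟨?_, h⟩
      intro q hq
      simp only [mem_insert, mem_singleton] at hq
      rcases hq with rfl | rfl | rfl <;> assumption
    rw [hN] at this
    simp at this
  by_contra hL
  have hopp : ∀ x ∈ S, ∀ y ∈ S, ∀ z ∈ S, ∀ t ∈ S, x ≠ y → x ≠ z → x ≠ t → y ≠ z → y ≠ t → z ≠ t →
      dist x y = dist z t := by
    intro x hx y hy z hz t ht h1 h2 h3 h4 h5' h6
    rcases four h1 h2 h3 h4 h5' h6 (hdeg x hx y hy z hz h1 h4 h2) (hdeg x hx y hy t ht h1 h5' h3)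
      (hdeg x hx z hz t ht h2 h6 h3) (hdeg y hy z hz t ht h4 h6 h5') with h | h
    · exfalso
      have hc4 : ({x, y, z, t} : Finset V).card = 4 := by
        rw [card_insert_of_notMem (by simp [*]), card_insert_of_notMem (by simp [*]),
          card_insert_of_notMem (by simp [*]), card_singleton]
      have hsub : ({x, y, z, t} : Finset V) ⊆ S := by
        intro q hq
        simp only [mem_insert, mem_singleton] at hq
        rcases hq with rfl | rfl | rfl | rfl <;> assumption
      obtain ⟨v, hv, hv2⟩ := exists_mem_notMem_of_card_lt_card
        (show ({x, y, z, t} : Finset V).card < S.card by omega)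
      have hins : insert v ({x, y, z, t} : Finset V) = S :=
        eq_of_subset_of_card_le (insert_subset hv hsub)
          (by rw [card_insert_of_notMem hv2]; omega)
      apply hL
      have := menger_step hv2 (by omega) h (by rw [hins]; exact hN)
      rwa [hins] at this
    · exact h.1
  obtain ⟨a, ha⟩ := card_pos.1 (by omega : 0 < S.card)
  obtain ⟨b, hb⟩ := card_pos.1 (by rw [card_erase_of_mem ha]; omega : 0 < (S.erase a).card)
  obtain ⟨c, hc⟩ := card_pos.1 (by
    rw [card_erase_of_mem hb, card_erase_of_mem ha]; omega : 0 < ((S.erase a).erase b).card)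
  obtain ⟨d, hd⟩ := card_pos.1 (by
    rw [card_erase_of_mem hc, card_erase_of_mem hb, card_erase_of_mem ha]; omega :
      0 < (((S.erase a).erase b).erase c).card)
  obtain ⟨e, he⟩ := card_pos.1 (by
    rw [card_erase_of_mem hd, card_erase_of_mem hc, card_erase_of_mem hb, card_erase_of_mem ha]
    omega : 0 < ((((S.erase a).erase b).erase c).erase d).card)
  simp only [mem_erase] at hb hc hd he
  obtain ⟨hba, hb⟩ := hb
  obtain ⟨hcb, hca, hc⟩ := hc
  obtain ⟨hdc, hdb, hda, hd⟩ := hd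
  obtain ⟨hed, hec, heb, hea, he⟩ := he
  have q1 : dist a b = dist d e :=
    hopp a ha b hb d hd e he hba.symm hda.symm hea.symm hdb.symm heb.symm hed.symm
  have q2 : dist d e = dist b c :=
    hopp d hd e he b hb c hc hed.symm hdb hdc heb hec hcb.symm
  have q3 : dist b c = dist a d :=
    hopp b hb c hc a ha d hd hcb.symm hba hdb.symm hca hdc.symm hda.symm
  have q4 : dist a d = dist b e :=
    hopp a ha d hd b hb e he hda.symm hba.symm hea.symm hdb hed.symm heb.symm
  have q5 : dist b e = dist a c :=
    hopp b hb e he a ha c hc heb.symm hba hcb.symm hea hec hca.symm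
  have hp := dist_pos.2 hba.symm
  have hD := hdeg a ha b hb c hc hba.symm hcb.symm hca.symm
  unfold Deg at hD
  rw [dist_comm b a, dist_comm c b] at hD
  rcases hD with h | h | h <;> linarith

lemma menger {V : Type*} [MetricSpace V] [DecidableEq V] : ∀ (n : ℕ) (S : Finset V),
    S.card = n + 5 → NN S = ∅ → Lin S := by
  intro n
  induction n with
  | zero => intro S h hN; exact menger5 (by omega) hN
  | succ n ih =>
    intro S h hN
    obtain ⟨v, hv⟩ := card_pos.1 (by omega : 0 < S.card)
    have hc := card_erase_of_mem hv
    have hins := insert_erase hv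
    have h1 : Lin (S.erase v) := ih _ (by omega) (by
      have := NN_mono (erase_subset v S)
      rw [hN] at this
      exact subset_empty.1 this)
    have := menger_step (notMem_erase v S) (by omega) h1 (by rw [hins]; exact hN)
    rwa [hins] at this

lemma common {V : Type*} [MetricSpace V] [DecidableEq V] {S : Finset V} {v : V} (hv : v ∈ S)
    (h6 : 6 ≤ S.card) (hL : ¬ Lin S) (hN : (NN S).card + 4 ≤ S.card) (hall : ∀ T ∈ NN S, v ∈ T) :
    (NN S).card + 4 = S.card ∧ ∃ v z, v ≠ z ∧ ∀ T ∈ NN S, v ∈ T ∧ z ∈ T := by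
  have hc := card_erase_of_mem hv
  have hins := insert_erase hv
  have he : NN (S.erase v) = ∅ := by
    rw [eq_empty_iff_forall_notMem]
    intro T hT
    have h1 := hall T (NN_mono (erase_subset v S) hT)
    exact notMem_erase v S ((mem_NN.1 hT).1 h1)
  have hlin := menger (S.card - 6) (S.erase v) (by omega) he
  have := addPoint (S.erase v) v (notMem_erase v S) (by omega) hlin (by rw [hins]; omega)
    (by rwa [hins])
  rw [hins] at this
  obtain ⟨h1, z, hz, h2⟩ := this
  exact ⟨by omega, v, z, fun h => notMem_erase v S (h ▸ hz), h2⟩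

lemma mainInd {V : Type*} [MetricSpace V] [DecidableEq V] : ∀ (n : ℕ) (S : Finset V),
    S.card = n + 6 → ¬ Lin S → (NN S).card + 4 ≤ S.card →
    (NN S).card + 4 = S.card ∧ ((∃ v z, v ≠ z ∧ ∀ T ∈ NN S, v ∈ T ∧ z ∈ T) ∨
      (n = 0 ∧ ∀ A ∈ NN S, ∀ B ∈ NN S, A ≠ B → Disjoint A B)) := by
  intro n
  induction n with
  | zero =>
    intro S h6 hL hN
    by_cases hcom : ∃ v ∈ S, ∀ T ∈ NN S, v ∈ T
    · obtain ⟨v, hv, hall⟩ := hcom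
      have := common hv (by omega) hL hN hall
      exact ⟨this.1, Or.inl this.2⟩
    · have h0 : (NN S).card = 0 ∨ (NN S).card = 1 ∨ (NN S).card = 2 := by omega
      rcases h0 with h0 | h0 | h0
      · exact absurd (menger 1 S (by omega) (card_eq_zero.1 h0)) hL
      · exfalso
        obtain ⟨T, hT⟩ := card_eq_one.1 h0
        have hTm : T ∈ NN S := by rw [hT]; simp
        rw [mem_NN] at hTm
        obtain ⟨v, hv⟩ := card_pos.1 (by have := hTm.2.1; omega : 0 < T.card)
        exact hcom ⟨v, hTm.1 hv, by rw [hT]; simpa using hv⟩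
      · refine ⟨by omega, Or.inr ⟨rfl, ?_⟩⟩
        intro A hA B hB hAB
        rw [disjoint_left]
        intro v hvA hvB
        have hpair : ({A, B} : Finset (Finset V)) = NN S :=
          eq_of_subset_of_card_le (by
            intro q hq; simp only [mem_insert, mem_singleton] at hq
            rcases hq with rfl | rfl <;> assumption) (by rw [card_pair hAB]; omega)
        refine hcom ⟨v, (mem_NN.1 hA).1 hvA, ?_⟩
        rw [← hpair]
        simp [hvA, hvB]
  | succ n ih =>
    intro S h6 hL hN
    by_cases hcom : ∃ v ∈ S, ∀ T ∈ NN S, v ∈ T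
    · obtain ⟨v, hv, hall⟩ := hcom
      have := common hv (by omega) hL hN hall
      exact ⟨this.1, Or.inl this.2⟩
    · exfalso
      have hone : ∀ v ∈ S, ∀ A ∈ NN S, v ∈ A →
          (NN S).card + 4 = S.card ∧ (NN (S.erase v)).card + 1 = (NN S).card := by
        intro v hv A hA hvA
        have hc := card_erase_of_mem hv
        have hAn : A ∉ NN (S.erase v) := fun h => notMem_erase v S ((mem_NN.1 h).1 hvA)
        have hlt : (NN (S.erase v)).card < (NN S).card :=
          card_lt_card (ssubset_iff_of_subset (NN_mono (erase_subset v S)) |>.2 ⟨A, hA, hAn⟩)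
        have hnl : ¬ Lin (S.erase v) := by
          intro h
          refine hcom ⟨v, hv, fun T hT => ?_⟩
          by_contra hvT
          have : T ∈ NN (S.erase v) := by
            rw [mem_NN] at hT ⊢
            exact ⟨subset_erase.2 ⟨hT.1, hvT⟩, hT.2⟩
          rw [lin_NN h] at this
          simp at this
        have := (ih (S.erase v) (by omega) hnl (by omega)).1
        omega
      have hne : (NN S).Nonempty := by
        rw [nonempty_iff_ne_empty]
        exact fun h => hL (menger (n + 2) S (by omega) h)
      obtain ⟨A, hA⟩ := hne
      have hcard : (NN S).card + 4 = S.card := by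
        obtain ⟨v, hv⟩ := card_pos.1 (by have := (mem_NN.1 hA).2.1; omega : 0 < A.card)
        exact (hone v ((mem_NN.1 hA).1 hv) A hA hv).1
      have hdis : ∀ A ∈ NN S, ∀ B ∈ NN S, A ≠ B → Disjoint A B := by
        intro A hA B hB hAB
        rw [disjoint_left]
        intro v hvA hvB
        have h1 := (hone v ((mem_NN.1 hA).1 hvA) A hA hvA).2
        have hAn : A ∉ NN (S.erase v) := fun h => notMem_erase v S ((mem_NN.1 h).1 hvA)
        have hBn : B ∉ NN (S.erase v) := fun h => notMem_erase v S ((mem_NN.1 h).1 hvB)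
        have hsub : insert A (insert B (NN (S.erase v))) ⊆ NN S :=
          insert_subset hA (insert_subset hB (NN_mono (erase_subset v S)))
        have := card_le_card hsub
        rw [card_insert_of_notMem (by simp [hAB, hAn]), card_insert_of_notMem hBn] at this
        omega
      have hU : ((NN S).biUnion (fun A => A)).card = (NN S).card * 3 := by
        rw [card_biUnion (fun A hA B hB h => hdis A hA B hB h)]
        exact sum_const_nat (fun T hT => (mem_NN.1 hT).2.1)
      have hUS : (NN S).biUnion (fun A => A) ⊆ S := by
        intro x hx
        obtain ⟨T, hT, hx⟩ := mem_biUnion.1 hx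
        exact (mem_NN.1 hT).1 hx
      have := card_le_card hUS
      omega

end Szabo

/-- Szabó: in an `n`-point metric space (`n ≥ 6`) with at most `n - 4` nondegenerate triangles,
either the space embeds isometrically in ℝ, or there are exactly `n - 4` nondegenerate
triangles and moreover either the intersection of all of them consists of exactly two points,
or `n = 6` and the two nondegenerate triangles are disjoint. -/
theorem stmt2 {V : Type*} [MetricSpace V] [Fintype V] [DecidableEq V]
    (n : ℕ) (hn : 6 ≤ n) (hcard : Fintype.card V = n)
    (N : Set (Finset V))
    (hN : N = {T : Finset V | T.card = 3 ∧
      ¬ ∃ r s t : V, T = {r, s, t} ∧ TriDegen (fun x y : V => dist x y) r s t})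
    (hle : N.ncard ≤ n - 4) :
    (∃ f : V → ℝ, Isometry f) ∨
      (N.ncard = n - 4 ∧
        ((⋂ T ∈ N, (T : Set V)).ncard = 2 ∨
          (n = 6 ∧ ∀ T₁ ∈ N, ∀ T₂ ∈ N, T₁ ≠ T₂ → Disjoint T₁ T₂))) := by
  classical
  have hNN : N = ↑(Szabo.NN (Finset.univ : Finset V)) := by
    ext T
    rw [hN, Finset.mem_coe, Szabo.mem_NN]
    exact ⟨fun h => ⟨Finset.subset_univ _, h⟩, fun h => h.2⟩
  have hcu : (Finset.univ : Finset V).card = n := by rw [Finset.card_univ, hcard]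
  clear hN
  subst hNN
  rw [Set.ncard_coe_finset] at hle ⊢
  by_cases hL : Szabo.Lin (Finset.univ : Finset V)
  · left
    obtain ⟨f, hf⟩ := hL
    refine ⟨f, Isometry.of_dist_eq fun x y => ?_⟩
    rw [hf x (Finset.mem_univ _) y (Finset.mem_univ _), Real.dist_eq]
  · right
    obtain ⟨h1, h2⟩ := Szabo.mainInd (n - 6) Finset.univ (by omega) hL (by omega)
    refine ⟨by omega, ?_⟩
    rcases h2 with ⟨v, z, hvz, h⟩ | ⟨h0, h⟩
    · left
      obtain ⟨A, hA, B, hB, hAB⟩ := Finset.one_lt_card.1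
        (by omega : 1 < (Szabo.NN (Finset.univ : Finset V)).card)
      have hvzc : ({v, z} : Finset V).card = 2 := Finset.card_pair hvz
      have hsub : ∀ T ∈ Szabo.NN (Finset.univ : Finset V), ({v, z} : Finset V) ⊆ T := by
        intro T hT q hq
        simp only [Finset.mem_insert, Finset.mem_singleton] at hq
        rcases hq with rfl | rfl
        · exact (h T hT).1
        · exact (h T hT).2
      have hA3 := (Szabo.mem_NN.1 hA).2.1
      have hB3 := (Szabo.mem_NN.1 hB).2.1
      have hlt : (A ∩ B).card < 3 := by
        by_contra hge
        have e1 : A ∩ B = A := Finset.eq_of_subset_of_card_le Finset.inter_subset_left (by omega)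
        have e2 : A ∩ B = B := Finset.eq_of_subset_of_card_le Finset.inter_subset_right (by omega)
        exact hAB (e1.symm.trans e2)
      have heq : ({v, z} : Finset V) = A ∩ B :=
        Finset.eq_of_subset_of_card_le (Finset.subset_inter (hsub A hA) (hsub B hB)) (by omega)
      have hI : (⋂ T ∈ (↑(Szabo.NN (Finset.univ : Finset V)) : Set (Finset V)), (T : Set V)) =
          (({v, z} : Finset V) : Set V) := by
        ext q
        simp only [Set.mem_iInter, Finset.mem_coe]
        constructor
        · intro hq
          rw [heq, Finset.mem_inter]
          exact ⟨hq A hA, hq B hB⟩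
        · intro hq T hT
          exact hsub T hT hq
      rw [hI, Set.ncard_coe_finset, hvzc]
    · right
      exact ⟨by omega, fun A hA B hB => h A hA B hB⟩
end

section
/- Let (V, dist) be a metric space with exactly five points in which precisely one triangle is nondegenerate. Then V contains a four-point subset whose induced metric subspace is circular. -/
lemma triDegen_of_eq {V : Type*} [MetricSpace V] [DecidableEq V] {r s t r' s' t' : V}
    (hrs : r ≠ s) (hst : s ≠ t) (hrt : r ≠ t)
    (h : ({r, s, t} : Finset V) = {r', s', t'})
    (hd : TriDegen (fun x y : V => dist x y) r' s' t') :
    TriDegen (fun x y : V => dist x y) r s t := by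
  have h1 : r' ∈ ({r, s, t} : Finset V) := by rw [h]; simp
  have h2 : s' ∈ ({r, s, t} : Finset V) := by rw [h]; simp
  have h3 : t' ∈ ({r, s, t} : Finset V) := by rw [h]; simp
  have e1 := dist_comm r s
  have e2 := dist_comm s t
  have e3 := dist_comm r t
  simp only [Finset.mem_insert, Finset.mem_singleton] at h1 h2 h3
  unfold TriDegen MBtw at *
  rcases h1 with rfl | rfl | rfl <;> rcases h2 with rfl | rfl | rfl <;>
    rcases h3 with rfl | rfl | rfl <;> grind

lemma proj_dist {V : Type*} [MetricSpace V] {x y u v : V} (hxy : x ≠ y) (f : V → ℝ)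
    (xy : |f x - f y| = dist x y) (xu : |f x - f u| = dist x u) (yu : |f y - f u| = dist y u)
    (xv : |f x - f v| = dist x v) (yv : |f y - f v| = dist y v)
    (uv : |f u - f v| = dist u v) :
    |(dist x u ^ 2 - dist y u ^ 2) / (2 * dist x y)
      - (dist x v ^ 2 - dist y v ^ 2) / (2 * dist x y)| = dist u v := by
  have hL : 0 < dist x y := dist_pos.mpr hxy
  rw [← sub_div, ← xu, ← yu, ← xv, ← yv]
  simp only [sq_abs]
  have : (f x - f u) ^ 2 - (f y - f u) ^ 2 - ((f x - f v) ^ 2 - (f y - f v) ^ 2)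
      = -(2 * (f x - f y) * (f u - f v)) := by ring
  rw [this, abs_div, abs_neg, abs_mul, abs_mul, abs_mul, xy, uv, abs_of_pos hL]
  have : |(2 : ℝ)| = 2 := by norm_num
  rw [this]
  field_simp

lemma degen_of_line {V : Type*} [MetricSpace V] {a b c : V} (hab : a ≠ b) (hbc : b ≠ c)
    (hac : a ≠ c) (p : V → ℝ) (h1 : |p a - p b| = dist a b) (h2 : |p b - p c| = dist b c)
    (h3 : |p a - p c| = dist a c) : TriDegen (fun x y : V => dist x y) a b c := by
  have e1 := dist_comm a b
  have e2 := dist_comm b c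
  unfold TriDegen MBtw
  grind

/-- In a five-point metric space with precisely one nondegenerate triangle, there is a
four-point subset whose induced subspace is circular, i.e. all four of its triangles are
degenerate and yet it is not isometric to a subset of the real line. -/
theorem stmt3 {V : Type*} [MetricSpace V] [Fintype V] [DecidableEq V]
    (h5 : Fintype.card V = 5)
    (hone : ∃! T : Finset V, T.card = 3 ∧
      ¬ ∃ r s t : V, T = {r, s, t} ∧ TriDegen (fun x y : V => dist x y) r s t) :
    ∃ S : Finset V, S.card = 4 ∧
      (∀ r s t : V, r ∈ S → s ∈ S → t ∈ S → r ≠ s → s ≠ t → r ≠ t →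
        TriDegen (fun x y : V => dist x y) r s t) ∧
      ¬ ∃ f : V → ℝ, ∀ x ∈ S, ∀ y ∈ S, |f x - f y| = dist x y := by
  classical
  obtain ⟨T, ⟨hT, hnd⟩, huniq⟩ := hone
  have hdeg : ∀ r s t : V, r ≠ s → s ≠ t → r ≠ t → ({r, s, t} : Finset V) ≠ T →
      TriDegen (fun x y : V => dist x y) r s t := by
    intro r s t hrs hst hrt hne
    by_contra hcon
    apply hne
    apply huniq
    refine ⟨Finset.card_eq_three.mpr ⟨r, s, t, hrs, hrt, hst, rfl⟩, ?_⟩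
    rintro ⟨r', s', t', he, hd⟩
    exact hcon (triDegen_of_eq hrs hst hrt he hd)
  have hc : (Tᶜ).card = 2 := by rw [Finset.card_compl, h5, hT]
  obtain ⟨x, y, hxy, hTc⟩ := Finset.card_eq_two.mp hc
  have hx : x ∉ T := by rw [← Finset.mem_compl, hTc]; simp
  have hy : y ∉ T := by rw [← Finset.mem_compl, hTc]; simp
  by_contra hno
  have key : ∀ u ∈ T, ∀ v ∈ T, u ≠ v →
      |(dist x u ^ 2 - dist y u ^ 2) / (2 * dist x y)
        - (dist x v ^ 2 - dist y v ^ 2) / (2 * dist x y)| = dist u v := by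
    intro u hu v hv huv
    by_contra hbad
    apply hno
    have hxu : x ≠ u := fun h => hx (h ▸ hu)
    have hxv : x ≠ v := fun h => hx (h ▸ hv)
    have hyu : y ≠ u := fun h => hy (h ▸ hu)
    have hyv : y ≠ v := fun h => hy (h ▸ hv)
    refine ⟨{x, y, u, v}, ?_, ?_, ?_⟩
    · simp [hxy, hxu, hxv, hyu, hyv, huv]
    · intro r s t hr hs ht hrs hst hrt
      apply hdeg r s t hrs hst hrt
      intro he
      have m1 : r ∈ T := by rw [← he]; simp
      have m2 : s ∈ T := by rw [← he]; simp
      have m3 : t ∈ T := by rw [← he]; simp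
      simp only [Finset.mem_insert, Finset.mem_singleton] at hr hs ht
      grind
    · rintro ⟨f, hf⟩
      apply hbad
      apply proj_dist hxy f <;> apply hf <;> simp
  obtain ⟨a, b, c, hab, hac, hbc, rfl⟩ := Finset.card_eq_three.mp hT
  apply hnd
  refine ⟨a, b, c, rfl, ?_⟩
  exact degen_of_line hab hbc hac
    (fun u => (dist x u ^ 2 - dist y u ^ 2) / (2 * dist x y))
    (key a (by simp) b (by simp) hab) (key b (by simp) c (by simp) hbc)
    (key a (by simp) c (by simp) hac)
end

section
/- Every circular four-point metric space admits a labeling of its points as 0, 1, 2, 3 such that [012], [123], [230], and [301] all hold. -/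
/-- Every circular four-point metric space (all four triangles degenerate, yet not isometric
to a subset of ℝ) admits a labeling of its points as `0, 1, 2, 3` such that `[012]`, `[123]`,
`[230]` and `[301]` all hold. -/
theorem stmt4 {V : Type*} [MetricSpace V] (h4 : Nat.card V = 4)
    (hdeg : ∀ r s t : V, r ≠ s → s ≠ t → r ≠ t →
      TriDegen (fun x y : V => dist x y) r s t)
    (hnl : ¬ ∃ f : V → ℝ, Isometry f) :
    ∃ e : Fin 4 → V, Function.Bijective e ∧
      MBtw (fun x y : V => dist x y) (e 0) (e 1) (e 2) ∧
      MBtw (fun x y : V => dist x y) (e 1) (e 2) (e 3) ∧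
      MBtw (fun x y : V => dist x y) (e 2) (e 3) (e 0) ∧
      MBtw (fun x y : V => dist x y) (e 3) (e 0) (e 1) := by
  classical
  haveI : Finite V := Nat.finite_of_card_ne_zero (by omega)
  haveI : Fintype V := Fintype.ofFinite V
  have hc4 : Fintype.card V = 4 := by rw [← Nat.card_eq_fintype_card]; exact h4
  haveI : Nontrivial V := Fintype.one_lt_card_iff_nontrivial.mp (by omega)
  obtain ⟨⟨a, c⟩, hmax⟩ := Finite.exists_max (fun p : V × V => dist p.1 p.2)
  have hmax' : ∀ u v : V, dist u v ≤ dist a c := fun u v => hmax (u, v)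
  have hac : a ≠ c := by
    obtain ⟨u, v, huv⟩ := exists_pair_ne V
    have h1 := dist_pos.mpr huv
    exact dist_pos.mp (lt_of_lt_of_le h1 (hmax' u v))
  have hcard : (({a, c} : Finset V)ᶜ).card = 2 := by
    rw [Finset.card_compl, Finset.card_pair hac, hc4]
  obtain ⟨b, d, hbd, hS⟩ := Finset.card_eq_two.mp hcard
  have hmem : ∀ v : V, (v = b ∨ v = d) ↔ ¬ (v = a ∨ v = c) := by
    intro v
    have := Finset.ext_iff.mp hS v
    simp only [Finset.mem_compl, Finset.mem_insert, Finset.mem_singleton] at this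
    exact this.symm
  have hb := (hmem b).mp (Or.inl rfl)
  have hd := (hmem d).mp (Or.inr rfl)
  push Not at hb hd
  obtain ⟨hba, hbc⟩ := hb
  obtain ⟨hda, hdc⟩ := hd
  have hall : ∀ v : V, v = a ∨ v = b ∨ v = c ∨ v = d := by
    intro v
    have := hmem v
    tauto
  have pab := dist_pos.mpr hba.symm
  have pbc := dist_pos.mpr hbc
  have pad := dist_pos.mpr hda.symm
  have pdc := dist_pos.mpr hdc
  have pbd := dist_pos.mpr hbd
  have key : ∀ v : V, v ≠ a → v ≠ c → dist a v + dist v c = dist a c := by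
    intro v hva hvc
    have h1 := hmax' a v
    have h2 := hmax' v c
    have p1 := dist_pos.mpr hva
    have p2 := dist_pos.mpr hvc
    rcases hdeg a v c hva.symm hvc hac with h | h | h
    · exact h.2.2.2
    · have := h.2.2.2
      simp only at this
      linarith
    · have := h.2.2.2
      simp only [dist_comm c v] at this
      linarith
  have kb := key b hba hbc
  have kd := key d hda hdc
  by_cases hz : |dist a b - dist a d| = dist b d
  · exfalso
    apply hnl
    refine ⟨fun v => dist a v, Isometry.of_dist_eq ?_⟩
    have hz' : |dist a d - dist a b| = dist d b := by
      rw [abs_sub_comm, dist_comm d b]; exact hz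
    have e1 : |dist a b - dist a c| = dist b c := by
      rw [← kb, abs_sub_comm, add_sub_cancel_left, abs_of_pos pbc]
    have e2 : |dist a d - dist a c| = dist d c := by
      rw [← kd, abs_sub_comm, add_sub_cancel_left, abs_of_pos pdc]
    have e1' : |dist a c - dist a b| = dist c b := by
      rw [abs_sub_comm, dist_comm c b]; exact e1
    have e2' : |dist a c - dist a d| = dist c d := by
      rw [abs_sub_comm, dist_comm c d]; exact e2
    intro u v
    rw [Real.dist_eq]
    rcases hall u with rfl | rfl | rfl | rfl <;> rcases hall v with rfl | rfl | rfl | rfl <;>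
      first
        | assumption
        | simp [dist_comm]
  · have n1 : dist a b - dist a d ≠ dist b d := by
      intro h; apply hz; rw [h, abs_of_pos pbd]
    have n2 : dist a d - dist a b ≠ dist b d := by
      intro h; apply hz; rw [abs_sub_comm, h, abs_of_pos pbd]
    have s1 : dist a b + dist a d = dist b d := by
      rcases hdeg a b d hba.symm hbd hda.symm with h | h | h <;> have h := h.2.2.2 <;>
        simp only [dist_comm b a, dist_comm d b] at h
      · exact absurd (by linarith) n2
      · exact h
      · exact absurd (by linarith) n1
    have s2 : dist b c + dist d c = dist b d := by
      rcases hdeg b c d hbc hdc.symm hbd with h | h | h <;> have h := h.2.2.2 <;>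
        simp only [dist_comm c b, dist_comm c d] at h
      · exact h
      · exact absurd (by linarith) n2
      · exact absurd (by linarith) n1
    refine ⟨![a, b, c, d], ?_, ?_, ?_, ?_, ?_⟩
    · rw [Fintype.bijective_iff_surjective_and_card]
      refine ⟨?_, by simp [hc4]⟩
      intro v
      rcases hall v with rfl | rfl | rfl | rfl
      · exact ⟨0, rfl⟩
      · exact ⟨1, rfl⟩
      · exact ⟨2, rfl⟩
      · exact ⟨3, rfl⟩
    · exact ⟨hba.symm, hbc, hac, kb⟩
    · refine ⟨hbc, hdc.symm, hbd, ?_⟩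
      change dist b c + dist c d = dist b d
      rw [dist_comm c d]; exact s2
    · refine ⟨hdc.symm, hda, hac.symm, ?_⟩
      change dist c d + dist d a = dist c a
      rw [dist_comm c d, dist_comm d a, dist_comm c a]; linarith
    · refine ⟨hda, hba.symm, hbd.symm, ?_⟩
      change dist d a + dist a b = dist d b
      rw [dist_comm d a, dist_comm d b]; linarith
end

section
/- Let V be a set with n points, where n ≥ 5. Then every set of ⌈n(n−1)(n−2)/6⌉ − n + 5 (that is, binomial(n,3) − n + 5) three-point subsets of V is an anchor in V. -/
/-- `A` is an anchor in `V`: it is a set of three-point subsets of `V` such that, for every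
metric `d` on `V`, if all triangles in `A` are degenerate then `(V, d)` is isometric to a
subset of the real line. -/
def IsAnchor {V : Type*} [DecidableEq V] (A : Finset (Finset V)) : Prop :=
  (∀ T ∈ A, T.card = 3) ∧
  ∀ d : V → V → ℝ, IsMetricD d →
    (∀ T ∈ A, ∃ r s t : V, T = {r, s, t} ∧ TriDegen d r s t) →
    LineEmbeds d

/-- The finite set `S` embeds isometrically in the line. -/
def LineOn5 {V : Type*} (d : V → V → ℝ) (S : Set V) : Prop :=
  ∃ f : V → ℝ, ∀ x ∈ S, ∀ y ∈ S, |f x - f y| = d x y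

/-- A set of points is a degenerate triangle. -/
def Dg5 {V : Type*} [DecidableEq V] (d : V → V → ℝ) (T : Finset V) : Prop :=
  ∃ r s t : V, T = {r, s, t} ∧ TriDegen d r s t

theorem LineOn5.mono {V : Type*} {d : V → V → ℝ} {S T : Set V} (h : LineOn5 d T) (hs : S ⊆ T) :
    LineOn5 d S := by
  obtain ⟨f, hf⟩ := h
  exact ⟨f, fun x hx y hy => hf x (hs hx) y (hs hy)⟩

/-- Gluing: coordinates relative to two fixed points. -/
theorem glue5 {V : Type*} {d : V → V → ℝ} (hd : IsMetricD d) (S : Set V) (x y : V) (hxy : x ≠ y)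
    (h : ∀ a ∈ S, ∀ b ∈ S, LineOn5 d {x, y, a, b}) : LineOn5 d S := by
  refine ⟨fun a => (d x a ^ 2 - d y a ^ 2 + d x y ^ 2) / (2 * d x y), fun a ha b hb => ?_⟩
  obtain ⟨g, hg⟩ := h a ha b hb
  have hD : d x y ≠ 0 := fun h0 => hxy ((hd.1 x y).1 h0)
  have e1 := hg x (by simp) y (by simp)
  have e2 := hg x (by simp) a (by simp)
  have e3 := hg y (by simp) a (by simp)
  have e4 := hg x (by simp) b (by simp)
  have e5 := hg y (by simp) b (by simp)
  have e6 := hg a (by simp) b (by simp)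
  have key : (d x a ^ 2 - d y a ^ 2 + d x y ^ 2) / (2 * d x y)
      - (d x b ^ 2 - d y b ^ 2 + d x y ^ 2) / (2 * d x y) = (g a - g b) * (g y - g x) / d x y := by
    field_simp
    rw [← e2, ← e3, ← e4, ← e5]
    simp only [sq_abs]
    ring
  show |_ - _| = _
  rw [key, abs_div, abs_mul, abs_sub_comm (g y), e1, e6]
  have : |d x y| = d x y := by rw [← e1, abs_abs]
  rw [this]
  field_simp

theorem tri5 {V : Type*} [DecidableEq V] {d : V → V → ℝ} (hd : IsMetricD d) {r s t : V}
    (h1 : r ≠ s) (h2 : s ≠ t) (h3 : r ≠ t) (h : Dg5 d {r, s, t}) :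
    d r s + d s t = d r t ∨ d r s + d r t = d s t ∨ d r t + d s t = d r s := by
  obtain ⟨a, b, c, he, hT⟩ := h
  have hs := hd.2.1
  have ha : a ∈ ({r, s, t} : Finset V) := by rw [he]; simp
  have hb : b ∈ ({r, s, t} : Finset V) := by rw [he]; simp
  have hc : c ∈ ({r, s, t} : Finset V) := by rw [he]; simp
  simp only [Finset.mem_insert, Finset.mem_singleton] at ha hb hc
  clear he
  have q1 := hs r s
  have q2 := hs r t
  have q3 := hs s t
  unfold TriDegen MBtw at hT
  have hab : a ≠ b := by tauto
  have hac : a ≠ c := by tauto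
  have hbc : b ≠ c := by tauto
  have hT' : d a b + d b c = d a c ∨ d b a + d a c = d b c ∨ d a c + d c b = d a b := by tauto
  clear hT
  rcases ha with rfl | rfl | rfl <;> rcases hb with rfl | rfl | rfl <;>
    rcases hc with rfl | rfl | rfl <;> first
    | exact absurd rfl hab
    | exact absurd rfl hac
    | exact absurd rfl hbc
    | (rcases hT' with h | h | h
       · first
         | (left; linarith)
         | (right; left; linarith)
         | (right; right; linarith)
       · first
         | (left; linarith)
         | (right; left; linarith)
         | (right; right; linarith)
       · first
         | (left; linarith)
         | (right; left; linarith)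
         | (right; right; linarith))

theorem pos5 {V : Type*} {d : V → V → ℝ} (hd : IsMetricD d) {a b : V} (h : a ≠ b) : 0 < d a b := by
  have h0 : d a b ≠ 0 := fun h0 => h ((hd.1 a b).1 h0)
  have h1 := hd.2.2 a b a
  have h2 := (hd.1 a a).2 rfl
  have h3 := hd.2.1 a b
  have : 0 ≤ d a b := by linarith
  exact lt_of_le_of_ne this (Ne.symm h0)

/-- Menger's theorem for at least five points. -/
theorem menger5 {V : Type*} [DecidableEq V] {d : V → V → ℝ} (hd : IsMetricD d) (S : Finset V)
    (hS : 5 ≤ S.card) (h : ∀ T ∈ S.powersetCard 3, Dg5 d T) : LineOn5 d (S : Set V) := by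
  have hne : (S ×ˢ S).Nonempty := by
    have : S.Nonempty := Finset.card_pos.1 (by omega)
    exact this.product this
  obtain ⟨⟨x, y⟩, hxyS, hmax⟩ := Finset.exists_max_image (S ×ˢ S) (fun p => d p.1 p.2) hne
  rw [Finset.mem_product] at hxyS
  obtain ⟨hx, hy⟩ := hxyS
  simp only at hx hy
  have hmax' : ∀ a ∈ S, ∀ b ∈ S, d a b ≤ d x y := fun a ha b hb =>
    hmax (a, b) (Finset.mem_product.2 ⟨ha, hb⟩)
  have hs := hd.2.1
  have hz : ∀ a, d a a = 0 := fun a => (hd.1 a a).2 rfl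
  have hxy : x ≠ y := by
    rintro rfl
    obtain ⟨b, hb, hbx⟩ := Finset.exists_mem_ne (by omega : 1 < S.card) x
    have := hmax' b hb x hx
    have := pos5 hd hbx
    have := hz x
    linarith
  have hD := pos5 hd hxy
  have htri : ∀ a ∈ S, ∀ b ∈ S, ∀ c ∈ S, a ≠ b → b ≠ c → a ≠ c →
      d a b + d b c = d a c ∨ d a b + d a c = d b c ∨ d a c + d b c = d a b := by
    intro a ha b hb c hc h1 h2 h3
    apply tri5 hd h1 h2 h3
    apply h
    rw [Finset.mem_powersetCard]
    refine ⟨?_, Finset.card_eq_three.2 ⟨a, b, c, h1, h3, h2, rfl⟩⟩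
    intro z hz
    simp only [Finset.mem_insert, Finset.mem_singleton] at hz
    rcases hz with rfl | rfl | rfl <;> assumption
  -- points between a diametral pair
  have hbtw : ∀ u ∈ S, ∀ v ∈ S, d u v = d x y → ∀ a ∈ S, d u a + d a v = d x y := by
    intro u hu v hv huv a ha
    have huvne : u ≠ v := by rintro rfl; have := hz u; linarith
    by_cases hau : u = a
    · subst hau; rw [hz]; linarith
    by_cases hav : a = v
    · subst hav; rw [hz]; linarith
    have p1 := pos5 hd hau
    have p2 := pos5 hd hav
    have m1 := hmax' u hu a ha
    have m2 := hmax' a ha v hv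
    rcases htri u hu a ha v hv hau hav huvne with h | h | h <;> linarith
  have hf := hbtw x hx y hy rfl
  have hpair : ∀ a ∈ S, ∀ b ∈ S, a ≠ x → a ≠ y → b ≠ x → b ≠ y → a ≠ b →
      |d x a - d x b| = d a b ∨ (d a b = d x y ∧ d x a + d x b = d x y) := by
    intro a ha b hb hax hay hbx hby hab
    have f1 := hf a ha
    have f2 := hf b hb
    have p := pos5 hd hab
    have s1 := hs a y
    have s2 := hs b y
    have t1 := htri x hx a ha b hb (Ne.symm hax) hab (Ne.symm hbx)
    have t2 := htri y hy a ha b hb (Ne.symm hay) hab (Ne.symm hby)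
    rcases t1 with h | h | h
    · left; rw [abs_sub_comm, abs_of_nonneg] <;> linarith
    · rcases t2 with h' | h' | h'
      · left; rw [abs_of_nonneg] <;> linarith
      · right; constructor <;> linarith
      · left; rw [abs_sub_comm, abs_of_nonneg] <;> linarith
    · left; rw [abs_of_nonneg] <;> linarith
  refine ⟨fun a => d x a, ?_⟩
  intro a ha b hb
  rw [Finset.mem_coe] at ha hb
  show |d x a - d x b| = d a b
  have f1 := hf a ha
  have f2 := hf b hb
  by_cases hab : a = b
  · subst hab; simp [hz]
  have p := pos5 hd hab
  by_cases hax : a = x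
  · subst hax; rw [hz, zero_sub, abs_neg, abs_of_pos p]
  by_cases hbx : b = x
  · subst hbx; rw [hz, sub_zero, hs b a, abs_of_pos p]
  by_cases hay : a = y
  · subst hay
    have := hs a b
    rw [abs_of_nonneg] <;> linarith
  by_cases hby : b = y
  · subst hby
    rw [abs_sub_comm, abs_of_nonneg] <;> linarith
  rcases hpair a ha b hb hax hay hbx hby hab with h | ⟨h1, h2⟩
  · exact h
  exfalso
  obtain ⟨c, hcS, hc⟩ : ∃ c ∈ S, c ∉ ({x, y, a, b} : Finset V) := by
    apply Finset.exists_mem_notMem_of_card_lt_card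
    exact lt_of_le_of_lt Finset.card_le_four (by omega)
  simp only [Finset.mem_insert, Finset.mem_singleton, not_or] at hc
  obtain ⟨hcx, hcy, hca, hcb⟩ := hc
  have f3 := hf c hcS
  have g := hbtw a ha b hb h1 c hcS
  have p1 := pos5 hd hca
  have p2 := pos5 hd hcb
  have s1 := hs a c
  have s2 := hs b c
  have pa := pos5 hd (Ne.symm hax)
  have pb := pos5 hd (Ne.symm hbx)
  have pc := pos5 hd (Ne.symm hcx)
  have pc' := pos5 hd hcy
  rcases hpair a ha c hcS hax hay hcx hcy (Ne.symm hca) with q1 | ⟨q1, -⟩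
  · rcases hpair b hb c hcS hbx hby hcx hcy (Ne.symm hcb) with q2 | ⟨q2, -⟩
    · rcases abs_cases (d x a - d x c) with ⟨e1, -⟩ | ⟨e1, -⟩ <;>
        rcases abs_cases (d x b - d x c) with ⟨e2, -⟩ | ⟨e2, -⟩ <;> linarith
    · linarith
  · linarith

open Classical in
/-- The non-degenerate triples inside `S`. -/
noncomputable def Bad5 {V : Type*} [DecidableEq V] (d : V → V → ℝ) (S : Finset V) :
    Finset (Finset V) := (S.powersetCard 3).filter (fun T => ¬ Dg5 d T)

theorem mem_Bad5 {V : Type*} [DecidableEq V] {d : V → V → ℝ} {S T : Finset V} :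
    T ∈ Bad5 d S ↔ (T ⊆ S ∧ T.card = 3) ∧ ¬ Dg5 d T := by
  simp [Bad5, Finset.mem_powersetCard]

theorem main5 {V : Type*} [DecidableEq V] {d : V → V → ℝ} (hd : IsMetricD d) (k : ℕ) :
    ∀ S : Finset V, S.card = k + 5 → ¬ LineOn5 d (S : Set V) → k + 1 ≤ (Bad5 d S).card := by
  induction k with
  | zero =>
    intro S hS hL
    by_contra hcon
    have h0 : Bad5 d S = ∅ := Finset.card_eq_zero.1 (by omega)
    apply hL
    apply menger5 hd S (by omega)
    intro T hT
    by_contra hT'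
    have : T ∈ Bad5 d S := mem_Bad5.2 ⟨Finset.mem_powersetCard.1 hT, hT'⟩
    simp [h0] at this
  | succ k ih =>
    intro S hS hL
    by_cases hne : (Bad5 d S) = ∅
    · exfalso
      apply hL
      apply menger5 hd S (by omega)
      intro T hT
      by_contra hT'
      have : T ∈ Bad5 d S := mem_Bad5.2 ⟨Finset.mem_powersetCard.1 hT, hT'⟩
      simp [hne] at this
    obtain ⟨T, hT⟩ := Finset.nonempty_iff_ne_empty.2 hne
    have hT' := mem_Bad5.1 hT
    by_cases hex : ∃ z ∈ T, ¬ LineOn5 d ((S.erase z : Finset V) : Set V)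
    · obtain ⟨z, hz, hzL⟩ := hex
      have h1 := ih (S.erase z) (by rw [Finset.card_erase_of_mem (hT'.1.1 hz)]; omega) hzL
      have h2 : Bad5 d (S.erase z) ⊂ Bad5 d S := by
        rw [Finset.ssubset_iff_of_subset]
        · refine ⟨T, hT, fun h => ?_⟩
          have := (mem_Bad5.1 h).1.1 hz
          simp at this
        · intro U hU
          have := mem_Bad5.1 hU
          exact mem_Bad5.2 ⟨⟨this.1.1.trans (Finset.erase_subset _ _), this.1.2⟩, this.2⟩
      have := Finset.card_lt_card h2
      omega
    · exfalso
      push Not at hex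
      apply hL
      have hc : 1 < (S \ T).card := by
        rw [Finset.card_sdiff_of_subset hT'.1.1]; omega
      obtain ⟨x, hx, y, hy, hxy⟩ := Finset.one_lt_card.1 hc
      rw [Finset.mem_sdiff] at hx hy
      apply glue5 hd _ x y hxy
      intro a ha b hb
      obtain ⟨z, hzT, hz⟩ : ∃ z ∈ T, z ∉ ({a, b} : Finset V) := by
        apply Finset.exists_mem_notMem_of_card_lt_card
        exact lt_of_le_of_lt Finset.card_le_two (by omega)
      simp only [Finset.mem_insert, Finset.mem_singleton, not_or] at hz
      apply (hex z hzT).mono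
      intro w hw
      simp only [Set.mem_insert_iff, Set.mem_singleton_iff] at hw
      rw [Finset.mem_coe, Finset.mem_erase]
      rcases hw with rfl | rfl | rfl | rfl
      · exact ⟨fun h => hx.2 (h ▸ hzT), hx.1⟩
      · exact ⟨fun h => hy.2 (h ▸ hzT), hy.1⟩
      · exact ⟨Ne.symm hz.1, ha⟩
      · exact ⟨Ne.symm hz.2, hb⟩

theorem choose5 (k : ℕ) : k + 5 ≤ Nat.choose (k + 5) 3 := by
  induction k with
  | zero => decide
  | succ k ih =>
    have h : Nat.choose (k + 1 + 5) 3 = Nat.choose (k + 5) 2 + Nat.choose (k + 5) 3 :=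
      Nat.choose_succ_succ (k + 5) 2
    have h2 : 0 < Nat.choose (k + 5) 2 := Nat.choose_pos (by omega)
    omega

/-- For `n ≥ 5`, every set of `binomial(n,3) - n + 5` three-point subsets of an `n`-point
set `V` is an anchor in `V`. -/
theorem stmt5 {V : Type*} [Fintype V] [DecidableEq V]
    (n : ℕ) (hn : 5 ≤ n) (hcard : Fintype.card V = n)
    (A : Finset (Finset V)) (h3 : ∀ T ∈ A, T.card = 3)
    (hA : A.card = Nat.choose n 3 - n + 5) :
    IsAnchor A := by
  refine ⟨h3, fun d hd hdeg => ?_⟩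
  by_contra hL
  obtain ⟨k, rfl⟩ : ∃ k, n = k + 5 := ⟨n - 5, by omega⟩
  have hL' : ¬ LineOn5 d ((Finset.univ : Finset V) : Set V) := by
    rintro ⟨f, hf⟩
    exact hL ⟨f, fun x y => hf x (by simp) y (by simp)⟩
  have h1 := main5 hd k Finset.univ (by rw [Finset.card_univ, hcard]) hL'
  have hdis : Disjoint (Bad5 d Finset.univ) A := by
    rw [Finset.disjoint_left]
    intro T hT hTA
    exact (mem_Bad5.1 hT).2 (hdeg T hTA)
  have hsub : Bad5 d Finset.univ ∪ A ⊆ (Finset.univ : Finset V).powersetCard 3 := by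
    intro T hT
    rw [Finset.mem_powersetCard]
    refine ⟨Finset.subset_univ _, ?_⟩
    rcases Finset.mem_union.1 hT with h | h
    · exact (mem_Bad5.1 h).1.2
    · exact h3 T h
  have h2 := Finset.card_le_card hsub
  rw [Finset.card_union_of_disjoint hdis, Finset.card_powersetCard, Finset.card_univ, hcard] at h2
  have := choose5 k
  omega
end

section
/- For every positive integer n with n ≠ 4 and every set V with exactly n points, there exists an anchor in V consisting of fewer than (7/6)·n² three-point subsets of V. -/
/-- Pair covering by triples in a finite abelian group. -/
lemma cover_group (G : Type) [AddCommGroup G] [Fintype G] [DecidableEq G]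
    (hm : Fintype.card G ≠ 2) :
    ∃ C : Finset (Finset G), (∀ T ∈ C, T.card = 3) ∧
      (∀ x y : G, x ≠ y → ∃ z, z ≠ x ∧ z ≠ y ∧ ({x, y, z} : Finset G) ∈ C) ∧
      6 * C.card ≤ (Fintype.card G) ^ 2 + 6 * Fintype.card G := by
  have hw : ∀ x y : G, ∃ w, x ≠ y → (w ≠ x ∧ w ≠ y) := by
    intro x y
    by_cases hxy : x = y
    · exact ⟨x, fun h => absurd hxy h⟩
    have h2 : ({x, y} : Finset G).card = 2 := Finset.card_pair hxy
    have hne : ({x, y} : Finset G) ≠ Finset.univ := by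
      intro h
      rw [h, Finset.card_univ] at h2
      exact hm h2
    obtain ⟨w, hw⟩ : ∃ w, w ∉ ({x, y} : Finset G) := by
      by_contra! h
      exact hne (Finset.eq_univ_iff_forall.2 h)
    simp at hw
    exact ⟨w, fun _ => hw⟩
  choose w hw using hw
  set P : Finset (G × G) := Finset.univ.filter
    (fun p => p.1 ≠ p.2 ∧ -p.1 - p.2 ≠ p.1 ∧ -p.1 - p.2 ≠ p.2) with hP
  set F : G × G → Finset G := fun p => {p.1, p.2, -p.1 - p.2} with hF
  set Q : Finset G := Finset.univ.filter (fun x => x ≠ -x - x) with hQ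
  set K : G → Finset G := fun x => {x, -x - x, w x (-x - x)} with hK
  have hF3 : ∀ p ∈ P, (F p).card = 3 := by
    intro p hp
    simp only [hP, Finset.mem_filter, Finset.mem_univ, true_and] at hp
    exact Finset.card_eq_three.2 ⟨_, _, _, hp.1, hp.2.1.symm, hp.2.2.symm, rfl⟩
  have h6 : 6 * (P.image F).card ≤ (Fintype.card G) ^ 2 := by
    have h1 : 6 * (P.image F).card ≤ P.card := by
      apply Finset.mul_card_image_le_card_of_maps_to (f := F)
      · intro p hp
        exact Finset.mem_image_of_mem F hp
      · intro T hT
        obtain ⟨p, hp, rfl⟩ := Finset.mem_image.1 hT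
        have h3 := hF3 p hp
        have hsub : (F p).offDiag ⊆ P.filter (fun q => F q = F p) := by
          rintro ⟨u, v⟩ huv
          simp only [Finset.mem_offDiag] at huv
          obtain ⟨hu, hv, huv⟩ := huv
          simp only [hP, Finset.mem_filter, Finset.mem_univ, true_and] at hp ⊢
          obtain ⟨x, y⟩ := p
          simp only [hF, Finset.mem_insert, Finset.mem_singleton] at hu hv hp ⊢
          have e1 : -x - (-x - y) = y := by abel
          have e2 : -(-x - y) - x = y := by abel
          have e3 : -y - (-x - y) = x := by abel
          have e4 : -(-x - y) - y = x := by abel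
          have e5 : -y - x = -x - y := by abel
          obtain ⟨hp1, hp2, hp3⟩ := hp
          rcases hu with rfl | rfl | rfl <;> rcases hv with rfl | rfl | rfl <;>
            first
            | exact absurd rfl huv
            | (simp only [e1, e2, e3, e4, e5]
               refine ⟨⟨?_, ?_, ?_⟩, ?_⟩ <;> first | tauto | (ext t; simp; tauto))
        have := Finset.card_le_card hsub
        rw [Finset.offDiag_card, h3] at this
        exact this
    have h2 : P.card ≤ Fintype.card G ^ 2 := by
      refine (Finset.card_le_univ P).trans ?_
      rw [Fintype.card_prod, sq]
    omega
  refine ⟨P.image F ∪ Q.image K, ?_, ?_, ?_⟩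
  · intro T hT
    rcases Finset.mem_union.1 hT with hT | hT
    · obtain ⟨p, hp, rfl⟩ := Finset.mem_image.1 hT
      exact hF3 p hp
    · obtain ⟨x, hx, rfl⟩ := Finset.mem_image.1 hT
      simp only [hQ, Finset.mem_filter, Finset.mem_univ, true_and] at hx
      obtain ⟨h1, h2⟩ := hw _ _ hx
      exact Finset.card_eq_three.2 ⟨_, _, _, hx, h1.symm, h2.symm, rfl⟩
  · intro x y hxy
    by_cases h1 : -x - y = x
    · have hy : y = -x - x := by
        have : y = -x - (-x - y) := by abel
        rw [h1] at this; exact this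
      subst hy
      obtain ⟨h3, h4⟩ := hw _ _ hxy
      refine ⟨_, h3, h4, Finset.mem_union_right _ (Finset.mem_image.2 ⟨x, ?_, rfl⟩)⟩
      simp only [hQ, Finset.mem_filter, Finset.mem_univ, true_and]
      exact hxy
    by_cases h2 : -x - y = y
    · have hx : x = -y - y := by
        have : x = -y - (-x - y) := by abel
        rw [h2] at this; exact this
      subst hx
      obtain ⟨h3, h4⟩ := hw _ _ hxy.symm
      refine ⟨_, h4, h3, Finset.mem_union_right _ (Finset.mem_image.2 ⟨y, ?_, ?_⟩)⟩
      · simp only [hQ, Finset.mem_filter, Finset.mem_univ, true_and]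
        exact hxy.symm
      · exact Finset.insert_comm _ _ _
    · refine ⟨_, h1, h2, Finset.mem_union_left _ (Finset.mem_image.2 ⟨(x, y), ?_, rfl⟩)⟩
      simp only [hP, Finset.mem_filter, Finset.mem_univ, true_and]
      exact ⟨hxy, h1, h2⟩
  · have h1 := Finset.card_union_le (P.image F) (Q.image K)
    have h2 : (Q.image K).card ≤ Fintype.card G :=
      Finset.card_image_le.trans (Finset.card_le_univ _)
    omega

/-- Pair covering by triples of a finite set. -/
lemma cover_finset {V : Type*} [DecidableEq V] (W : Finset V) (hm : W.card ≠ 2) :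
    ∃ C : Finset (Finset V), (∀ T ∈ C, T.card = 3) ∧
      (∀ x ∈ W, ∀ y ∈ W, x ≠ y → ∃ z ∈ W, z ≠ x ∧ z ≠ y ∧ ({x, y, z} : Finset V) ∈ C) ∧
      6 * C.card ≤ W.card ^ 2 + 6 * W.card := by
  by_cases h0 : W.card = 0
  · rw [Finset.card_eq_zero] at h0
    subst h0
    exact ⟨∅, by simp, by simp, by simp⟩
  have : NeZero W.card := ⟨h0⟩
  obtain ⟨C, h1, h2, h3⟩ := cover_group (ZMod W.card) (by rwa [ZMod.card])
  rw [ZMod.card] at h3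
  have e : ZMod W.card ≃ W := Fintype.equivOfCardEq (by simp [ZMod.card])
  let φ : ZMod W.card → V := fun i => (e i : V)
  have hφ : Function.Injective φ := fun i j h => e.injective (Subtype.ext h)
  refine ⟨C.image (Finset.image φ), ?_, ?_, ?_⟩
  · intro T hT
    obtain ⟨S, hS, rfl⟩ := Finset.mem_image.1 hT
    rw [Finset.card_image_of_injective _ hφ, h1 S hS]
  · intro x hx y hy hxy
    have ex : φ (e.symm ⟨x, hx⟩) = x := by simp [φ]
    have ey : φ (e.symm ⟨y, hy⟩) = y := by simp [φ]
    obtain ⟨z, hz1, hz2, hz⟩ := h2 (e.symm ⟨x, hx⟩) (e.symm ⟨y, hy⟩) (by simpa using hxy)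
    refine ⟨φ z, (e z).2, ?_, ?_, Finset.mem_image.2 ⟨_, hz, ?_⟩⟩
    · intro h; exact hz1 (hφ (h.trans ex.symm))
    · intro h; exact hz2 (hφ (h.trans ey.symm))
    · simp [Finset.image_insert, ex, ey]
  · have := Finset.card_image_le (s := C) (f := Finset.image φ)
    omega

lemma degen_cases {V : Type*} [DecidableEq V] {d : V → V → ℝ} (hd : IsMetricD d) {x y z : V}
    (h : ∃ r s t : V, ({x, y, z} : Finset V) = {r, s, t} ∧ TriDegen d r s t) :
    d x y + d y z = d x z ∨ d x y + d x z = d y z ∨ d x z + d y z = d x y := by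
  obtain ⟨r, s, t, hT, hdeg⟩ := h
  obtain ⟨-, hs, -⟩ := hd
  have hdist : r ≠ s ∧ s ≠ t ∧ r ≠ t := by
    rcases hdeg with h | h | h <;> obtain ⟨h1, h2, h3, -⟩ := h <;> tauto
  obtain ⟨n1, n2, n3⟩ := hdist
  have hr : r = x ∨ r = y ∨ r = z := by
    have : r ∈ ({x, y, z} : Finset V) := by rw [hT]; simp
    simpa using this
  have hs' : s = x ∨ s = y ∨ s = z := by
    have : s ∈ ({x, y, z} : Finset V) := by rw [hT]; simp
    simpa using this
  have ht : t = x ∨ t = y ∨ t = z := by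
    have : t ∈ ({x, y, z} : Finset V) := by rw [hT]; simp
    simpa using this
  have hdeg' : d r s + d s t = d r t ∨ d s r + d r t = d s t ∨ d r t + d t s = d r s := by
    rcases hdeg with h | h | h <;> obtain ⟨-, -, -, h⟩ := h <;> tauto
  clear hdeg hT
  have s1 := hs x y
  have s2 := hs x z
  have s3 := hs y z
  rcases hr with rfl | rfl | rfl <;> rcases hs' with rfl | rfl | rfl <;>
    first
    | exact absurd rfl n1
    | (rcases ht with rfl | rfl | rfl <;>
        first
        | exact absurd rfl n2
        | exact absurd rfl n3
        | (rcases hdeg' with h | h | h <;>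
            first
            | (left; linarith)
            | (right; left; linarith)
            | (right; right; linarith)))

lemma anchor_line {V : Type*} [DecidableEq V] (d : V → V → ℝ) (hd : IsMetricD d) (a b : V)
    (hab : a ≠ b)
    (D : V → V → V → Prop)
    (hD : ∀ x y z, D x y z →
      (d x y + d y z = d x z ∨ d x y + d x z = d y z ∨ d x z + d y z = d x y))
    (h1 : ∀ x, x ≠ a → x ≠ b → D a b x)
    (h2 : ∀ x y, x ≠ a → x ≠ b → y ≠ a → y ≠ b → x ≠ y → D a x y)
    (h3 : ∀ x y, x ≠ a → x ≠ b → y ≠ a → y ≠ b → x ≠ y → D b x y)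
    (h4 : ∀ x y, x ≠ a → x ≠ b → y ≠ a → y ≠ b → x ≠ y → 
      ∃ z, z ≠ x ∧ z ≠ y ∧ z ≠ a ∧ z ≠ b ∧ D x y z) :
    LineEmbeds d := by
  obtain ⟨hz, hs, htri⟩ := hd
  have hself : ∀ x, d x x = 0 := fun x => (hz x x).2 rfl
  have hpos : ∀ x y, x ≠ y → 0 < d x y := by
    intro x y hxy
    have e1 := htri x y x
    rw [hself, hs y x] at e1
    have e2 : d x y ≠ 0 := fun h => hxy ((hz x y).1 h)
    exact lt_of_le_of_ne (by linarith) e2.symm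
  have hnn : ∀ x y, 0 ≤ d x y := by
    intro x y
    by_cases h : x = y
    · rw [(hz x y).2 h]
    · exact (hpos x y h).le
  have hE := hpos a b hab
  have hf : ∀ x, ∃ f : ℝ, |f| = d a x ∧ |f - d a b| = d b x := by
    intro x
    by_cases hxa : x = a
    · subst hxa
      exact ⟨0, by simp [hself], by simp [hs b x, abs_of_pos hE]⟩
    by_cases hxb : x = b
    · subst hxb
      exact ⟨d a x, abs_of_pos hE, by simp [hself]⟩
    have p1 := hnn a x
    have p2 := hnn b x
    rcases hD _ _ _ (h1 x hxa hxb) with h | h | h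
    · exact ⟨d a x, abs_of_nonneg p1, by rw [abs_of_nonneg] <;> linarith⟩
    · exact ⟨-d a x, by rw [abs_neg, abs_of_nonneg p1], by rw [abs_of_nonpos] <;> linarith⟩
    · exact ⟨d a x, abs_of_nonneg p1, by rw [abs_of_nonpos] <;> linarith⟩
  choose f hfa hfb using hf
  have fa : f a = 0 := by
    have := hfa a
    rw [hself] at this
    exact abs_eq_zero.1 this
  have fb : f b = d a b := by
    have := hfb b
    rw [hself] at this
    linarith [abs_eq_zero.1 this]
  have key : ∀ x y, x ≠ y → |f x - f y| = d x y ∨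
      (f x + f y = d a b ∧ d x y = d a b ∧ x ≠ a ∧ x ≠ b ∧ y ≠ a ∧ y ≠ b) := by
    intro x y hxy
    by_cases hxa : x = a
    · left; rw [hxa, fa, zero_sub, abs_neg]; exact hfa y
    by_cases hxb : x = b
    · left; rw [hxb, fb, abs_sub_comm]; exact hfb y
    by_cases hya : y = a
    · left; rw [hya, fa, sub_zero, hs x a]; exact hfa x
    by_cases hyb : y = b
    · left; rw [hyb, fb, hs x b]; exact hfb x
    have A1 := hD _ _ _ (h2 x y hxa hxb hya hyb hxy)
    have B1 := hD _ _ _ (h3 x y hxa hxb hya hyb hxy)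
    rw [← hfa x, ← hfa y] at A1
    rw [← hfb x, ← hfb y] at B1
    have pxy := hpos x y hxy
    have A2 : d x y = |f x - f y| ∨ d x y = |f x + f y| := by
      rcases abs_cases (f x) with ⟨e1, _⟩ | ⟨e1, _⟩ <;>
      rcases abs_cases (f y) with ⟨e2, _⟩ | ⟨e2, _⟩ <;>
      rcases abs_cases (f x - f y) with ⟨e3, _⟩ | ⟨e3, _⟩ <;>
      rcases abs_cases (f x + f y) with ⟨e4, _⟩ | ⟨e4, _⟩ <;>
      rw [e1, e2] at A1 <;> rw [e3, e4] <;>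
      rcases A1 with h | h | h <;> first | (left; linarith) | (right; linarith)
    have B2 : d x y = |f x - f y| ∨ d x y = |f x + f y - 2 * d a b| := by
      rcases abs_cases (f x - d a b) with ⟨e1, _⟩ | ⟨e1, _⟩ <;>
      rcases abs_cases (f y - d a b) with ⟨e2, _⟩ | ⟨e2, _⟩ <;>
      rcases abs_cases (f x - f y) with ⟨e3, _⟩ | ⟨e3, _⟩ <;>
      rcases abs_cases (f x + f y - 2 * d a b) with ⟨e4, _⟩ | ⟨e4, _⟩ <;>
      rw [e1, e2] at B1 <;> rw [e3, e4] <;>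
      rcases B1 with h | h | h <;> first | (left; linarith) | (right; linarith)
    rcases A2 with h | h
    · exact Or.inl h.symm
    rcases B2 with h' | h'
    · exact Or.inl h'.symm
    right
    have hsum : f x + f y = d a b := by
      rcases abs_eq_abs.1 (h.symm.trans h') with h | h <;> linarith
    refine ⟨hsum, ?_, hxa, hxb, hya, hyb⟩
    rw [h, hsum, abs_of_pos hE]
  refine ⟨f, fun x y => ?_⟩
  by_cases hxy : x = y
  · subst hxy; simp [hself]
  rcases key x y hxy with h | ⟨hsum, hdist, hxa, hxb, hya, hyb⟩
  · exact h
  obtain ⟨z, hzx, hzy, hza, hzb, hDz⟩ := h4 x y hxa hxb hya hyb hxy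
  have hdeg := hD _ _ _ hDz
  have pxz := hpos x z hzx.symm
  have pyz := hpos y z hzy.symm
  rcases key x z hzx.symm with k1 | ⟨k1, k1', -⟩
  · rcases key y z hzy.symm with k2 | ⟨k2, k2', -⟩
    · have hfz : |f x - f y| = d x y ∨ |f z| = 0 ∨ |f z - d a b| = 0 := by
        rw [← k1, ← k2, hdist] at hdeg
        rw [hdist, abs_eq_zero, abs_eq_zero]
        rcases abs_cases (f x - f z) with ⟨e1, _⟩ | ⟨e1, _⟩ <;>
        rcases abs_cases (f y - f z) with ⟨e2, _⟩ | ⟨e2, _⟩ <;>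
        rcases abs_cases (f x - f y) with ⟨e3, _⟩ | ⟨e3, _⟩ <;>
        rw [e1, e2] at hdeg <;> rw [e3] <;>
        rcases hdeg with h | h | h <;>
        first | (left; linarith) | (right; left; linarith) | (right; right; linarith)
      rcases hfz with h | h | h
      · exact h
      · rw [hfa] at h
        exact absurd ((hz _ _).1 h).symm hza
      · rw [hfb] at h
        exact absurd ((hz _ _).1 h).symm hzb
    · exfalso
      have e : f z = f x := by linarith
      rw [e, sub_self, abs_zero] at k1
      linarith
  · exfalso
    have e : f z = f y := by linarith
    rcases key y z hzy.symm with k2 | ⟨k2, k2', -⟩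
    · rw [e, sub_self, abs_zero] at k2
      linarith
    · rcases hdeg with h | h | h <;> linarith

/-- For every positive `n ≠ 4`, every `n`-point set has an anchor of fewer than `7/6 · n²`
three-point subsets. -/
theorem stmt6 {V : Type*} [Fintype V] [DecidableEq V]
    (n : ℕ) (hn : 0 < n) (hn4 : n ≠ 4) (hcard : Fintype.card V = n) :
    ∃ A : Finset (Finset V), IsAnchor A ∧ (A.card : ℝ) < 7 / 6 * (n : ℝ) ^ 2 := by
  by_cases hn1 : n = 1
  · refine ⟨∅, ⟨by simp, ?_⟩, by subst hn1; norm_num⟩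
    intro d hd _
    have : Subsingleton V := Fintype.card_le_one_iff_subsingleton.1 (by omega)
    refine ⟨fun _ => 0, fun x y => ?_⟩
    rw [(hd.1 x y).2 (Subsingleton.elim x y)]
    simp
  have : Nontrivial V := Fintype.one_lt_card_iff_nontrivial.1 (by omega)
  obtain ⟨a, b, hab⟩ := exists_pair_ne V
  set W : Finset V := Finset.univ \ {a, b} with hW
  have hmem : ∀ x, x ∈ W ↔ x ≠ a ∧ x ≠ b := by
    intro x; simp [hW]
  have hWc : W.card + 2 = n := by
    have h := Finset.card_sdiff_add_card_eq_card (Finset.subset_univ ({a, b} : Finset V))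
    rw [Finset.card_pair hab, Finset.card_univ, hcard] at h
    exact h
  obtain ⟨C, hC3, hCcov, hCc⟩ := cover_finset W (by omega)
  have haW : a ∉ W := by simp [hW]
  have hbW : b ∉ W := by simp [hW]
  set A1 := W.image (fun x => ({a, b, x} : Finset V)) with hA1
  set A2 := (W.powersetCard 2).image (insert a) with hA2
  set A3 := (W.powersetCard 2).image (insert b) with hA3
  have mem2 : ∀ x y, x ∈ W → y ∈ W → x ≠ y → ({x, y} : Finset V) ∈ W.powersetCard 2 := by
    intro x y hx hy hxy
    rw [Finset.mem_powersetCard]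
    refine ⟨?_, Finset.card_pair hxy⟩
    intro t ht
    simp only [Finset.mem_insert, Finset.mem_singleton] at ht
    rcases ht with rfl | rfl <;> assumption
  refine ⟨A1 ∪ A2 ∪ A3 ∪ C, ⟨?_, ?_⟩, ?_⟩
  · intro T hT
    simp only [Finset.mem_union] at hT
    rcases hT with ((hT | hT) | hT) | hT
    · obtain ⟨x, hx, rfl⟩ := Finset.mem_image.1 hT
      rw [hmem] at hx
      exact Finset.card_eq_three.2 ⟨_, _, _, hab, hx.1.symm, hx.2.symm, rfl⟩
    · obtain ⟨S, hS, rfl⟩ := Finset.mem_image.1 hT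
      rw [Finset.mem_powersetCard] at hS
      rw [Finset.card_insert_of_notMem (fun h => haW (hS.1 h)), hS.2]
    · obtain ⟨S, hS, rfl⟩ := Finset.mem_image.1 hT
      rw [Finset.mem_powersetCard] at hS
      rw [Finset.card_insert_of_notMem (fun h => hbW (hS.1 h)), hS.2]
    · exact hC3 T hT
  · intro d hd hdeg
    refine anchor_line d hd a b hab
      (fun x y z => ({x, y, z} : Finset V) ∈ A1 ∪ A2 ∪ A3 ∪ C)
      (fun x y z h => degen_cases hd (hdeg _ h)) ?_ ?_ ?_ ?_
    · intro x hxa hxb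
      simp only [Finset.mem_union]
      exact Or.inl (Or.inl (Or.inl (Finset.mem_image.2 ⟨x, (hmem x).2 ⟨hxa, hxb⟩, rfl⟩)))
    · intro x y hxa hxb hya hyb hxy
      simp only [Finset.mem_union]
      exact Or.inl (Or.inl (Or.inr (Finset.mem_image.2
        ⟨_, mem2 x y ((hmem x).2 ⟨hxa, hxb⟩) ((hmem y).2 ⟨hya, hyb⟩) hxy, rfl⟩)))
    · intro x y hxa hxb hya hyb hxy
      simp only [Finset.mem_union]
      exact Or.inl (Or.inr (Finset.mem_image.2
        ⟨_, mem2 x y ((hmem x).2 ⟨hxa, hxb⟩) ((hmem y).2 ⟨hya, hyb⟩) hxy, rfl⟩))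
    · intro x y hxa hxb hya hyb hxy
      obtain ⟨z, hz, hzx, hzy, hzC⟩ :=
        hCcov x ((hmem x).2 ⟨hxa, hxb⟩) y ((hmem y).2 ⟨hya, hyb⟩) hxy
      exact ⟨z, hzx, hzy, ((hmem z).1 hz).1, ((hmem z).1 hz).2, Finset.mem_union_right _ hzC⟩
  · have c1 : A1.card ≤ W.card := Finset.card_image_le
    have c2 : A2.card ≤ W.card.choose 2 := by
      rw [← Finset.card_powersetCard]; exact Finset.card_image_le
    have c3 : A3.card ≤ W.card.choose 2 := by
      rw [← Finset.card_powersetCard]; exact Finset.card_image_le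
    have u1 := Finset.card_union_le (A1 ∪ A2 ∪ A3) C
    have u2 := Finset.card_union_le (A1 ∪ A2) A3
    have u3 := Finset.card_union_le A1 A2
    have ch : ((W.card.choose 2 : ℕ) : ℝ) = W.card * (W.card - 1) / 2 := Nat.cast_choose_two ℝ _
    have tot : (A1 ∪ A2 ∪ A3 ∪ C).card ≤ W.card + 2 * W.card.choose 2 + C.card := by omega
    have tot' : ((A1 ∪ A2 ∪ A3 ∪ C).card : ℝ) ≤ W.card + 2 * (W.card.choose 2 : ℕ) + C.card := by
      exact_mod_cast tot
    have hCc' : 6 * (C.card : ℝ) ≤ (W.card : ℝ) ^ 2 + 6 * W.card := by exact_mod_cast hCc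
    have hn' : (n : ℝ) = W.card + 2 := by rw [← hWc]; push_cast; rfl
    have hw0 : (0 : ℝ) ≤ W.card := Nat.cast_nonneg _
    rw [ch] at tot'
    rw [hn']
    nlinarith
end

section
/- If V is a set with exactly four points, then no set A of three-point subsets of V is an anchor in V. -/
/-- The graph metric of the 4-cycle. -/
def cyc4 (i j : Fin 4) : ℕ :=
  if i = j then 0 else if (i.val + j.val) % 2 = 0 then 2 else 1

lemma cyc4_zero : ∀ i j, cyc4 i j = 0 ↔ i = j := by decide
lemma cyc4_symm : ∀ i j, cyc4 i j = cyc4 j i := by decide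
lemma cyc4_tri : ∀ i j k, cyc4 i k ≤ cyc4 i j + cyc4 j k := by decide
lemma cyc4_degen : ∀ i j k, i ≠ j → i ≠ k → j ≠ k →
    cyc4 i j + cyc4 j k = cyc4 i k ∨ cyc4 j i + cyc4 i k = cyc4 j k ∨
    cyc4 i k + cyc4 k j = cyc4 i j := by decide

/-- In a four-point set, no set of three-point subsets is an anchor. -/
theorem stmt7 {V : Type*} [Fintype V] [DecidableEq V]
    (hcard : Fintype.card V = 4)
    (A : Finset (Finset V)) (h3 : ∀ T ∈ A, T.card = 3) :
    ¬ IsAnchor A := by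
  rintro ⟨-, h⟩
  let e : V ≃ Fin 4 := Fintype.equivFinOfCardEq hcard
  have hL := h (fun x y => (cyc4 (e x) (e y) : ℝ))
  suffices hS : LineEmbeds (fun x y => (cyc4 (e x) (e y) : ℝ)) by
    obtain ⟨f, hf⟩ := hS
    have key : ∀ i j : Fin 4, |f (e.symm i) - f (e.symm j)| = (cyc4 i j : ℝ) := by
      intro i j
      simpa using hf (e.symm i) (e.symm j)
    have h01 := key 0 1
    have h12 := key 1 2
    have h23 := key 2 3
    have h03 := key 0 3
    have h02 := key 0 2
    have h13 := key 1 3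
    rw [show cyc4 0 1 = 1 by decide] at h01
    rw [show cyc4 1 2 = 1 by decide] at h12
    rw [show cyc4 2 3 = 1 by decide] at h23
    rw [show cyc4 0 3 = 1 by decide] at h03
    rw [show cyc4 0 2 = 2 by decide] at h02
    rw [show cyc4 1 3 = 2 by decide] at h13
    push_cast at h01 h12 h23 h03 h02 h13
    generalize f (e.symm 0) = a at h01 h12 h23 h03 h02 h13
    generalize f (e.symm 1) = b at h01 h12 h23 h03 h02 h13
    generalize f (e.symm 2) = c at h01 h12 h23 h03 h02 h13
    generalize f (e.symm 3) = d at h01 h12 h23 h03 h02 h13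
    rcases abs_cases (a - b) with ⟨h1, _⟩ | ⟨h1, _⟩ <;>
    rcases abs_cases (b - c) with ⟨h2, _⟩ | ⟨h2, _⟩ <;>
    rcases abs_cases (c - d) with ⟨h3, _⟩ | ⟨h3, _⟩ <;>
    rcases abs_cases (a - d) with ⟨h4, _⟩ | ⟨h4, _⟩ <;>
    rcases abs_cases (a - c) with ⟨h5, _⟩ | ⟨h5, _⟩ <;>
    rcases abs_cases (b - d) with ⟨h6, _⟩ | ⟨h6, _⟩ <;> linarith
  refine hL ⟨?_, ?_, ?_⟩ ?_
  · intro x y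
    simp [cyc4_zero]
  · intro x y
    simp only [cyc4_symm (e x) (e y)]
  · intro x y z
    beta_reduce
    exact_mod_cast cyc4_tri (e x) (e y) (e z)
  · intro T hT
    obtain ⟨r, s, t, hrs, hrt, hst, rfl⟩ := Finset.card_eq_three.1 (h3 T hT)
    refine ⟨r, s, t, rfl, ?_⟩
    rcases cyc4_degen (e r) (e s) (e t) (by simpa) (by simpa) (by simpa) with h | h | h
    · exact Or.inl ⟨hrs, hst, hrt, by beta_reduce; exact_mod_cast h⟩
    · exact Or.inr (Or.inl ⟨hrs.symm, hrt, hst, by beta_reduce; exact_mod_cast h⟩)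
    · exact Or.inr (Or.inr ⟨hrt, hst.symm, hrs, by beta_reduce; exact_mod_cast h⟩)
end

section
/- Let V be a set with n points, where n ≥ 5. Then every anchor in V contains at least n(n−1)/2 three-point subsets of V. -/
theorem exists_pos {V : Type*} [Fintype V] [DecidableEq V] (x y u v : V)
    (hxy : x ≠ y) (hux : u ≠ x) (huy : u ≠ y) (hvx : v ≠ x) (hvy : v ≠ y) (huv : u ≠ v) :
    ∃ g : V → ℝ, Function.Injective g ∧ g x = 2 ∧ g y = -1 ∧ g u = 0 ∧ g v = 1 ∧
      ∀ w, w ≠ x → w ≠ y → w ≠ u → w ≠ v → 0 < g w ∧ g w < 1 := by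
  let e := Fintype.equivFin V
  let q : V → ℝ := fun z => ((e z : ℕ) + 1 : ℝ) / (Fintype.card V + 1)
  have hq : ∀ z, 0 < q z ∧ q z < 1 := by
    intro z
    have h : ((e z : ℕ) : ℝ) < Fintype.card V := by exact_mod_cast (e z).2
    refine ⟨by positivity, ?_⟩
    rw [div_lt_one (by positivity)]
    linarith
  have hqi : Function.Injective q := by
    intro a b h
    have h0 : (Fintype.card V + 1 : ℝ) ≠ 0 := by positivity
    have h1 := (div_left_inj' h0).1 h
    have h2 : ((e a : ℕ) : ℝ) = (e b : ℕ) := by linarith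
    exact e.injective (Fin.ext (by exact_mod_cast h2))
  clear_value q
  refine ⟨fun z => if z = x then 2 else if z = y then -1 else if z = u then 0 else
    if z = v then 1 else q z, ?_, ?_, ?_, ?_, ?_, ?_⟩
  · intro a b h
    have ha := hq a
    have hb := hq b
    have hab := @hqi a b
    simp only at h
    split_ifs at h <;> first | (subst_vars; rfl) | (exact hab h) | (exfalso; linarith)
  · simp
  · simp [hxy.symm]
  · simp [hux, huy]
  · simp [hvx, hvy, huv.symm]
  · intro w h1 h2 h3 h4
    simp [h1, h2, h3, h4, hq w]

theorem anchor_pair {V : Type*} [Fintype V] [DecidableEq V]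
    (hn : 5 ≤ Fintype.card V) (A : Finset (Finset V)) (hA : IsAnchor A)
    (x y : V) (hxy : x ≠ y) : 3 ≤ (A.filter (fun T => {x, y} ⊆ T)).card := by
  by_contra hlt
  push Not at hlt
  let S : Finset V := Finset.univ \ {x, y}
  let N : Finset V := S.filter (fun z => ({x, y, z} : Finset V) ∈ A)
  have hN : N.card ≤ 2 := by
    have : N.card ≤ (A.filter (fun T => {x, y} ⊆ T)).card := by
      apply Finset.card_le_card_of_injOn (fun z => ({x, y, z} : Finset V))
      · intro z hz
        have hz' : z ∈ N := hz
        simp only [N, Finset.mem_filter] at hz'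
        simp only [Finset.coe_filter, Set.mem_setOf_eq]
        refine ⟨hz'.2, ?_⟩
        intro t ht
        simp at ht ⊢
        tauto
      · intro a ha b hb h
        have ha' : a ∈ N := ha
        simp only [N, S, Finset.mem_filter, Finset.mem_sdiff, Finset.mem_insert,
          Finset.mem_singleton, Finset.mem_univ, true_and] at ha'
        have : a ∈ ({x, y, b} : Finset V) := by
          have h' : ({x, y, a} : Finset V) = {x, y, b} := h
          rw [← h']; simp
        simp at this
        tauto
    omega
  have hS : S.card = Fintype.card V - 2 := by
    simp only [S]
    rw [Finset.card_sdiff_of_subset (Finset.subset_univ _), Finset.card_pair hxy, Finset.card_univ]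
  obtain ⟨U, hNU, hUS, hU⟩ := Finset.exists_subsuperset_card_eq
    (Finset.filter_subset _ _ : N ⊆ S) hN (by omega)
  obtain ⟨w, hwS, hwU⟩ : ∃ w ∈ S, w ∉ U :=
    Finset.exists_mem_notMem_of_card_lt_card (by omega)
  obtain ⟨u, v, huv, rfl⟩ := Finset.card_eq_two.1 hU
  have huS : u ∈ S := hUS (by simp)
  have hvS : v ∈ S := hUS (by simp)
  have key : ∀ z, z ≠ x → z ≠ y → ({x, y, z} : Finset V) ∈ A → z = u ∨ z = v := by
    intro z h1 h2 h3
    have : z ∈ ({u, v} : Finset V) := hNU (by simp [N, S, h1, h2, h3])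
    simpa using this
  simp [S] at huS hvS hwS hwU
  obtain ⟨g, hgi, gx, gy, gu, gv, gw⟩ :=
    exists_pos x y u v hxy huS.1 huS.2 hvS.1 hvS.2 huv
  have hmid : ∀ z, z ≠ x → z ≠ y → 0 ≤ g z ∧ g z ≤ 1 := by
    intro z h1 h2
    by_cases h3 : z = u
    · subst h3; rw [gu]; norm_num
    by_cases h4 : z = v
    · subst h4; rw [gv]; norm_num
    exact ⟨(gw z h1 h2 h3 h4).1.le, (gw z h1 h2 h3 h4).2.le⟩
  have hnx : ∀ z, z ≠ x → -1 ≤ g z ∧ g z ≤ 1 := by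
    intro z h
    by_cases h2 : z = y
    · subst h2; rw [gy]; norm_num
    · have := hmid z h h2; constructor <;> linarith
  have hny : ∀ z, z ≠ y → 0 ≤ g z ∧ g z ≤ 2 := by
    intro z h
    by_cases h2 : z = x
    · subst h2; rw [gx]; norm_num
    · have := hmid z h2 h; constructor <;> linarith
  have hall : ∀ z, -1 ≤ g z ∧ g z ≤ 2 := by
    intro z
    by_cases h2 : z = x
    · subst h2; rw [gx]; norm_num
    · have := hnx z h2; constructor <;> linarith
  let d : V → V → ℝ := fun a b => min |g a - g b| (4 - |g a - g b|)
  have hdsym : ∀ a b, d a b = d b a := by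
    intro a b; simp only [d]; rw [abs_sub_comm]
  have hd : IsMetricD d := by
    refine ⟨?_, hdsym, ?_⟩
    · intro a b
      constructor
      · intro h
        apply hgi
        have ha := hall a
        have hb := hall b
        simp only [d] at h
        rcases min_choice |g a - g b| (4 - |g a - g b|) with h' | h' <;> rw [h'] at h
        · exact sub_eq_zero.1 (abs_eq_zero.1 h)
        · exfalso
          have : |g a - g b| ≤ 3 := abs_le.2 ⟨by linarith, by linarith⟩
          linarith
      · rintro rfl; simp [d]
    · intro a b c
      have ha := hall a
      have hb := hall b
      have hc := hall c
      simp only [d]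
      rcases abs_cases (g a - g b) with h1 | h1 <;> rcases abs_cases (g b - g c) with h2 | h2 <;>
      rcases abs_cases (g a - g c) with h3 | h3 <;>
      rcases min_cases |g a - g b| (4 - |g a - g b|) with h4 | h4 <;>
      rcases min_cases |g b - g c| (4 - |g b - g c|) with h5 | h5 <;>
      first
      | (refine (min_le_left _ _).trans ?_; linarith)
      | (refine (min_le_right _ _).trans ?_; linarith)
  -- three points in an arc of length at most two
  have hdeg : ∀ r s t : V, r ≠ s → s ≠ t → r ≠ t → |g r - g s| ≤ 2 → |g s - g t| ≤ 2 →
      |g r - g t| ≤ 2 → TriDegen d r s t := by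
    intro r s t hrs hst hrt h1 h2 h3
    have e1 : d r s = |g r - g s| := min_eq_left (by linarith)
    have e2 : d s t = |g s - g t| := min_eq_left (by linarith)
    have e3 : d r t = |g r - g t| := min_eq_left (by linarith)
    have : d r s + d s t = d r t ∨ d s r + d r t = d s t ∨ d r t + d t s = d r s := by
      rw [hdsym s r, hdsym t s, e1, e2, e3]
      rcases abs_cases (g r - g s) with h1 | h1 <;> rcases abs_cases (g s - g t) with h2 | h2 <;>
      rcases abs_cases (g r - g t) with h3 | h3 <;>
      first
      | (left; linarith)
      | (right; left; linarith)
      | (right; right; linarith)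
    rcases this with h | h | h
    · exact Or.inl ⟨hrs, hst, hrt, h⟩
    · exact Or.inr (Or.inl ⟨hrs.symm, hrt, hst, h⟩)
    · exact Or.inr (Or.inr ⟨hrt, hst.symm, hrs, h⟩)
  obtain ⟨f, hf⟩ := hA.2 d hd (by
    intro T hT
    have hc := hA.1 T hT
    by_cases hTx : x ∈ T
    · by_cases hTy : y ∈ T
      · obtain ⟨z, hz⟩ : ∃ z, z ∈ T \ {x, y} := by
          rw [← Finset.Nonempty, ← Finset.card_pos]
          have := Finset.le_card_sdiff ({x, y} : Finset V) T
          rw [Finset.card_pair hxy] at this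
          omega
        simp at hz
        obtain ⟨hzT, hzx, hzy⟩ := hz
        change z ≠ x at hzx
        change z ≠ y at hzy
        have hTe : T = {x, y, z} := by
          symm
          apply Finset.eq_of_subset_of_card_le
          · intro t ht; simp at ht; rcases ht with rfl | rfl | rfl <;> assumption
          · rw [hc, Finset.card_eq_three.2 ⟨x, y, z, hxy, hzx.symm, hzy.symm, rfl⟩]
        refine ⟨x, y, z, hTe, ?_⟩
        rcases key z hzx hzy (hTe ▸ hT) with rfl | rfl
        · refine Or.inl ⟨hxy, hzy.symm, hzx.symm, ?_⟩
          simp only [d, gx, gy, gu]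
          norm_num [abs_of_pos, abs_of_neg, min_def]
        · refine Or.inr (Or.inl ⟨hxy.symm, hzx.symm, hzy.symm, ?_⟩)
          simp only [d, gx, gy, gv]
          norm_num [abs_of_pos, abs_of_neg, min_def]
      · obtain ⟨r, s, t, hrs, hrt, hst, rfl⟩ := Finset.card_eq_three.1 hc
        simp at hTy
        have hr := hny r (by tauto)
        have hs := hny s (by tauto)
        have ht := hny t (by tauto)
        refine ⟨r, s, t, rfl, hdeg r s t hrs hst hrt ?_ ?_ ?_⟩ <;>
          exact abs_le.2 ⟨by linarith, by linarith⟩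
    · obtain ⟨r, s, t, hrs, hrt, hst, rfl⟩ := Finset.card_eq_three.1 hc
      simp at hTx
      have hr := hnx r (by tauto)
      have hs := hnx s (by tauto)
      have ht := hnx t (by tauto)
      refine ⟨r, s, t, rfl, hdeg r s t hrs hst hrt ?_ ?_ ?_⟩ <;>
        exact abs_le.2 ⟨by linarith, by linarith⟩)
  have hw := gw w hwS.1 hwS.2 hwU.1 hwU.2
  have e1 := hf x y
  have e2 := hf x w
  have e3 := hf y w
  have d1 : d x y = 1 := by
    simp only [d, gx, gy]
    norm_num [abs_of_pos, min_def]
  have d2 : d x w = 2 - g w := by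
    simp only [d, gx]
    rw [abs_of_pos (by linarith), min_eq_left (by linarith)]
  have d3 : d y w = 1 + g w := by
    simp only [d, gy]
    rw [abs_of_neg (by linarith), min_eq_left (by linarith)]
    ring
  rw [d1] at e1
  rw [d2] at e2
  rw [d3] at e3
  rcases abs_cases (f x - f y) with h1 | h1 <;> rcases abs_cases (f x - f w) with h2 | h2 <;>
    rcases abs_cases (f y - f w) with h3 | h3 <;> linarith

/-- For `n ≥ 5`, every anchor in an `n`-point set contains at least `n(n-1)/2` triangles. -/
theorem stmt8 {V : Type*} [Fintype V] [DecidableEq V]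
    (n : ℕ) (hn : 5 ≤ n) (hcard : Fintype.card V = n)
    (A : Finset (Finset V)) (hA : IsAnchor A) :
    n * (n - 1) / 2 ≤ A.card := by
  subst hcard
  have h := Finset.sum_card_bipartiteAbove_eq_sum_card_bipartiteBelow
    (s := Finset.powersetCard 2 (Finset.univ : Finset V)) (t := A) (fun P T => P ⊆ T)
  have h1 : ∀ P ∈ Finset.powersetCard 2 (Finset.univ : Finset V),
      3 ≤ (Finset.bipartiteAbove (fun P T => P ⊆ T) A P).card := by
    intro P hP
    obtain ⟨x, y, hxy, rfl⟩ := Finset.card_eq_two.1 (Finset.mem_powersetCard.1 hP).2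
    exact anchor_pair hn A hA x y hxy
  have h2 : ∀ T ∈ A, (Finset.bipartiteBelow (fun P T => P ⊆ T)
      (Finset.powersetCard 2 (Finset.univ : Finset V)) T).card = 3 := by
    intro T hT
    have : Finset.bipartiteBelow (fun P T => P ⊆ T)
      (Finset.powersetCard 2 (Finset.univ : Finset V)) T = Finset.powersetCard 2 T := by
      ext P
      simp [Finset.bipartiteBelow, Finset.mem_powersetCard, and_comm]
    rw [this, Finset.card_powersetCard, hA.1 T hT]
    rfl
  have h3 := Finset.card_nsmul_le_sum _ _ _ h1
  rw [h, Finset.sum_congr rfl h2, Finset.card_powersetCard, Finset.card_univ,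
    Nat.choose_two_right] at h3
  simp at h3
  omega
end

section
/- Let V be a set with n points, where n ≥ 5, and let C be a set of fewer than n(n−1)/2 three-point subsets of V. Then there exists a metric dist on V such that every triangle belonging to C is degenerate, and yet at least one triangle in V is nondegenerate. -/
/-- Three reals are always collinear. -/
lemma abs_line (x y z : ℝ) : |x - y| + |y - z| = |x - z| ∨ |y - x| + |x - z| = |y - z| ∨
    |x - z| + |z - y| = |x - y| := by
  rw [abs_sub_comm y x, abs_sub_comm z y]
  rcases abs_cases (x - y) with h1 | h1 <;> rcases abs_cases (y - z) with h2 | h2 <;>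
    rcases abs_cases (x - z) with h3 | h3 <;>
    first
    | (left; linarith)
    | (right; left; linarith)
    | (right; right; linarith)

/-- Some pair lies in at most two triples of `C`. -/
lemma exists_light_pair {V : Type*} [Fintype V] [DecidableEq V]
    (C : Finset (Finset V)) (h3 : ∀ T ∈ C, T.card = 3)
    (hC : C.card < Fintype.card V * (Fintype.card V - 1) / 2) :
    ∃ a b : V, a ≠ b ∧ (C.filter (fun T => a ∈ T ∧ b ∈ T)).card ≤ 2 := by
  by_contra! hcon
  have key := Finset.sum_card_bipartiteAbove_eq_sum_card_bipartiteBelow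
    (s := (Finset.univ : Finset V).powersetCard 2) (t := C) (fun p T => p ⊆ T)
  have h1 : ∀ T ∈ C, (Finset.bipartiteBelow (fun p T => p ⊆ T)
      ((Finset.univ : Finset V).powersetCard 2) T).card = 3 := by
    intro T hT
    have : Finset.bipartiteBelow (fun p T => p ⊆ T)
      ((Finset.univ : Finset V).powersetCard 2) T = T.powersetCard 2 := by
      ext p
      simp [Finset.mem_bipartiteBelow, Finset.mem_powersetCard, and_comm]
    rw [this, Finset.card_powersetCard, h3 T hT]
    rfl
  have h2 : ∀ p ∈ (Finset.univ : Finset V).powersetCard 2,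
      3 ≤ (Finset.bipartiteAbove (fun p T => p ⊆ T) C p).card := by
    intro p hp
    obtain ⟨a, b, hab, rfl⟩ := Finset.card_eq_two.1 (Finset.mem_powersetCard.1 hp).2
    have := hcon a b hab
    have e : Finset.bipartiteAbove (fun p T => p ⊆ T) C {a, b}
        = C.filter (fun T => a ∈ T ∧ b ∈ T) := by
      ext T
      simp [Finset.mem_bipartiteAbove, Finset.insert_subset_iff]
    rw [e]; omega
  have h4 := Finset.card_nsmul_le_sum _ _ _ h2
  rw [key, Finset.sum_congr rfl h1, Finset.card_powersetCard, Finset.card_univ,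
    Nat.choose_two_right] at h4
  simp at h4
  omega

/-- If `n ≥ 5` and `C` is a set of fewer than `n(n-1)/2` three-point subsets of an `n`-point
set `V`, then there is a metric on `V` making every triangle in `C` degenerate while some
triangle of `V` is nondegenerate. -/
theorem stmt9 {V : Type*} [Fintype V] [DecidableEq V]
    (n : ℕ) (hn : 5 ≤ n) (hcard : Fintype.card V = n)
    (C : Finset (Finset V)) (h3 : ∀ T ∈ C, T.card = 3)
    (hC : C.card < n * (n - 1) / 2) :
    ∃ d : V → V → ℝ, IsMetricD d ∧
      (∀ T ∈ C, ∃ r s t : V, T = {r, s, t} ∧ TriDegen d r s t) ∧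
      (∃ r s t : V, r ≠ s ∧ s ≠ t ∧ r ≠ t ∧ ¬ TriDegen d r s t) := by
  subst hcard
  obtain ⟨a, b, hab, hle⟩ := exists_light_pair C h3 hC
  set W : Finset V := Finset.univ.filter
    (fun x => x ≠ a ∧ x ≠ b ∧ ({a, b, x} : Finset V) ∈ C) with hW
  have hWc : W.card ≤ 2 := by
    refine le_trans (Finset.card_le_card_of_injOn (fun x => ({a, b, x} : Finset V)) ?_ ?_) hle
    · intro x hx
      simp only [hW, Finset.coe_filter, Finset.mem_univ, true_and, Set.mem_ofPred_eq] at hx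
      simp [hx.2.2]
    · intro x hx y hy hxy
      simp only [hW, Finset.coe_filter, Finset.mem_univ, true_and, Set.mem_ofPred_eq] at hx hy
      have : x ∈ ({a, b, y} : Finset V) := by
        have h : ({a, b, x} : Finset V) = {a, b, y} := hxy
        rw [← h]; simp
      simp at this
      tauto
  have hab2 : ({a, b} : Finset V).card = 2 := Finset.card_pair hab
  obtain ⟨U, hWU, hU, hUc⟩ := Finset.exists_subsuperset_card_eq
    (s := W) (t := Finset.univ \ {a, b}) (n := 2)
    (by intro x hx; simp [hW] at hx; simp; tauto) hWc
    (by rw [Finset.card_sdiff_of_subset (Finset.subset_univ _), Finset.card_univ]; omega)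
  obtain ⟨u, v, huv, rfl⟩ := Finset.card_eq_two.1 hUc
  have hu : u ≠ a ∧ u ≠ b := by
    have := hU (show u ∈ ({u, v} : Finset V) by simp)
    simpa using this
  have hv : v ≠ a ∧ v ≠ b := by
    have := hU (show v ∈ ({u, v} : Finset V) by simp)
    simpa using this
  obtain ⟨w, hw⟩ : ∃ w, w ∉ ({a, b, u, v} : Finset V) := by
    by_contra! h
    have h5 : (Finset.univ : Finset V) ⊆ {a, b, u, v} := fun x _ => h x
    have := Finset.card_le_card h5
    have h6 : ({a, b, u, v} : Finset V).card ≤ 4 := Finset.card_le_four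
    rw [Finset.card_univ] at this
    omega
  simp only [Finset.mem_insert, Finset.mem_singleton, not_or] at hw
  obtain ⟨e⟩ : Nonempty (V ≃ Fin (Fintype.card V)) := ⟨Fintype.equivFin V⟩
  obtain ⟨f, fa, fb, fu, fv, fo, finj⟩ : ∃ f : V → ℝ, f a = 0 ∧ f b = 0 ∧ f u = 1 ∧ f v = -1 ∧
      (∀ x, x ≠ a → x ≠ b → x ≠ u → x ≠ v → 2 ≤ f x) ∧
      (∀ x y, f x = f y → x = y ∨ (x = a ∧ y = b) ∨ (x = b ∧ y = a)) := by
    have hpos : ∀ x, (0 : ℝ) ≤ ((e x : ℕ) : ℝ) := fun x => Nat.cast_nonneg _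
    have hin : ∀ x y, ((e x : ℕ) : ℝ) = ((e y : ℕ) : ℝ) → x = y := by
      intro x y h
      exact e.injective (Fin.ext (by exact_mod_cast h))
    refine ⟨fun x => if x = a ∨ x = b then 0 else if x = u then 1 else if x = v then -1
      else 2 + ((e x : ℕ) : ℝ), by simp, by simp, by simp [hu], by simp [hv, huv.symm], ?_, ?_⟩
    · intro x h1 h2 h3 h4
      simp [h1, h2, h3, h4]
    · intro x y h
      have := hpos x
      have := hpos y
      have := hin x y
      dsimp only at h
      split_ifs at h <;> first | (exfalso; linarith) | grind
  have fge : ∀ x, x ≠ a → x ≠ b → 1 ≤ |f x| := by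
    intro x h1 h2
    by_cases h3 : x = u
    · rw [h3, fu]; simp
    by_cases h4 : x = v
    · rw [h4, fv]; simp
    have := fo x h1 h2 h3 h4
    exact le_trans (by linarith) (le_abs_self _)
  let P : V → V → Prop := fun x y => (x = a ∧ y = b) ∨ (x = b ∧ y = a)
  obtain ⟨d, hd1, hd2⟩ : ∃ d : V → V → ℝ, (∀ x y, P x y → d x y = 2) ∧
      (∀ x y, ¬ P x y → d x y = |f x - f y|) := by
    classical
    exact ⟨fun x y => if P x y then 2 else |f x - f y|, fun x y h => by simp [h],
      fun x y h => by simp [h]⟩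
  have dab : d a b = 2 := hd1 _ _ (Or.inl ⟨rfl, rfl⟩)
  have dba : d b a = 2 := hd1 _ _ (Or.inr ⟨rfl, rfl⟩)
  have da : ∀ x, x ≠ b → d a x = |f x| ∧ d x a = |f x| := by
    intro x hx
    rw [hd2 a x (by grind), hd2 x a (by grind), fa]
    simp
  have db : ∀ x, x ≠ a → d b x = |f x| ∧ d x b = |f x| := by
    intro x hx
    rw [hd2 b x (by grind), hd2 x b (by grind), fb]
    simp
  have dself : ∀ x, d x x = 0 := by
    intro x
    rw [hd2 x x (by grind)]; simp
  have dge : ∀ x y, |f x - f y| ≤ d x y := by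
    intro x y
    by_cases h : P x y
    · rw [hd1 x y h]
      rcases h with ⟨rfl, rfl⟩ | ⟨rfl, rfl⟩ <;> simp [fa, fb]
    · rw [hd2 x y h]
  refine ⟨d, ⟨?_, ?_, ?_⟩, ?_, ?_⟩
  · intro x y
    constructor
    · intro h
      by_cases hp : P x y
      · rw [hd1 x y hp] at h; norm_num at h
      · rw [hd2 x y hp, abs_eq_zero, sub_eq_zero] at h
        rcases finj x y h with h | h
        · exact h
        · exact absurd h hp
    · rintro rfl; exact dself x
  · intro x y
    by_cases hp : P x y
    · rw [hd1 x y hp, hd1 y x (by grind)]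
    · rw [hd2 x y hp, hd2 y x (by grind), abs_sub_comm]
  · intro x y z
    by_cases hp : P x z
    · rcases hp with ⟨rfl, rfl⟩ | ⟨rfl, rfl⟩
      · by_cases h1 : y = x
        · rw [h1, dself]; simp
        by_cases h2 : y = z
        · rw [h2, dself]; simp
        have := fge y h1 h2
        rw [dab, (da y h2).1, (db y h1).2]; linarith
      · by_cases h1 : y = x
        · rw [h1, dself]; simp
        by_cases h2 : y = z
        · rw [h2, dself]; simp
        have := fge y h2 h1
        rw [dba, (da y h1).2, (db y h2).1]; linarith
    · rw [hd2 x z hp]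
      exact (abs_sub_le _ (f y) _).trans (add_le_add (dge _ _) (dge _ _))
  · intro T hT
    by_cases hp : a ∈ T ∧ b ∈ T
    · have hsub : ({a, b} : Finset V) ⊆ T := by
        simp [Finset.insert_subset_iff, hp]
      have hc : (T \ {a, b}).card = 1 := by
        rw [Finset.card_sdiff_of_subset hsub, h3 T hT, hab2]
      obtain ⟨x, hx⟩ := Finset.card_eq_one.1 hc
      have hxm : x ∈ T \ {a, b} := by rw [hx]; simp
      simp at hxm
      have hTe : T = {a, b, x} := by
        rw [← Finset.union_sdiff_of_subset hsub, hx]; ext; simp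
      have hxW : x ∈ W := by
        rw [hW]; simp [hxm, ← hTe, hT]
      have hxU := hWU hxW
      have hfx : |f x| = 1 := by
        simp at hxU
        rcases hxU with rfl | rfl
        · rw [fu]; simp
        · rw [fv]; simp
      have hxa : x ≠ a := by tauto
      have hxb : x ≠ b := by tauto
      refine ⟨a, b, x, hTe, Or.inr (Or.inr ⟨hxa.symm, hxb, hab, ?_⟩)⟩
      rw [(da x hxb).1, (db x hxa).2, dab, hfx]; norm_num
    · obtain ⟨r, s, t, hrs, hrt, hst, rfl⟩ := Finset.card_eq_three.1 (h3 T hT)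
      simp only [Finset.mem_insert, Finset.mem_singleton] at hp
      refine ⟨r, s, t, rfl, ?_⟩
      have e1 := hd2 r s (by grind)
      have e2 := hd2 s t (by grind)
      have e3 := hd2 r t (by grind)
      have e4 := hd2 s r (by grind)
      have e5 := hd2 t s (by grind)
      unfold TriDegen MBtw
      rw [e1, e2, e3, e4, e5]
      simp only [ne_eq, hrs, hrt, hst, hrs.symm, hst.symm, not_false_eq_true, true_and]
      exact abs_line (f r) (f s) (f t)
  · obtain ⟨wa, wb, wu, wv⟩ := hw
    have h2 := fo w wa wb wu wv
    have h4 : |f w| = f w := abs_of_nonneg (by linarith)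
    refine ⟨a, b, w, hab, Ne.symm wb, Ne.symm wa, ?_⟩
    unfold TriDegen MBtw
    rw [dab, dba, (da w wb).1, (db w wa).1, (db w wa).2, h4]
    rintro (h | h | h) <;> linarith [h.2.2.2]
end

section
/- For every integer m with m ≥ 3 and every set X with exactly m elements, there exists a family F of exactly ⌈(m/3)·⌈(m−1)/2⌉⌉ three-element subsets of X such that every two-element subset of X is contained in at least one member of F. -/
/-- `X` has a family of at most `k` sets of size at most three covering all pairs. -/
def PairCov (X : Type*) [DecidableEq X] (k : ℕ) : Prop :=
  ∃ F : Finset (Finset X), (∀ T ∈ F, T.card ≤ 3) ∧ F.card ≤ k ∧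
    ∀ x y : X, x ≠ y → ∃ T ∈ F, x ∈ T ∧ y ∈ T

theorem PairCov.transport {X Y : Type*} [DecidableEq X] [DecidableEq Y] {k l : ℕ}
    (h : PairCov X k) (e : X ≃ Y) (hkl : k ≤ l) : PairCov Y l := by
  obtain ⟨F, h1, h2, h3⟩ := h
  refine ⟨F.image (fun T => T.image e), ?_, Finset.card_image_le.trans (h2.trans hkl), ?_⟩
  · intro T hT
    obtain ⟨S, hS, rfl⟩ := Finset.mem_image.1 hT
    exact Finset.card_image_le.trans (h1 S hS)
  · intro x y hxy
    obtain ⟨T, hT, hx, hy⟩ := h3 (e.symm x) (e.symm y) (by simpa using hxy)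
    exact ⟨T.image e, Finset.mem_image_of_mem _ hT,
      Finset.mem_image.2 ⟨_, hx, by simp⟩, Finset.mem_image.2 ⟨_, hy, by simp⟩⟩

/-- The family of sets indexed by a finite type. -/
theorem PairCov.union {X ι : Type*} [DecidableEq X] [Fintype ι] {k l : ℕ} (F : Finset (Finset X))
    (h1 : ∀ T ∈ F, T.card ≤ 3) (h2 : F.card ≤ k) (a b c : ι → X) (hl : k + Fintype.card ι ≤ l)
    (h : ∀ x y : X, x ≠ y → (∃ T ∈ F, x ∈ T ∧ y ∈ T) ∨ (∃ T ∈ F, y ∈ T ∧ x ∈ T) ∨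
      (∃ j, (x = a j ∨ x = b j ∨ x = c j) ∧ (y = a j ∨ y = b j ∨ y = c j))) :
    PairCov X l := by
  refine ⟨F ∪ Finset.univ.image (fun j => {a j, b j, c j}), ?_, ?_, ?_⟩
  · intro T hT
    rcases Finset.mem_union.1 hT with hT | hT
    · exact h1 T hT
    · obtain ⟨j, -, rfl⟩ := Finset.mem_image.1 hT
      exact Finset.card_le_three
  · have h3 : (Finset.univ.image (fun j => ({a j, b j, c j} : Finset X))).card ≤ Fintype.card ι :=
      Finset.card_image_le
    have := Finset.card_union_le F (Finset.univ.image (fun j => ({a j, b j, c j} : Finset X)))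
    omega
  · intro x y hxy
    rcases h x y hxy with ⟨T, hT, hx, hy⟩ | ⟨T, hT, hx, hy⟩ | ⟨j, hx, hy⟩
    · exact ⟨T, Finset.mem_union_left _ hT, hx, hy⟩
    · exact ⟨T, Finset.mem_union_left _ hT, hy, hx⟩
    · exact ⟨_, Finset.mem_union_right _ (Finset.mem_image_of_mem _ (Finset.mem_univ j)),
        by simpa using hx, by simpa using hy⟩

/-- Bose-type core: all pairs in a level, and all mixed pairs but the diagonal ones. -/
theorem core {Q X : Type*} [AddCommGroup Q] [Fintype Q] [DecidableEq Q] [DecidableEq X]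
    (g : Fin 3 → Q ≃ Q) (e : Q × Fin 3 → X) :
    ∃ F : Finset (Finset X), (∀ T ∈ F, T.card ≤ 3) ∧ F.card ≤ 3 * (Fintype.card Q).choose 2 ∧
      (∀ i x y, x ≠ y → ∃ T ∈ F, e (x, i) ∈ T ∧ e (y, i) ∈ T) ∧
      (∀ i x z, z ≠ g i (x + x) → ∃ T ∈ F, e (x, i) ∈ T ∧ e (z, i + 1) ∈ T) := by
  let B : Finset Q × Fin 3 → Finset X := fun q =>
    insert (e (g q.2 (∑ x ∈ q.1, x), q.2 + 1)) (q.1.image (fun x => e (x, q.2)))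
  have key : ∀ i x y, x ≠ y → ∃ T ∈ (Finset.powersetCard 2 (Finset.univ : Finset Q) ×ˢ
      (Finset.univ : Finset (Fin 3))).image B,
      e (x, i) ∈ T ∧ e (y, i) ∈ T ∧ e (g i (x + y), i + 1) ∈ T := by
    intro i x y hxy
    refine ⟨B ({x, y}, i), Finset.mem_image_of_mem _ ?_, ?_, ?_, ?_⟩
    · simp [Finset.mem_powersetCard, Finset.card_pair hxy]
    · simp [B]
    · simp [B]
    · simp [B, Finset.sum_pair hxy]
  refine ⟨(Finset.powersetCard 2 (Finset.univ : Finset Q) ×ˢ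
      (Finset.univ : Finset (Fin 3))).image B, ?_, ?_, ?_, ?_⟩
  · intro T hT
    obtain ⟨q, hq, rfl⟩ := Finset.mem_image.1 hT
    have hq' : q.1.card = 2 := by
      have := (Finset.mem_product.1 hq).1
      exact (Finset.mem_powersetCard.1 this).2
    have h1 := Finset.card_insert_le (e (g q.2 (∑ x ∈ q.1, x), q.2 + 1))
      (q.1.image (fun x => e (x, q.2)))
    have h2 : (q.1.image (fun x => e (x, q.2))).card ≤ q.1.card := Finset.card_image_le
    simp only [B]
    omega
  · refine Finset.card_image_le.trans ?_
    simp [Finset.card_product, Finset.card_powersetCard, mul_comm]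
  · intro i x y hxy
    obtain ⟨T, hT, h1, h2, -⟩ := key i x y hxy
    exact ⟨T, hT, h1, h2⟩
  · intro i x z hz
    have hne : x ≠ (g i).symm z - x := by
      intro h
      apply hz
      have : x + x = (g i).symm z := by
        nth_rewrite 2 [h]; abel
      rw [this]; simp
    obtain ⟨T, hT, h1, -, h2⟩ := key i x _ hne
    refine ⟨T, hT, h1, ?_⟩
    simpa using h2

/-- Any two points of `Q × Fin 3`, up to swap, are on the same level or on consecutive levels. -/
theorem level_cases {Q : Type*} (P : Q × Fin 3 → Q × Fin 3 → Prop)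
    (hs : ∀ x y, P x y → P y x)
    (h1 : ∀ i x y, x ≠ y → P (x, i) (y, i))
    (h2 : ∀ i x y, P (x, i) (y, i + 1)) : ∀ x y, x ≠ y → P x y := by
  rintro ⟨x, i⟩ ⟨y, j⟩ hxy
  have : j = i ∨ j = i + 1 ∨ i = j + 1 := by
    clear hxy; revert i j; decide
  rcases this with rfl | rfl | rfl
  · exact h1 _ _ _ (by rintro rfl; exact hxy rfl)
  · exact h2 _ _ _
  · exact hs _ _ (h2 _ _ _)

theorem zmod_split (t : ℕ) (ht : 0 < t) (x : ZMod (2 * t)) :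
    ∃ a : Fin t, x = (a.val : ZMod (2 * t)) ∨ x = (a.val : ZMod (2 * t)) + (t : ZMod (2 * t)) := by
  have : NeZero (2 * t) := ⟨by omega⟩
  have hx := ZMod.val_lt x
  by_cases h : x.val < t
  · exact ⟨⟨x.val, h⟩, Or.inl (by simp)⟩
  · refine ⟨⟨x.val - t, by omega⟩, Or.inr ?_⟩
    rw [← Nat.cast_add]
    simp only
    rw [Nat.sub_add_cancel (by omega)]
    simp

theorem zmod_tt (t : ℕ) : (t : ZMod (2 * t)) + (t : ZMod (2 * t)) = 0 := by
  have h := ZMod.natCast_self (2 * t)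
  rw [two_mul, Nat.cast_add] at h
  rw [two_mul]
  exact h

theorem choose_even (t : ℕ) (ht : 0 < t) : (2 * t).choose 2 = t * (2 * t - 1) := by
  rw [Nat.choose_two_right, mul_assoc, Nat.mul_div_cancel_left _ (by norm_num)]

theorem choose_odd (t : ℕ) : (2 * t + 1).choose 2 = (2 * t + 1) * t := by
  rw [Nat.choose_two_right]
  have : (2 * t + 1) * (2 * t + 1 - 1) = 2 * ((2 * t + 1) * t) := by
    rw [Nat.add_sub_cancel]; ring
  rw [this, Nat.mul_div_cancel_left _ (by norm_num)]

theorem case0 (t : ℕ) (ht : 0 < t) : PairCov (ZMod (2 * t) × Fin 3) (6 * t ^ 2) := by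
  have : NeZero (2 * t) := ⟨by omega⟩
  obtain ⟨F, h1, h2, h3, h4⟩ := core (Q := ZMod (2 * t)) (fun _ => Equiv.refl _) id
  refine PairCov.union (ι := Fin t × Fin 3) F h1 h2
    (fun j => ((j.1.val : ZMod (2 * t)), j.2))
    (fun j => ((j.1.val : ZMod (2 * t)) + (t : ZMod (2 * t)), j.2))
    (fun j => ((j.1.val : ZMod (2 * t)) + (j.1.val : ZMod (2 * t)), j.2 + 1)) ?_ ?_
  · simp only [ZMod.card, choose_even t ht, Fintype.card_prod, Fintype.card_fin]
    obtain ⟨s, rfl⟩ : ∃ s, t = s + 1 := ⟨t - 1, by omega⟩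
    have : 2 * (s + 1) - 1 = 2 * s + 1 := by omega
    rw [this]; nlinarith
  · apply level_cases
    · rintro x y (h | h | ⟨j, h, h'⟩)
      exacts [Or.inr (Or.inl h), Or.inl h, Or.inr (Or.inr ⟨j, h', h⟩)]
    · intro i x y hxy
      exact Or.inl (h3 i x y hxy)
    · intro i x z
      by_cases hz : z = x + x
      · right; right
        obtain ⟨a, rfl | rfl⟩ := zmod_split t ht x
        · exact ⟨(a, i), by simp, by simp [hz]⟩
        · refine ⟨(a, i), by simp, Or.inr (Or.inr ?_)⟩
          rw [hz]
          have := zmod_tt t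
          simp only [Prod.mk.injEq, and_true]
          linear_combination this
      · exact Or.inl (h4 i x z hz)

/-- Halving, as a permutation of `ZMod (2 t + 1)`. -/
theorem half_equiv (t : ℕ) : ∃ g : ZMod (2 * t + 1) ≃ ZMod (2 * t + 1), ∀ x, g (x + x) = x := by
  have h : (2 : ZMod (2 * t + 1)) * (t + 1) = 1 := by
    have h := ZMod.natCast_self (2 * t + 1)
    push_cast at h
    linear_combination h
  refine ⟨⟨fun x => (t + 1) * x, fun x => x + x, ?_, ?_⟩, ?_⟩
  · intro x; linear_combination x * h
  · intro x; simp only; linear_combination x * h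
  · intro x; simp only [Equiv.coe_fn_mk]; linear_combination x * h

theorem case3 (t : ℕ) : PairCov (ZMod (2 * t + 1) × Fin 3) (6 * t ^ 2 + 5 * t + 1) := by
  obtain ⟨g, hg⟩ := half_equiv t
  obtain ⟨F, h1, h2, h3, h4⟩ := core (Q := ZMod (2 * t + 1)) (fun _ => g) id
  refine PairCov.union (ι := ZMod (2 * t + 1)) F h1 h2
    (fun j => (j, 0)) (fun j => (j, 1)) (fun j => (j, 2)) ?_ ?_
  · simp only [ZMod.card, choose_odd t]
    nlinarith
  · apply level_cases
    · rintro x y (h | h | ⟨j, h, h'⟩)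
      exacts [Or.inr (Or.inl h), Or.inl h, Or.inr (Or.inr ⟨j, h', h⟩)]
    · intro i x y hxy
      exact Or.inl (h3 i x y hxy)
    · intro i x z
      by_cases hz : z = x
      · right; right
        refine ⟨x, ?_, ?_⟩ <;> fin_cases i <;> simp [hz]
      · exact Or.inl (h4 i x z (by rwa [hg]))

theorem half_even (t : ℕ) (ht : 0 < t) : ∃ g : ZMod (2 * t) ≃ ZMod (2 * t),
    ∀ a : Fin t, g ((a.val : ZMod (2 * t)) + (a.val : ZMod (2 * t))) = (a.val : ZMod (2 * t)) := by
  have : NeZero (2 * t) := ⟨by omega⟩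
  have inj : ∀ a b : ℕ, a < 2 * t → b < 2 * t → (a : ZMod (2 * t)) = b → a = b := by
    intro a b ha hb h
    have := congrArg ZMod.val h
    rwa [ZMod.val_natCast_of_lt ha, ZMod.val_natCast_of_lt hb] at this
  obtain ⟨g, hg⟩ := Finset.exists_equiv_extend_of_card_eq
    (α := ZMod (2 * t)) (β := ZMod (2 * t)) (t := Finset.univ) (by simp)
    (s := Finset.univ.image (fun a : Fin t => (a.val : ZMod (2 * t))))
    (f := fun x => x + x) (by simp) (by
      intro x hx y hy hxy
      simp only [Finset.coe_image, Finset.coe_univ, Set.image_univ, Set.mem_range] at hx hy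
      obtain ⟨a, rfl⟩ := hx
      obtain ⟨b, rfl⟩ := hy
      simp only [← Nat.cast_add] at hxy
      have := inj _ _ (by omega) (by omega) hxy
      have : a.val = b.val := by omega
      rw [this])
  let u : {x // x ∈ (Finset.univ : Finset (ZMod (2 * t)))} ≃ ZMod (2 * t) :=
    Equiv.subtypeUnivEquiv (by simp)
  refine ⟨(g.trans u).symm, fun a => ?_⟩
  rw [Equiv.symm_apply_eq]
  exact (hg _ (Finset.mem_image_of_mem _ (Finset.mem_univ a))).symm

theorem case1 (t : ℕ) (ht : 0 < t) : PairCov (Option (ZMod (2 * t) × Fin 3)) (6 * t ^ 2 + t) := by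
  have : NeZero (2 * t) := ⟨by omega⟩
  obtain ⟨g, hg⟩ := half_even t ht
  obtain ⟨F, h1, h2, h3, h4⟩ := core (Q := ZMod (2 * t)) (fun _ => g) some
  refine PairCov.union (ι := Fin t ⊕ (Fin t × Fin 3)) F h1 h2
    (Sum.elim (fun j => some ((j.val : ZMod (2 * t)), 0)) (fun _ => none))
    (Sum.elim (fun j => some ((j.val : ZMod (2 * t)), 1))
      (fun j => some ((j.1.val : ZMod (2 * t)) + (t : ZMod (2 * t)), j.2)))
    (Sum.elim (fun j => some ((j.val : ZMod (2 * t)), 2))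
      (fun j => some ((j.1.val : ZMod (2 * t)), j.2 + 1))) ?_ ?_
  · simp only [ZMod.card, choose_even t ht, Fintype.card_prod, Fintype.card_fin, Fintype.card_sum]
    obtain ⟨s, rfl⟩ : ∃ s, t = s + 1 := ⟨t - 1, by omega⟩
    have : 2 * (s + 1) - 1 = 2 * s + 1 := by omega
    rw [this]; nlinarith
  · have hinf : ∀ p : ZMod (2 * t) × Fin 3, ∃ j : Fin t × Fin 3,
        p = ((j.1.val : ZMod (2 * t)) + (t : ZMod (2 * t)), j.2) ∨
        p = ((j.1.val : ZMod (2 * t)), j.2 + 1) := by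
      rintro ⟨x, i⟩
      obtain ⟨a, rfl | rfl⟩ := zmod_split t ht x
      · exact ⟨(a, i - 1), Or.inr (by simp)⟩
      · exact ⟨(a, i), Or.inl rfl⟩
    rintro (_ | p) (_ | q) hpq
    · exact absurd rfl hpq
    · obtain ⟨j, hj⟩ := hinf q
      exact Or.inr (Or.inr ⟨Sum.inr j, Or.inl rfl, by simpa using hj⟩)
    · obtain ⟨j, hj⟩ := hinf p
      exact Or.inr (Or.inr ⟨Sum.inr j, by simpa using hj, Or.inl rfl⟩)
    · have hpq' : p ≠ q := fun h => hpq (by rw [h])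
      clear hpq
      revert p q
      apply level_cases
      · rintro x y (h | h | ⟨j, h, h'⟩)
        exacts [Or.inr (Or.inl h), Or.inl h, Or.inr (Or.inr ⟨j, h', h⟩)]
      · intro i x y hxy
        exact Or.inl (h3 i x y hxy)
      · intro i x z
        by_cases hz : z = g (x + x)
        · right; right
          obtain ⟨a, rfl | rfl⟩ := zmod_split t ht x
          · rw [hg] at hz
            refine ⟨Sum.inl a, ?_, ?_⟩ <;> fin_cases i <;> simp [hz]
          · have hz' : z = (a.val : ZMod (2 * t)) := by
              rw [hz, ← hg a]
              congr 1
              rw [hg]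
              linear_combination zmod_tt t
            exact ⟨Sum.inr (a, i), by simp, by simp [hz']⟩
        · exact Or.inl (h4 i x z hz)

theorem case5 (t : ℕ) : PairCov ((ZMod (2 * t + 1) × Fin 3) ⊕ Bool) (6 * t ^ 2 + 9 * t + 4) := by
  obtain ⟨g, hg⟩ := half_equiv t
  obtain ⟨F, h1, h2, h3, h4⟩ := core (Q := ZMod (2 * t + 1))
    (fun i => g.trans (Equiv.addRight (if i = 2 then 1 else 0)))
    (Sum.inl : _ → (ZMod (2 * t + 1) × Fin 3) ⊕ Bool)
  obtain ⟨v, hv⟩ : ∃ v : ℕ → ZMod (2 * t + 1) × Fin 3, ∀ j,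
      v j = (((j / 3 : ℕ) : ZMod (2 * t + 1)), ⟨j % 3, Nat.mod_lt _ (by norm_num)⟩) :=
    ⟨_, fun _ => rfl⟩
  have hsurj : ∀ p, ∃ j, j ≤ 6 * t + 2 ∧ p = v j := by
    rintro ⟨x, i⟩
    have hx := ZMod.val_lt x
    refine ⟨3 * x.val + i.val, by omega, ?_⟩
    rw [hv]
    have e1 : (3 * x.val + i.val) / 3 = x.val := by omega
    have e2 : (3 * x.val + i.val) % 3 = i.val := by omega
    simp [e1, e2]
  have hnext : ∀ j x i, v j = (x, i) →
      v (j + 1) = (x + (if i = 2 then 1 else 0), i + 1) := by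
    intro j x i h
    rw [hv] at h
    rw [Prod.mk.injEq] at h
    obtain ⟨rfl, rfl⟩ := h
    rw [hv]
    have : j % 3 = 0 ∨ j % 3 = 1 ∨ j % 3 = 2 := by omega
    rcases this with h | h | h
    · have e1 : (j + 1) / 3 = j / 3 := by omega
      have e2 : (j + 1) % 3 = 1 := by omega
      simp [e1, e2, h]
    · have e1 : (j + 1) / 3 = j / 3 := by omega
      have e2 : (j + 1) % 3 = 2 := by omega
      simp [e1, e2, h]
    · have e1 : (j + 1) / 3 = j / 3 + 1 := by omega
      have e2 : (j + 1) % 3 = 0 := by omega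
      simp [e1, e2, h]
  have hwrap : v (6 * t + 2 + 1) = v 0 := by
    rw [hv, hv]
    have e1 : (6 * t + 2 + 1) / 3 = 2 * t + 1 := by omega
    have e2 : (6 * t + 2 + 1) % 3 = 0 := by omega
    simp only [e1, e2, ZMod.natCast_self]
    simp
  refine PairCov.union (ι := Fin (6 * t + 2) ⊕ Bool) F h1 h2
    (Sum.elim (fun j => Sum.inr (decide (j.val % 2 = 0))) (fun _ => Sum.inr true))
    (Sum.elim (fun j => Sum.inl (v j.val)) (fun _ => Sum.inl (v 0)))
    (Sum.elim (fun j => Sum.inl (v (j.val + 1)))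
      (fun b => if b then Sum.inr false else Sum.inl (v (6 * t + 2)))) ?_ ?_
  · simp only [ZMod.card, choose_odd t, Fintype.card_fin, Fintype.card_sum, Fintype.card_bool]
    nlinarith
  · have hinf : ∀ (b : Bool) (p : ZMod (2 * t + 1) × Fin 3),
        (∃ j : Fin (6 * t + 2), b = decide (j.val % 2 = 0) ∧ (p = v j.val ∨ p = v (j.val + 1))) ∨
        (b = true ∧ p = v (6 * t + 2)) ∨ (b = false ∧ p = v 0) := by
      intro b p
      obtain ⟨j, hj, rfl⟩ := hsurj p
      by_cases hb : b = decide (j % 2 = 0)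
      · by_cases hj2 : j = 6 * t + 2
        · right; left
          refine ⟨?_, by rw [hj2]⟩
          rw [hb, decide_eq_true_iff]; omega
        · left
          exact ⟨⟨j, by omega⟩, hb, Or.inl rfl⟩
      · by_cases hj0 : j = 0
        · right; right
          subst hj0
          simpa using hb
        · left
          refine ⟨⟨j - 1, by omega⟩, ?_, Or.inr ?_⟩
          · have : ((j - 1) % 2 = 0) ↔ ¬ (j % 2 = 0) := by omega
            simp only [this]
            cases b <;> simp_all
          · simp only
            rw [Nat.sub_add_cancel (by omega)]
    have hinf' : ∀ (b : Bool) (p : ZMod (2 * t + 1) × Fin 3),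
        ∃ j : Fin (6 * t + 2) ⊕ Bool, 
        ((Sum.inr b : (ZMod (2 * t + 1) × Fin 3) ⊕ Bool) =
            Sum.elim (fun j => Sum.inr (decide (j.val % 2 = 0))) (fun _ => Sum.inr true) j ∨
          (Sum.inr b : (ZMod (2 * t + 1) × Fin 3) ⊕ Bool) =
            Sum.elim (fun j => Sum.inl (v j.val)) (fun _ => Sum.inl (v 0)) j ∨
          (Sum.inr b : (ZMod (2 * t + 1) × Fin 3) ⊕ Bool) =
            Sum.elim (fun j => Sum.inl (v (j.val + 1)))
              (fun b => if b then Sum.inr false else Sum.inl (v (6 * t + 2))) j) ∧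
        ((Sum.inl p : (ZMod (2 * t + 1) × Fin 3) ⊕ Bool) =
            Sum.elim (fun j => Sum.inr (decide (j.val % 2 = 0))) (fun _ => Sum.inr true) j ∨
          (Sum.inl p : (ZMod (2 * t + 1) × Fin 3) ⊕ Bool) =
            Sum.elim (fun j => Sum.inl (v j.val)) (fun _ => Sum.inl (v 0)) j ∨
          (Sum.inl p : (ZMod (2 * t + 1) × Fin 3) ⊕ Bool) =
            Sum.elim (fun j => Sum.inl (v (j.val + 1)))
              (fun b => if b then Sum.inr false else Sum.inl (v (6 * t + 2))) j) := by
      intro b p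
      rcases hinf b p with ⟨j, hb, hp⟩ | ⟨rfl, rfl⟩ | ⟨rfl, rfl⟩
      · refine ⟨Sum.inl j, Or.inl (by simp [hb]), Or.inr ?_⟩
        rcases hp with rfl | rfl
        · exact Or.inl rfl
        · exact Or.inr rfl
      · exact ⟨Sum.inr false, Or.inl rfl, Or.inr (Or.inr (by simp))⟩
      · exact ⟨Sum.inr true, Or.inr (Or.inr (by simp)), Or.inr (Or.inl rfl)⟩
    rintro (p | b) (q | c) hpq
    · have hpq' : p ≠ q := fun h => hpq (by rw [h])
      clear hpq
      revert p q
      apply level_cases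
      · rintro x y (h | h | ⟨j, h, h'⟩)
        exacts [Or.inr (Or.inl h), Or.inl h, Or.inr (Or.inr ⟨j, h', h⟩)]
      · intro i x y hxy
        exact Or.inl (h3 i x y hxy)
      · intro i x z
        by_cases hz : z = x + (if i = 2 then 1 else 0)
        · right; right
          obtain ⟨j, hj, hjv⟩ := hsurj (x, i)
          have hn := hnext j x i hjv.symm
          rw [← hz] at hn
          by_cases hj2 : j = 6 * t + 2
          · subst hj2
            rw [hwrap] at hn
            exact ⟨Sum.inr false, Or.inr (Or.inr (by simp [hjv])), Or.inr (Or.inl (by simp [hn]))⟩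
          · exact ⟨Sum.inl ⟨j, by omega⟩, Or.inr (Or.inl (by simp [hjv])),
              Or.inr (Or.inr (by simp [hn]))⟩
        · exact Or.inl (h4 i x z (by simpa [hg] using hz))
    · obtain ⟨j, hb, hp⟩ := hinf' c p
      exact Or.inr (Or.inr ⟨j, hp, hb⟩)
    · obtain ⟨j, hb, hp⟩ := hinf' b q
      exact Or.inr (Or.inr ⟨j, hb, hp⟩)
    · refine Or.inr (Or.inr ⟨Sum.inr true, ?_, ?_⟩)
      · cases b <;> simp
      · cases c <;> simp

/-- Adding a point to a set of odd size. -/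
theorem add_point (s k : ℕ) (h : PairCov (Fin (2 * s + 1)) k) :
    PairCov (Option (Fin (2 * s + 1))) (k + (s + 1)) := by
  obtain ⟨F, h1, h2, h3⟩ := h
  refine PairCov.union (k := k) (ι := Fin (s + 1)) (F.image (fun T => T.image some)) ?_
    (Finset.card_image_le.trans h2) (fun _ => none) (fun j => some ⟨2 * j.val, by omega⟩)
    (fun j => some ⟨min (2 * j.val + 1) (2 * s), by omega⟩) (by simp) ?_
  · intro T hT
    obtain ⟨S, hS, rfl⟩ := Finset.mem_image.1 hT
    exact Finset.card_image_le.trans (h1 S hS)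
  · have hinf : ∀ p : Fin (2 * s + 1), ∃ j : Fin (s + 1),
        p = ⟨2 * j.val, by omega⟩ ∨ p = ⟨min (2 * j.val + 1) (2 * s), by omega⟩ := by
      intro p
      refine ⟨⟨p.val / 2, by omega⟩, ?_⟩
      simp only [Fin.ext_iff]
      omega
    rintro (_ | p) (_ | q) hpq
    · exact absurd rfl hpq
    · obtain ⟨j, hj⟩ := hinf q
      exact Or.inr (Or.inr ⟨j, Or.inl rfl, by simpa using hj⟩)
    · obtain ⟨j, hj⟩ := hinf p
      exact Or.inr (Or.inr ⟨j, by simpa using hj, Or.inl rfl⟩)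
    · obtain ⟨T, hT, hp, hq⟩ := h3 p q (fun h => hpq (by rw [h]))
      exact Or.inl ⟨T.image some, Finset.mem_image_of_mem _ hT,
        Finset.mem_image_of_mem _ hp, Finset.mem_image_of_mem _ hq⟩

theorem div3_eq {a b c : ℕ} (h : a = 3 * b + c) (hc : c ≤ 2) : b ≤ (a + 2) / 3 := by omega

theorem exists_cov (m : ℕ) (hm : 3 ≤ m) : PairCov (Fin m) ((m * (m / 2) + 2) / 3) := by
  have c1 : ∀ t, 0 < t → PairCov (Fin (6 * t + 1)) (6 * t ^ 2 + t) := fun t ht => by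
    have : NeZero (2 * t) := ⟨by omega⟩
    refine (case1 t ht).transport (Fintype.equivFinOfCardEq ?_) le_rfl
    simp only [Fintype.card_option, Fintype.card_prod, ZMod.card, Fintype.card_fin]; omega
  have c3 : ∀ t, PairCov (Fin (6 * t + 3)) (6 * t ^ 2 + 5 * t + 1) := fun t => by
    refine (case3 t).transport (Fintype.equivFinOfCardEq ?_) le_rfl
    simp only [Fintype.card_prod, ZMod.card, Fintype.card_fin]; omega
  obtain ⟨t, r, hr, rfl⟩ : ∃ t r, r < 6 ∧ m = 6 * t + r :=
    ⟨m / 6, m % 6, Nat.mod_lt _ (by norm_num), (Nat.div_add_mod m 6).symm⟩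
  interval_cases r
  · have ht : 0 < t := by omega
    have : NeZero (2 * t) := ⟨by omega⟩
    refine (case0 t ht).transport (Fintype.equivFinOfCardEq ?_) ?_
    · simp only [Fintype.card_prod, ZMod.card, Fintype.card_fin]; omega
    · rw [show (6 * t + 0) / 2 = 3 * t by omega]
      exact div3_eq (c := 0) (by ring) (by norm_num)
  · refine (c1 t (by omega)).transport (Equiv.refl _) ?_
    rw [show (6 * t + 1) / 2 = 3 * t by omega]
    exact div3_eq (c := 0) (by ring) (by norm_num)
  · have h := c1 t (by omega)
    rw [show 6 * t + 1 = 2 * (3 * t) + 1 by ring] at h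
    refine (add_point _ _ h).transport (Fintype.equivFinOfCardEq ?_) ?_
    · simp only [Fintype.card_option, Fintype.card_fin]; omega
    · rw [show (6 * t + 2) / 2 = 3 * t + 1 by omega]
      apply Nat.le_of_eq
      symm
      rw [show (6 * t + 2) * (3 * t + 1) + 2 = (6 * t ^ 2 + t + (3 * t + 1)) * 3 + 1 by ring]
      omega
  · refine (c3 t).transport (Equiv.refl _) ?_
    rw [show (6 * t + 3) / 2 = 3 * t + 1 by omega]
    exact div3_eq (c := 0) (by ring) (by norm_num)
  · have h := c3 t
    rw [show 6 * t + 3 = 2 * (3 * t + 1) + 1 by ring] at h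
    refine (add_point _ _ h).transport (Fintype.equivFinOfCardEq ?_) ?_
    · simp only [Fintype.card_option, Fintype.card_fin]; omega
    · rw [show (6 * t + 4) / 2 = 3 * t + 2 by omega]
      apply Nat.le_of_eq
      symm
      rw [show (6 * t + 4) * (3 * t + 2) + 2 = 
        (6 * t ^ 2 + 5 * t + 1 + (3 * t + 1 + 1)) * 3 + 1 by ring]
      omega
  · refine (case5 t).transport (Fintype.equivFinOfCardEq ?_) ?_
    · simp only [Fintype.card_sum, Fintype.card_bool, Fintype.card_prod, ZMod.card,
        Fintype.card_fin]
      omega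
    · rw [show (6 * t + 5) / 2 = 3 * t + 2 by omega]
      apply Nat.le_of_eq
      symm
      rw [show (6 * t + 5) * (3 * t + 2) + 2 = (6 * t ^ 2 + 9 * t + 4) * 3 by ring]
      omega

theorem ceil_formula (m : ℕ) :
    ⌈(m : ℚ) / 3 * ((⌈((m : ℚ) - 1) / 2⌉ : ℤ) : ℚ)⌉ = (((m * (m / 2) + 2) / 3 : ℕ) : ℤ) := by
  have e1 : ⌈((m : ℚ) - 1) / 2⌉ = ((m / 2 : ℕ) : ℤ) := by
    rw [Int.ceil_eq_iff]
    obtain ⟨h1, h2⟩ : 2 * (m / 2) ≤ m ∧ m ≤ 2 * (m / 2) + 1 := by omega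
    have h1' : (2 : ℚ) * ((m / 2 : ℕ) : ℚ) ≤ m := by exact_mod_cast h1
    have h2' : (m : ℚ) ≤ 2 * ((m / 2 : ℕ) : ℚ) + 1 := by exact_mod_cast h2
    rw [Int.cast_natCast]
    constructor <;> linarith
  rw [e1, Int.ceil_eq_iff]
  generalize m / 2 = s
  obtain ⟨h1, h2⟩ : m * s ≤ 3 * ((m * s + 2) / 3) ∧ 3 * ((m * s + 2) / 3) ≤ m * s + 2 := by omega
  have h1' : (m : ℚ) * s ≤ 3 * (((m * s + 2) / 3 : ℕ) : ℚ) := by exact_mod_cast h1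
  have h2' : 3 * (((m * s + 2) / 3 : ℕ) : ℚ) ≤ (m : ℚ) * s + 2 := by exact_mod_cast h2
  simp only [Int.cast_natCast]
  constructor <;> linarith

theorem le_choose3 (m : ℕ) (hm : 3 ≤ m) : (m * (m / 2) + 2) / 3 ≤ m.choose 3 := by
  rcases Nat.lt_or_ge m 4 with h | h
  · obtain rfl : m = 3 := by omega
    decide
  · obtain ⟨n, rfl⟩ : ∃ n, m = n + 4 := ⟨m - 4, by omega⟩
    have h6 : 6 * (n + 4).choose 3 = (n + 4) * (n + 3) * (n + 2) := by
      have := Nat.descFactorial_eq_factorial_mul_choose (n + 4) 3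
      simp [Nat.descFactorial, Nat.factorial] at this
      rw [← this]
      ring
    have h1 : 2 * ((n + 4) / 2) ≤ n + 4 := by omega
    have h2 : (n + 4) * (2 * ((n + 4) / 2)) ≤ (n + 4) * (n + 4) := Nat.mul_le_mul_left _ h1
    have h3 : 3 * (((n + 4) * ((n + 4) / 2) + 2) / 3) ≤ (n + 4) * ((n + 4) / 2) + 2 := by omega
    have h4 : (n + 4) * (n + 4) + 4 ≤ (n + 4) * (n + 3) * (n + 2) := by nlinarith [sq_nonneg n]
    nlinarith

/-- Fort--Hedlund: for every `m ≥ 3` and every `m`-element set `X`, there is a family of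
exactly `⌈(m/3)·⌈(m-1)/2⌉⌉` three-element subsets of `X` covering all two-element subsets
of `X`. -/
theorem stmt11 {X : Type*} [Fintype X] [DecidableEq X]
    (m : ℕ) (hm : 3 ≤ m) (hcard : Fintype.card X = m) :
    ∃ F : Finset (Finset X), (∀ T ∈ F, T.card = 3) ∧
      (F.card : ℤ) = ⌈(m : ℚ) / 3 * ((⌈((m : ℚ) - 1) / 2⌉ : ℤ) : ℚ)⌉ ∧
      ∀ p : Finset X, p.card = 2 → ∃ T ∈ F, p ⊆ T := by
  have hc := (exists_cov m hm).transport (Fintype.equivFinOfCardEq hcard).symm le_rfl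
  obtain ⟨F, h1, h2, h3⟩ := hc
  have hex : ∀ T : Finset X, ∃ S : Finset X, T.card ≤ 3 → T ⊆ S ∧ S.card = 3 := by
    intro T
    by_cases hT : T.card ≤ 3
    · obtain ⟨S, hS, hS'⟩ := Finset.exists_superset_card_eq hT (by omega)
      exact ⟨S, fun _ => ⟨hS, hS'⟩⟩
    · exact ⟨T, fun h => absurd h hT⟩
  choose f hf using hex
  have hsub : F.image f ⊆ Finset.powersetCard 3 Finset.univ := by
    intro T hT
    obtain ⟨S, hS, rfl⟩ := Finset.mem_image.1 hT
    exact Finset.mem_powersetCard.2 ⟨Finset.subset_univ _, (hf S (h1 S hS)).2⟩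
  obtain ⟨G, hG1, hG2, hG3⟩ := Finset.exists_subsuperset_card_eq hsub
    (Finset.card_image_le.trans h2)
    (by rw [Finset.card_powersetCard, Finset.card_univ, hcard]; exact le_choose3 m hm)
  refine ⟨G, fun T hT => (Finset.mem_powersetCard.1 (hG2 hT)).2, ?_, ?_⟩
  · rw [ceil_formula, hG3]
  · intro p hp
    obtain ⟨x, y, hxy, rfl⟩ := Finset.card_eq_two.1 hp
    obtain ⟨T, hT, hx, hy⟩ := h3 x y hxy
    have hs := (hf T (h1 T hT)).1
    refine ⟨f T, hG1 (Finset.mem_image_of_mem _ hT), ?_⟩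
    intro z hz
    rcases Finset.mem_insert.1 hz with rfl | hz
    · exact hs hx
    · rw [Finset.mem_singleton.1 hz]; exact hs hy
end

section
/- Let (V, dist) be a metric space on the five-point set {a, b, x, y, z}, where a, b, x, y, z are pairwise distinct. Suppose that each of the three four-point subspaces {a,b,y,z}, {a,b,x,z}, and {a,b,x,y} (that is, each four-point subspace that does not contain all of x, y, z) is linear. Then the triangle {x, y, z} is degenerate. -/
/-- The position on the line of a point `p`, computed from its distances to `a` and `b`. -/
noncomputable def linePos {V : Type*} [MetricSpace V] (a b p : V) : ℝ :=
  (dist p a ^ 2 - dist p b ^ 2 + dist b a ^ 2) / (2 * dist b a)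

theorem linePos_isometry {V : Type*} [MetricSpace V] {a b : V} (hab : a ≠ b) {S : Set V}
    (ha : a ∈ S) (hb : b ∈ S)
    (h : ∃ f : V → ℝ, ∀ p ∈ S, ∀ q ∈ S, |f p - f q| = dist p q)
    {p q : V} (hp : p ∈ S) (hq : q ∈ S) : |linePos a b p - linePos a b q| = dist p q := by
  obtain ⟨f, hf⟩ := h
  have hD : 0 < dist b a := dist_pos.2 hab.symm
  have key : ∀ r ∈ S, linePos a b r = (f r - f a) * (f b - f a) / dist b a := by
    intro r hr
    have e : dist r a ^ 2 - dist r b ^ 2 + dist b a ^ 2 = 2 * ((f r - f a) * (f b - f a)) := by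
      rw [← hf r hr a ha, ← hf r hr b hb, ← hf b hb a ha, sq_abs, sq_abs, sq_abs]
      ring
    rw [linePos, e, mul_div_mul_left _ _ two_ne_zero]
  have e : linePos a b p - linePos a b q = (f p - f q) * (f b - f a) / dist b a := by
    rw [key p hp, key q hq]
    ring
  rw [e, abs_div, abs_mul, hf p hp q hq, hf b hb a ha, abs_of_pos hD,
    mul_div_cancel_right₀ _ hD.ne']

/-- In a metric space on the five pairwise distinct points `{a, b, x, y, z}`, if each of the
three four-point subspaces `{a,b,y,z}`, `{a,b,x,z}`, `{a,b,x,y}` is linear (isometric to a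
subset of ℝ), then the triangle `{x, y, z}` is degenerate. -/
theorem stmt13 {V : Type*} [MetricSpace V] (a b x y z : V)
    (hdist : List.Pairwise (· ≠ ·) [a, b, x, y, z])
    (hV : ∀ v : V, v = a ∨ v = b ∨ v = x ∨ v = y ∨ v = z)
    (h₁ : ∃ f : V → ℝ, ∀ p ∈ ({a, b, y, z} : Set V), ∀ q ∈ ({a, b, y, z} : Set V),
      |f p - f q| = dist p q)
    (h₂ : ∃ f : V → ℝ, ∀ p ∈ ({a, b, x, z} : Set V), ∀ q ∈ ({a, b, x, z} : Set V),
      |f p - f q| = dist p q)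
    (h₃ : ∃ f : V → ℝ, ∀ p ∈ ({a, b, x, y} : Set V), ∀ q ∈ ({a, b, x, y} : Set V),
      |f p - f q| = dist p q) :
    TriDegen (fun p q : V => dist p q) x y z := by
  simp only [List.pairwise_cons, List.mem_cons, List.not_mem_nil, or_false, forall_eq_or_imp,
    forall_eq] at hdist
  obtain ⟨⟨hab, -⟩, -, ⟨hxy, hxz⟩, hyz, -⟩ := hdist
  have hyz' := linePos_isometry hab (by simp) (by simp) h₁ (p := y) (q := z) (by simp) (by simp)
  have hxz' := linePos_isometry hab (by simp) (by simp) h₂ (p := x) (q := z) (by simp) (by simp)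
  have hxy' := linePos_isometry hab (by simp) (by simp) h₃ (p := x) (q := y) (by simp) (by simp)
  have main : dist x y + dist y z = dist x z ∨ dist x y + dist x z = dist y z ∨
      dist x z + dist y z = dist x y := by
    rw [← hyz', ← hxz', ← hxy']
    generalize linePos a b x = X
    generalize linePos a b y = Y
    generalize linePos a b z = Z
    grind
  rcases main with h | h | h
  · exact Or.inl ⟨hxy, hyz, hxz, h⟩
  · exact Or.inr (Or.inl ⟨hxy.symm, hxz, hyz, by simpa only [dist_comm y x] using h⟩)
  · exact Or.inr (Or.inr ⟨hxz, hyz.symm, hxy, by simpa only [dist_comm z y] using h⟩)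
end

section
/- Let n ≥ 5 and let V = {x, y, z₁, z₂, …, z_{n−2}} be a set of n distinct points. Consider the connected graph G on vertex set V whose edges are z₁x, xz₂, z₁y, yz₂, z₂z₃, z₃z₄, …, z_{n−3}z_{n−2}, and equip V with the shortest-path metric of G. Then a triangle in this metric space is nondegenerate if and only if it is one of {x, y, z₃}, {x, y, z₄}, …, {x, y, z_{n−2}}. -/
/-- height above `z₁` -/
def hgt (a : ℕ) : ℕ := if a = 2 then 0 else if a ≤ 1 then 1 else a - 1

/-- explicit distance -/
def fdist (a b : ℕ) : ℕ :=
  if (a = 0 ∧ b = 1) ∨ (a = 1 ∧ b = 0) then 2 else (hgt a - hgt b) + (hgt b - hgt a)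

def adjN (a b : ℕ) : Prop :=
  (a = 0 ∧ b = 2) ∨ (a = 0 ∧ b = 3) ∨ (a = 1 ∧ b = 2) ∨ (a = 1 ∧ b = 3) ∨ (3 ≤ a ∧ b = a + 1)

lemma fdist_step (u v w : ℕ) (h : adjN u v ∨ adjN v u) : fdist u w ≤ fdist v w + 1 := by
  unfold fdist hgt
  unfold adjN at h
  split_ifs <;> omega

lemma hgt_spec (a : ℕ) : (a = 2 ∧ hgt a = 0) ∨ (a ≤ 1 ∧ hgt a = 1) ∨ (3 ≤ a ∧ a = hgt a + 1) := by
  unfold hgt; split_ifs <;> omega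

lemma fdist_spec (a b : ℕ) : (a + b = 1 ∧ fdist a b = 2) ∨
    (a + b ≠ 1 ∧ hgt a ≤ hgt b ∧ fdist a b + hgt a = hgt b) ∨
    (a + b ≠ 1 ∧ hgt b ≤ hgt a ∧ fdist a b + hgt b = hgt a) := by
  unfold fdist; split_ifs <;> omega

lemma fdist_next (n u v k : ℕ) (hn : 5 ≤ n) (hu : u < n) (hv : v < n) (h : fdist u v = k + 1) :
    ∃ w, w < n ∧ (adjN u w ∨ adjN w u) ∧ fdist w v = k := by
  have key : ∀ w, w < n → (adjN u w ∨ adjN w u) → fdist w v + 1 = fdist u v →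
      ∃ w, w < n ∧ (adjN u w ∨ adjN w u) ∧ fdist w v = k :=
    fun w h1 h2 h3 => ⟨w, h1, h2, by omega⟩
  have huv : u ≠ v := by
    rintro rfl
    unfold fdist at h
    split_ifs at h <;> omega
  clear h
  by_cases h1 : u ≤ 1
  · by_cases h2 : v = 2
    · apply key 2 (by omega) (by unfold adjN; omega)
      have := fdist_spec u v
      have := fdist_spec 2 v
      have := hgt_spec u
      have := hgt_spec v
      have := hgt_spec 2
      omega
    · apply key 3 (by omega) (by unfold adjN; omega)
      have := fdist_spec u v
      have := fdist_spec 3 v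
      have := hgt_spec u
      have := hgt_spec v
      have := hgt_spec 3
      omega
  by_cases h2 : u = 2
  · by_cases h3 : v = 1
    · apply key 1 (by omega) (by unfold adjN; omega)
      have := fdist_spec u v
      have := fdist_spec 1 v
      have := hgt_spec u
      have := hgt_spec v
      have := hgt_spec 1
      omega
    · apply key 0 (by omega) (by unfold adjN; omega)
      have := fdist_spec u v
      have := fdist_spec 0 v
      have := hgt_spec u
      have := hgt_spec v
      have := hgt_spec 0
      omega
  by_cases h4 : u < v
  · apply key (u + 1) (by omega) (by unfold adjN; omega)
    have := fdist_spec u v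
    have := fdist_spec (u + 1) v
    have := hgt_spec u
    have := hgt_spec v
    have := hgt_spec (u + 1)
    omega
  by_cases h3 : u = 3
  · by_cases h5 : v ≤ 1
    · apply key v (by omega) (by unfold adjN; omega)
      have := fdist_spec u v
      have := fdist_spec v v
      have := hgt_spec u
      have := hgt_spec v
      have := hgt_spec v
      omega
    · apply key 0 (by omega) (by unfold adjN; omega)
      have := fdist_spec u v
      have := fdist_spec 0 v
      have := hgt_spec u
      have := hgt_spec v
      have := hgt_spec 0
      omega
  · apply key (u - 1) (by omega) (by unfold adjN; omega)
    have := fdist_spec u v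
    have := fdist_spec (u - 1) v
    have := hgt_spec u
    have := hgt_spec v
    have := hgt_spec (u - 1)
    omega

lemma fdist_zero (u v : ℕ) (h : fdist u v = 0) : u = v := by
  unfold fdist hgt at h
  split_ifs at h <;> omega

lemma fdist_self (u : ℕ) : fdist u u = 0 := by
  unfold fdist; split_ifs <;> omega

set_option maxHeartbeats 2000000 in
lemma fdist_degen (r s t : ℕ) (h1 : r ≠ s) (h2 : s ≠ t) (h3 : r ≠ t) :
    ¬ (fdist r s + fdist s t = fdist r t ∨ fdist s r + fdist r t = fdist s t ∨
      fdist r t + fdist t s = fdist r s) ↔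
    ((r = 0 ∧ s = 1 ∧ 4 ≤ t) ∨ (r = 1 ∧ s = 0 ∧ 4 ≤ t) ∨ (r = 0 ∧ t = 1 ∧ 4 ≤ s) ∨
     (r = 1 ∧ t = 0 ∧ 4 ≤ s) ∨ (s = 0 ∧ t = 1 ∧ 4 ≤ r) ∨ (s = 1 ∧ t = 0 ∧ 4 ≤ r)) := by
  have c : ∀ a b, fdist a b = fdist b a := by
    intro a b; unfold fdist; split_ifs <;> omega
  rw [c s r, c t s]
  have e1 := fdist_spec r s
  have e2 := fdist_spec s t
  have e3 := fdist_spec r t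
  have g1 := hgt_spec r
  have g2 := hgt_spec s
  have g3 := hgt_spec t
  clear c
  generalize fdist r s = A at *
  generalize fdist s t = B at *
  generalize fdist r t = C at *
  generalize hgt r = x at *
  generalize hgt s = y at *
  generalize hgt t = z at *
  constructor
  · intro h
    have hs : r + s = 1 ∨ s + t = 1 ∨ r + t = 1 := by
      by_contra hc
      clear g1 g2 g3
      obtain ⟨c1, c2⟩ := not_or.1 hc
      obtain ⟨c2, c3⟩ := not_or.1 c2
      replace e1 := e1.resolve_left (fun q => c1 q.1)
      replace e2 := e2.resolve_left (fun q => c2 q.1)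
      replace e3 := e3.resolve_left (fun q => c3 q.1)
      omega
    rcases hs with hs | hs | hs
    · have h4 : 4 ≤ t := by
        have hx : x = 1 := by omega
        have hy : y = 1 := by omega
        clear g1 g2
        omega
      clear h e1 e2 e3 g1 g2 g3
      omega
    · have h4 : 4 ≤ r := by
        have hx : z = 1 := by omega
        have hy : y = 1 := by omega
        clear g3 g2
        omega
      clear h e1 e2 e3 g1 g2 g3
      omega
    · have h4 : 4 ≤ s := by
        have hx : x = 1 := by omega
        have hy : z = 1 := by omega
        clear g1 g3
        omega
      clear h e1 e2 e3 g1 g2 g3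
      omega
  · intro h
    rcases h with h | h | h | h | h | h <;> omega

/-- Let `n ≥ 5`, and identify the `n`-point set `V = {x, y, z₁, …, z_{n-2}}` with `Fin n`
via `x = 0`, `y = 1`, and `zₖ = k + 1` (for `1 ≤ k ≤ n - 2`).  Let `G` be the graph on `V`
with edges `z₁x, xz₂, z₁y, yz₂, z₂z₃, z₃z₄, …, z_{n-3}z_{n-2}`.  Then `G` is connected and,
in the shortest-path metric of `G`, a triangle is nondegenerate if and only if it is one of
`{x, y, z₃}, {x, y, z₄}, …, {x, y, z_{n-2}}`. -/
theorem stmt14 (n : ℕ) (hn : 5 ≤ n)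
    (G : SimpleGraph (Fin n))
    (hG : G = SimpleGraph.fromRel (fun a b : Fin n =>
      ((a : ℕ) = 0 ∧ (b : ℕ) = 2) ∨    -- x z₁
      ((a : ℕ) = 0 ∧ (b : ℕ) = 3) ∨    -- x z₂
      ((a : ℕ) = 1 ∧ (b : ℕ) = 2) ∨    -- y z₁
      ((a : ℕ) = 1 ∧ (b : ℕ) = 3) ∨    -- y z₂
      (3 ≤ (a : ℕ) ∧ (b : ℕ) = (a : ℕ) + 1)))  -- zₖ z_{k+1} for k ≥ 2
    (d : Fin n → Fin n → ℝ) (hd : ∀ u v : Fin n, d u v = G.dist u v) :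
    G.Connected ∧
    ∀ r s t : Fin n, r ≠ s → s ≠ t → r ≠ t →
      (¬ TriDegen d r s t ↔
        ∃ m : Fin n, 4 ≤ (m : ℕ) ∧
          ({r, s, t} : Finset (Fin n)) = {⟨0, by omega⟩, ⟨1, by omega⟩, m}) := by
  have hadj : ∀ u v : Fin n, G.Adj u v ↔ (adjN u v ∨ adjN v u) := by
    intro u v
    subst hG
    rw [SimpleGraph.fromRel_adj]
    unfold adjN
    constructor
    · rintro ⟨_, h⟩; exact h
    · intro h
      refine ⟨?_, h⟩
      rintro rfl
      omega
  have lower : ∀ (u v : Fin n) (p : G.Walk u v), fdist u v ≤ p.length := by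
    intro u v p
    induction p with
    | nil => simp [fdist_self]
    | @cons a b c h p ih =>
      have := fdist_step a b c ((hadj _ _).1 h)
      rw [SimpleGraph.Walk.length_cons]
      omega
  have upper : ∀ (k : ℕ) (u v : Fin n), fdist u v = k → ∃ p : G.Walk u v, p.length = k := by
    intro k
    induction k with
    | zero =>
      intro u v h
      obtain rfl : u = v := Fin.ext (fdist_zero _ _ h)
      exact ⟨.nil, rfl⟩
    | succ k ih =>
      intro u v h
      obtain ⟨w, hw, ha, hf⟩ := fdist_next n u v k hn u.2 v.2 h
      obtain ⟨p, hp⟩ := ih ⟨w, hw⟩ v hf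
      exact ⟨.cons ((hadj u ⟨w, hw⟩).2 ha) p, by simp [hp]⟩
  have conn : G.Connected := by
    have : Nonempty (Fin n) := ⟨⟨0, by omega⟩⟩
    exact ⟨fun u v => ⟨(upper _ u v rfl).choose⟩⟩
  have hdist : ∀ u v : Fin n, G.dist u v = fdist u v := by
    intro u v
    apply le_antisymm
    · obtain ⟨p, hp⟩ := upper _ u v rfl
      rw [← hp]; exact SimpleGraph.dist_le p
    · obtain ⟨p, hp⟩ := conn.exists_walk_length_eq_dist u v
      rw [← hp]; exact lower u v p
  refine ⟨conn, fun r s t h1 h2 h3 => ?_⟩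
  have key := fdist_degen r s t (Fin.val_ne_of_ne h1) (Fin.val_ne_of_ne h2) (Fin.val_ne_of_ne h3)
  have hT : TriDegen d r s t ↔ (fdist r s + fdist s t = fdist r t ∨
      fdist s r + fdist r t = fdist s t ∨ fdist r t + fdist t s = fdist r s) := by
    unfold TriDegen MBtw
    simp only [hd, hdist]
    norm_cast
    simp [h1, h2, h3, h1.symm, h2.symm]
  rw [hT, key]
  simp only [Finset.ext_iff, Finset.mem_insert, Finset.mem_singleton, Fin.ext_iff]
  constructor
  · intro h
    have : ∃ m : Fin n, (m = r ∨ m = s ∨ m = t) ∧ 4 ≤ (m : ℕ) := by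
      rcases h with h | h | h | h | h | h
      · exact ⟨t, by simp, h.2.2⟩
      · exact ⟨t, by simp, h.2.2⟩
      · exact ⟨s, by simp, h.2.2⟩
      · exact ⟨s, by simp, h.2.2⟩
      · exact ⟨r, by simp, h.2.2⟩
      · exact ⟨r, by simp, h.2.2⟩
    obtain ⟨m, hm, h4⟩ := this
    refine ⟨m, h4, fun a => ?_⟩
    simp only [Fin.ext_iff] at hm
    omega
  · rintro ⟨m, h4, h⟩
    have a1 := h r
    have a2 := h s
    have a3 := h t
    have n1 := Fin.val_ne_of_ne h1
    have n2 := Fin.val_ne_of_ne h2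
    have n3 := Fin.val_ne_of_ne h3
    simp only [true_or, or_true, true_iff] at a1 a2 a3
    omega
end
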